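/- arXiv:1302.6954 — 2 statements merged into one kernel-verified Lean document; each statement's English description precedes it below -/
import Mathlib

section
/- Let f : 𝕋² → 𝕋² be a homeomorphism homotopic to the identity with lift f̃ : ℝ² → ℝ². If f̃ has no fixed point, then for every integer q ≥ 1 the iterate f̃^q has no fixed point. Equivalently, the rotation vector (0,0) is realized by a periodic orbit of f (there exist q ≥ 1 and x ∈ ℝ² with f̃^q(x) = x) if and only if f̃ has a fixed point. -/
open Filter Topology Set Function

noncomputable section

/-- The torus 𝕋² = ℝ²/ℤ². -/
abbrev T2 : Type := AddCircle (1 : ℝ) × AddCircle (1 : ℝ)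

/-- The canonical projection π : ℝ² → 𝕋². -/
def proj : ℝ × ℝ → T2 := fun p => ((p.1 : AddCircle (1 : ℝ)), (p.2 : AddCircle (1 : ℝ)))

/-- `F` is a lift of `f`: it projects to `f` and commutes with integer translations. -/
def IsLift (f : T2 → T2) (F : ℝ × ℝ → ℝ × ℝ) : Prop :=
  (∀ x, proj (F x) = f (proj x)) ∧
    ∀ (x : ℝ × ℝ) (v : ℤ × ℤ),
      F (x + ((v.1 : ℝ), (v.2 : ℝ))) = F x + ((v.1 : ℝ), (v.2 : ℝ))


open Complex in
lemma exp_diff_const {X : Type*} [TopologicalSpace X] {K : Set X} (hK : IsPreconnected K)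
    {f g : X → ℂ} (hf : ContinuousOn f K) (hg : ContinuousOn g K)
    (h : ∀ x ∈ K, exp (f x) = exp (g x)) :
    ∃ n : ℤ, ∀ x ∈ K, f x = g x + n * (2 * Real.pi * I) := by
  rcases K.eq_empty_or_nonempty with rfl | ⟨a, ha⟩
  · exact ⟨0, by simp⟩
  obtain ⟨n, hn⟩ := exp_eq_exp_iff_exists_int.1 (h a ha)
  refine ⟨n, ?_⟩
  have := isCoveringMap_exp.eqOn_of_comp_eqOn hK (g₁ := f)
    (g₂ := fun x => g x + n * (2 * Real.pi * I)) hf (hg.add continuousOn_const) ?_ ha hn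
  · exact this
  · intro x hx
    apply Subtype.ext
    simp only [Function.comp]
    rw [h x hx]
    exact exp_eq_exp_iff_exists_int.2 ⟨-n, by push_cast; ring⟩

open Complex in
lemma exists_log_lift {E : Type*} [AddCommGroup E] [Module ℝ E] [TopologicalSpace E]
    [IsTopologicalAddGroup E] [ContinuousSMul ℝ E] {K : Set E} (hK : Convex ℝ K)
    {g : E → ℂ} (hg : ContinuousOn g K) (h0 : ∀ x ∈ K, g x ≠ 0) :
    ∃ l : E → ℂ, ContinuousOn l K ∧ ∀ x ∈ K, exp (l x) = g x := by
  classical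
  rcases K.eq_empty_or_nonempty with rfl | ⟨a, ha⟩
  · exact ⟨0, by simp⟩
  have hmem : ∀ p : unitInterval × K, a + (p.1 : ℝ) • ((p.2 : E) - a) ∈ K := fun p =>
    hK.add_smul_sub_mem ha p.2.2 p.1.2
  let H : C(unitInterval × K, {z : ℂ // z ≠ 0}) :=
    ⟨fun p => ⟨g (a + (p.1 : ℝ) • ((p.2 : E) - a)), h0 _ (hmem p)⟩, by
      apply Continuous.subtype_mk
      exact hg.comp_continuous (by fun_prop) hmem⟩
  let f : C(K, ℂ) := ContinuousMap.const _ (log (g a))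
  have H0 : ∀ x, H (0, x) = (fun z : ℂ ↦ (⟨_, z.exp_ne_zero⟩ : {z : ℂ // z ≠ 0})) (f x) := by
    intro x
    apply Subtype.ext
    simp [H, f, exp_log (h0 a ha)]
  let L := isCoveringMap_exp.liftHomotopy H f H0
  have hL := isCoveringMap_exp.liftHomotopy_lifts H f H0
  refine ⟨fun x => if hx : x ∈ K then L (1, ⟨x, hx⟩) else 0, ?_, ?_⟩
  · rw [continuousOn_iff_continuous_domRestrict]
    have : K.domRestrict (fun x => if hx : x ∈ K then L (1, ⟨x, hx⟩) else 0)
        = fun x : K => L (1, x) := by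
      ext x; simp [Set.domRestrict]
    rw [this]
    fun_prop
  · intro x hx
    simp only [hx, dif_pos]
    have := congrArg Subtype.val (congrFun hL (1, ⟨x, hx⟩))
    have e : a + (1 : ℝ) • (x - a) = x := by simp
    exact this.trans (congrArg g e)

open Complex in
/-- angular variation: complex logarithm of the difference quotient, on the universal cover of
the space of pairs of distinct points. -/
lemma exists_angle (F : ℂ ≃ₜ ℂ) (B : ℝ) (hB : ∀ w, ‖F w - w‖ ≤ B) :
    ∃ L : ℂ × ℂ → ℂ, Continuous L ∧
      (∀ a z, exp (L (a, z)) = (F (a + exp z) - F a) / exp z) ∧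
      (∀ a z, L (a, z + 2 * Real.pi * I) = L (a, z)) ∧
      (∀ a z, L (a + exp z, z + Real.pi * I) = L (a, z)) := by
  have hB0 : 0 ≤ B := (norm_nonneg _).trans (hB 0)
  have hFc : Continuous F := F.continuous
  obtain ⟨L, hLc, hL⟩ := exists_log_lift (E := ℂ × ℂ) (K := univ) convex_univ
    (g := fun p => (F (p.1 + exp p.2) - F p.1) / exp p.2)
    (by
      apply Continuous.continuousOn
      exact Continuous.div (by fun_prop) (by fun_prop) (fun x => exp_ne_zero _))
    (by
      intro p _
      refine div_ne_zero ?_ (exp_ne_zero _)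
      rw [sub_ne_zero]
      intro h
      have := F.injective h
      simp [exp_ne_zero] at this)
  rw [continuousOn_univ] at hLc
  have hL' : ∀ a z, exp (L (a, z)) = (F (a + exp z) - F a) / exp z := fun a z => hL (a, z) trivial
  have hexp : ∀ z : ℂ, exp (z + 2 * Real.pi * I) = exp z := exp_periodic
  have hexp2 : ∀ z : ℂ, exp (z + Real.pi * I) = - exp z := exp_antiperiodic
  have hpi : (2 * Real.pi * I : ℂ) ≠ 0 := by simp [Real.pi_ne_zero]
  have h1 : ∀ a z, L (a, z + 2 * Real.pi * I) = L (a, z) := by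
    obtain ⟨n, hn⟩ := exp_diff_const (X := ℂ × ℂ) (K := univ) isPreconnected_univ
      (f := fun p => L (p.1, p.2 + 2 * Real.pi * I)) (g := L)
      (by fun_prop) (by fun_prop) (by
        rintro ⟨a, z⟩ _
        simp only [hL', hexp])
    -- far away
    let c : ℂ := (Real.log (2 * B + 1) : ℝ)
    have hq : ∀ y : ℝ, exp (L (0, c + y * I)) ∈ slitPlane := by
      intro y
      set v := exp (c + y * I) with hv
      have hvn : ‖v‖ = 2 * B + 1 := by
        rw [hv, norm_exp]
        simp [c]
        rw [Real.exp_log (by linarith)]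
      have hv0 : v ≠ 0 := exp_ne_zero _
      rw [hL', zero_add, ← hv]
      apply mem_slitPlane_of_norm_lt_one (z := (F v - F 0) / v - 1) |> fun h => ?_
      have : ‖(F v - F 0) / v - 1‖ < 1 := by
        rw [div_sub_one hv0, norm_div, hvn, div_lt_one (by linarith)]
        have e : F v - F 0 - v = (F v - v) - (F 0 - 0) := by ring
        rw [e]
        have := norm_sub_le (F v - v) (F 0 - 0)
        linarith [hB v, hB 0]
      have h2 := mem_slitPlane_of_norm_lt_one this
      simpa using h2
    obtain ⟨m, hm⟩ := exp_diff_const (X := ℝ) (K := univ) isPreconnected_univ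
      (f := fun y => L (0, c + y * I)) (g := fun y => log (exp (L (0, c + y * I))))
      (by fun_prop) (by
        apply Continuous.continuousOn
        exact Continuous.clog (by fun_prop) hq) (by
        intro y _
        rw [exp_log (exp_ne_zero _)])
    have e1 := hm 0 trivial
    have e2 := hm (2 * Real.pi) trivial
    have e3 := hn (0, c) trivial
    simp only [ofReal_zero, zero_mul, add_zero] at e1
    simp only [ofReal_mul, ofReal_ofNat] at e2
    have e4 : exp (L (0, c + 2 * Real.pi * I)) = exp (L (0, c)) := by
      rw [hL', hL', hexp]
    rw [e4, ← e1] at e2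
    simp only at e3
    rw [e2] at e3
    have hn0 : (n : ℂ) = 0 := by
      have : (n : ℂ) * (2 * Real.pi * I) = 0 := by linear_combination -e3
      exact (mul_eq_zero.1 this).resolve_right hpi
    intro a z
    have := hn (a, z) trivial
    simpa [hn0] using this
  refine ⟨L, hLc, hL', h1, ?_⟩
  obtain ⟨n, hn⟩ := exp_diff_const (X := ℂ × ℂ) (K := univ) isPreconnected_univ
      (f := fun p => L (p.1 + exp p.2, p.2 + Real.pi * I)) (g := L)
      (by fun_prop) (by fun_prop) (by
        rintro ⟨a, z⟩ _
        simp only [hL', hexp2]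
        rw [div_eq_div_iff (by simp [exp_ne_zero]) (exp_ne_zero _)]
        rw [add_neg_cancel_right]
        ring)
  have e1 := hn (0, 0) trivial
  have e2 := hn (0 + exp 0, 0 + Real.pi * I) trivial
  simp only at e1 e2
  have e3 : (0 : ℂ) + exp 0 + exp (0 + Real.pi * I) = 0 := by rw [hexp2]; ring
  have e4 : (0 : ℂ) + Real.pi * I + Real.pi * I = 0 + 2 * Real.pi * I := by ring
  rw [e3, e4, h1, e1] at e2
  have hn0 : (n : ℂ) = 0 := by
    have : (n : ℂ) * (2 * Real.pi * I) = 0 := by linear_combination -e2 / 2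
    exact (mul_eq_zero.1 this).resolve_right hpi
  intro a z
  have := hn (a, z) trivial
  simpa [hn0] using this

open Complex in
lemma core_min (Γ : ℝ → ℂ) (hc : ContinuousOn Γ (Ici 0))
    (hinj : ∀ t t', 0 ≤ t → t < t' → t' ≤ t + 1 → Γ t ≠ Γ t')
    (s0 e0 : ℝ) (hs0 : 0 ≤ s0) (hse : s0 < e0) (heq : Γ s0 = Γ e0) :
    ∃ s e, 0 ≤ s ∧ s + 1 < e ∧ Γ s = Γ e ∧
      ∀ t t', s ≤ t → t < t' → t' ≤ e → t' - t < e - s → Γ t ≠ Γ t' := by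
  have hfar : ∀ t t', 0 ≤ t → t < t' → Γ t = Γ t' → t + 1 < t' := by
    intro t t' h0 h1 h2
    by_contra h
    exact hinj t t' h0 h1 (not_lt.1 h) h2
  let K : Set (ℝ × ℝ) := Icc s0 e0 ×ˢ Icc s0 e0
  have hK : IsCompact K := isCompact_Icc.prod isCompact_Icc
  let g : ℝ × ℝ → ℂ × ℝ := fun p => (Γ p.1 - Γ p.2, p.2 - p.1)
  have hg : ContinuousOn g K := by
    have h1 : ContinuousOn (fun p : ℝ × ℝ => Γ p.1) K :=
      hc.comp continuousOn_fst (fun p hp => hs0.trans hp.1.1)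
    have h2 : ContinuousOn (fun p : ℝ × ℝ => Γ p.2) K :=
      hc.comp continuousOn_snd (fun p hp => hs0.trans hp.2.1)
    exact (h1.sub h2).prodMk (by fun_prop)
  have hcl : IsClosed (({0} : Set ℂ) ×ˢ (Ici (1 : ℝ))) := isClosed_singleton.prod isClosed_Ici
  have hQ : IsCompact (K ∩ g ⁻¹' (({0} : Set ℂ) ×ˢ (Ici (1 : ℝ)))) :=
    hK.of_isClosed_subset (hg.preimage_isClosed_of_isClosed hK.isClosed hcl) inter_subset_left
  have hne : (K ∩ g ⁻¹' (({0} : Set ℂ) ×ˢ (Ici (1 : ℝ)))).Nonempty := by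
    refine ⟨(s0, e0), ⟨⟨⟨le_rfl, hse.le⟩, ⟨hse.le, le_rfl⟩⟩, ?_, ?_⟩⟩
    · simp [g, heq]
    · have := hfar s0 e0 hs0 hse heq
      simp only [g, mem_Ici]; linarith
  obtain ⟨⟨s, e⟩, hmem, hmin⟩ := hQ.exists_isMinOn hne
    (f := fun p : ℝ × ℝ => p.2 - p.1) (by fun_prop)
  obtain ⟨⟨⟨hs1, hs2⟩, ⟨he1, he2⟩⟩, hz, h1⟩ := hmem
  simp only [g, mem_singleton_iff, mem_Ici, sub_eq_zero] at hz h1 hs1 hs2 he1 he2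
  have hs : 0 ≤ s := hs0.trans hs1
  refine ⟨s, e, hs, hfar s e hs (by linarith) hz, hz, ?_⟩
  intro t t' ht htt ht' hlt h
  have h3 := hfar t t' (hs.trans ht) htt h
  have : e - s ≤ t' - t := isMinOn_iff.1 hmin (t, t')
    ⟨⟨⟨by simp only; linarith, by simp only; linarith⟩, ⟨by simp only; linarith, by simp only; linarith⟩⟩,
      by simp [g, h], by simp only [g, mem_Ici]; linarith⟩
  linarith

open Complex in
lemma core_false (F : ℂ ≃ₜ ℂ) (B : ℝ) (hB : ∀ w, ‖F w - w‖ ≤ B) (hfix : ∀ w, F w ≠ w)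
    (Γ : ℝ → ℂ) (hc : ContinuousOn Γ (Ici 0)) (hstep : ∀ t, 0 ≤ t → Γ (t + 1) = F (Γ t))
    (hinj : ∀ t t', 0 ≤ t → t < t' → t' ≤ t + 1 → Γ t ≠ Γ t')
    (s0 e0 : ℝ) (hs0 : 0 ≤ s0) (hse : s0 < e0) (heq : Γ s0 = Γ e0) : False := by
  obtain ⟨s, e, hs, hes, hΓ, hT⟩ := core_min Γ hc hinj s0 e0 hs0 hse heq
  obtain ⟨L, hLc, hL, hL1, hL2⟩ := exists_angle F B hB
  have hFc : Continuous F := F.continuous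
  have hLn : ∀ a z (n : ℤ), L (a, z + n * (2 * Real.pi * I)) = L (a, z) := by
    intro a z n
    have : Function.Periodic (fun z => L (a, z)) (2 * Real.pi * I) := hL1 a
    exact this.int_mul n z
  have hexp2 : ∀ z : ℂ, exp (z + Real.pi * I) = - exp z := exp_antiperiodic
  obtain ⟨A, hAc, hA⟩ := exists_log_lift (E := ℂ) (K := univ) convex_univ
    (g := fun a => F a - a) (by fun_prop) (fun a _ => sub_ne_zero.2 (hfix a))
  let d : ℝ × ℝ →ₗ[ℝ] ℝ := LinearMap.snd ℝ ℝ ℝ - LinearMap.fst ℝ ℝ ℝ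
  let fs : ℝ × ℝ →ₗ[ℝ] ℝ := LinearMap.fst ℝ ℝ ℝ
  let sn : ℝ × ℝ →ₗ[ℝ] ℝ := LinearMap.snd ℝ ℝ ℝ
  let S : Set (ℝ × ℝ) := fs ⁻¹' Ici 0 ∩ d ⁻¹' Ioc 0 1
  let T : Set (ℝ × ℝ) := (fs ⁻¹' Ici s ∩ sn ⁻¹' Iic e) ∩ d ⁻¹' Ioo 0 (e - s)
  let T' : Set (ℝ × ℝ) := (fs ⁻¹' Ici s ∩ sn ⁻¹' Iic (e - 1)) ∩ d ⁻¹' Ioi 0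
  have hSc : Convex ℝ S :=
    ((convex_Ici 0).linear_preimage fs).inter ((convex_Ioc 0 1).linear_preimage d)
  have hTc : Convex ℝ T :=
    (((convex_Ici s).linear_preimage fs).inter ((convex_Iic e).linear_preimage sn)).inter
      ((convex_Ioo 0 (e - s)).linear_preimage d)
  have hT'c : Convex ℝ T' :=
    (((convex_Ici s).linear_preimage fs).inter ((convex_Iic (e - 1)).linear_preimage sn)).inter
      ((convex_Ioi 0).linear_preimage d)
  have memS : ∀ t t' : ℝ, (t, t') ∈ S ↔ 0 ≤ t ∧ t < t' ∧ t' ≤ t + 1 := by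
    intro t t'
    simp only [S, fs, d, mem_inter_iff, mem_preimage, LinearMap.fst_apply, LinearMap.sub_apply,
      LinearMap.snd_apply, mem_Ici, mem_Ioc, sub_pos, sub_le_iff_le_add']
  have memT : ∀ t t' : ℝ, (t, t') ∈ T ↔ s ≤ t ∧ t < t' ∧ t' ≤ e ∧ t' - t < e - s := by
    intro t t'
    simp only [T, fs, sn, d, mem_inter_iff, mem_preimage, LinearMap.fst_apply, LinearMap.sub_apply,
      LinearMap.snd_apply, mem_Ici, mem_Iic, mem_Ioo, sub_pos]
    tauto
  have memT' : ∀ t t' : ℝ, (t, t') ∈ T' ↔ s ≤ t ∧ t < t' ∧ t' ≤ e - 1 := by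
    intro t t'
    simp only [T', fs, sn, d, mem_inter_iff, mem_preimage, LinearMap.fst_apply, LinearMap.sub_apply,
      LinearMap.snd_apply, mem_Ici, mem_Iic, mem_Ioi, sub_pos]
    tauto
  have hcont : ∀ R : Set (ℝ × ℝ), (∀ p ∈ R, 0 ≤ p.1 ∧ 0 ≤ p.2) →
      ContinuousOn (fun p : ℝ × ℝ => Γ p.2 - Γ p.1) R := by
    intro R hR
    have h1 : ContinuousOn (fun p : ℝ × ℝ => Γ p.1) R :=
      hc.comp continuousOn_fst (fun p hp => (hR p hp).1)
    have h2 : ContinuousOn (fun p : ℝ × ℝ => Γ p.2) R :=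
      hc.comp continuousOn_snd (fun p hp => (hR p hp).2)
    exact h2.sub h1
  have hS0 : ∀ p ∈ S, 0 ≤ p.1 ∧ 0 ≤ p.2 := by
    rintro ⟨t, t'⟩ hp
    rw [memS] at hp
    exact ⟨hp.1, by simp only; linarith⟩
  have hT0 : ∀ p ∈ T, 0 ≤ p.1 ∧ 0 ≤ p.2 := by
    rintro ⟨t, t'⟩ hp
    rw [memT] at hp
    constructor <;> simp only <;> linarith
  have hT'0 : ∀ p ∈ T', 0 ≤ p.1 ∧ 0 ≤ p.2 := by
    rintro ⟨t, t'⟩ hp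
    rw [memT'] at hp
    constructor <;> simp only <;> linarith
  obtain ⟨θ, hθc, hθ⟩ := exists_log_lift hSc (hcont S hS0) (by
    rintro ⟨t, t'⟩ hp
    rw [memS] at hp
    exact sub_ne_zero.2 (hinj t t' hp.1 hp.2.1 hp.2.2).symm)
  obtain ⟨η, hηc, hη⟩ := exists_log_lift hTc (hcont T hT0) (by
    rintro ⟨t, t'⟩ hp
    rw [memT] at hp
    exact sub_ne_zero.2 (hT t t' hp.1 hp.2.1 hp.2.2.1 hp.2.2.2).symm)
  -- shifts
  have shS : ∀ p ∈ S, p + (1, 1) ∈ S := by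
    rintro ⟨t, t'⟩ hp
    rw [memS] at hp
    rw [Prod.mk_add_mk, memS]
    refine ⟨?_, ?_, ?_⟩ <;> linarith
  have subT : ∀ p ∈ T', p ∈ T := by
    rintro ⟨t, t'⟩ hp
    rw [memT'] at hp
    rw [memT]
    refine ⟨?_, ?_, ?_, ?_⟩ <;> linarith
  have shT : ∀ p ∈ T', p + (1, 1) ∈ T := by
    rintro ⟨t, t'⟩ hp
    rw [memT'] at hp
    rw [Prod.mk_add_mk, memT]
    refine ⟨?_, ?_, ?_, ?_⟩ <;> linarith
  -- comparison of the two lifts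
  obtain ⟨n1, hn1⟩ := exp_diff_const (hSc.inter hTc).isPreconnected
    (hηc.mono inter_subset_right) (hθc.mono inter_subset_left)
    (fun p hp => (hη p hp.2).trans (hθ p hp.1).symm)
  -- comparison with the displacement
  obtain ⟨n2, hn2⟩ := exp_diff_const (convex_Ici (0 : ℝ)).isPreconnected
    (f := fun t => A (Γ t)) (g := fun t => θ (t, t + 1))
    (hAc.comp hc (fun _ _ => trivial))
    (hθc.comp (by fun_prop) (fun t ht => (memS _ _).2 ⟨ht, by linarith, le_rfl⟩))
    (by
      intro t ht
      rw [hA _ trivial, hθ _ ((memS _ _).2 ⟨ht, by linarith, le_rfl⟩)]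
      simp only
      rw [hstep t ht])
  -- equivariance
  have key : ∀ (R R' : Set (ℝ × ℝ)) (ω : ℝ × ℝ → ℂ), IsPreconnected R' → (∀ p ∈ R', p ∈ R) →
      (∀ p ∈ R', p + (1, 1) ∈ R) → (∀ p ∈ R', 0 ≤ p.1 ∧ 0 ≤ p.2) → ContinuousOn ω R →
      (∀ p ∈ R, exp (ω p) = Γ p.2 - Γ p.1) →
      ∃ n : ℤ, ∀ p ∈ R', ω (p + (1, 1)) = L (Γ p.1, ω p) + ω p + n * (2 * Real.pi * I) := by
    intro R R' ω hR' hsub hsh h0 hω hexp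
    apply exp_diff_const hR' (f := fun p => ω (p + (1, 1))) (g := fun p => L (Γ p.1, ω p) + ω p)
    · exact hω.comp (by fun_prop) hsh
    · have h1 : ContinuousOn (fun p : ℝ × ℝ => Γ p.1) R' :=
        hc.comp continuousOn_fst (fun p hp => (h0 p hp).1)
      have h2 := hω.mono hsub
      exact (hLc.comp_continuousOn (h1.prodMk h2)).add h2
    · intro p hp
      rw [hexp _ (hsh p hp), exp_add, hL, div_mul_cancel₀ _ (exp_ne_zero _), hexp _ (hsub p hp)]
      simp only [Prod.fst_add, Prod.snd_add]
      rw [hstep _ (h0 p hp).1, hstep _ (h0 p hp).2, add_sub_cancel]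
  obtain ⟨n3, hn3⟩ := key S S θ hSc.isPreconnected (fun _ h => h) shS hS0 hθc hθ
  obtain ⟨n4, hn4⟩ := key T T' η hT'c.isPreconnected subT shT hT'0 hηc hη
  -- n3 = n4
  have h34 : (n3 : ℂ) * (2 * Real.pi * I) = n4 * (2 * Real.pi * I) := by
    obtain ⟨δ, hδ0, hδ1, hδ2⟩ : ∃ δ : ℝ, 0 < δ ∧ δ ≤ 1 ∧ s + δ ≤ e - 1 := by
      refine ⟨min 1 (e - 1 - s), lt_min one_pos (by linarith), min_le_left _ _, ?_⟩
      have := min_le_right 1 (e - 1 - s)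
      linarith
    have m1 : (s, s + δ) ∈ S := (memS _ _).2 ⟨hs, by linarith, by linarith⟩
    have m2 : (s, s + δ) ∈ T' := (memT' _ _).2 ⟨le_rfl, by linarith, by linarith⟩
    have a1 := hn3 _ m1
    have a2 := hn4 _ m2
    have a3 := hn1 _ ⟨m1, subT _ m2⟩
    have a4 := hn1 _ ⟨shS _ m1, shT _ m2⟩
    rw [a4, a3, hLn, a1] at a2
    linear_combination a2
  -- the half turn
  obtain ⟨c, hcc⟩ := exp_diff_const (convex_Ioo s e).isPreconnected
    (f := fun τ => η (τ, e)) (g := fun τ => η (s, τ) + Real.pi * I)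
    (hηc.comp (by fun_prop) (fun τ hτ =>
      (memT _ _).2 ⟨hτ.1.le, hτ.2, le_rfl, by linarith [hτ.1]⟩))
    ((hηc.comp (by fun_prop) (fun τ hτ =>
      (memT _ _).2 ⟨le_rfl, hτ.1, hτ.2.le, by linarith [hτ.2]⟩)).add continuousOn_const)
    (by
      intro τ hτ
      rw [hexp2, hη _ ((memT _ _).2 ⟨hτ.1.le, hτ.2, le_rfl, by linarith [hτ.1]⟩),
        hη _ ((memT _ _).2 ⟨le_rfl, hτ.1, hτ.2.le, by linarith [hτ.2]⟩)]
      simp only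
      rw [hΓ]; ring)
  have c1 := hcc (s + 1) ⟨by linarith, by linarith⟩
  have c2 := hcc (e - 1) ⟨by linarith, by linarith⟩
  have mS1 : (e - 1, e) ∈ S := (memS _ _).2 ⟨by linarith, by linarith, by linarith⟩
  have mS2 : (s, s + 1) ∈ S := (memS _ _).2 ⟨by linarith, by linarith, by linarith⟩
  have mT1 : (e - 1, e) ∈ T := (memT _ _).2 ⟨by linarith, by linarith, by linarith, by linarith⟩
  have mT2 : (s, s + 1) ∈ T := (memT _ _).2 ⟨by linarith, by linarith, by linarith, by linarith⟩
  have mT3 : (s, e - 1) ∈ T' := (memT' _ _).2 ⟨by linarith, by linarith, by linarith⟩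
  have b1 := hn1 _ ⟨mS1, mT1⟩
  have b2 := hn1 _ ⟨mS2, mT2⟩
  have A1 := hn2 e (show (0 : ℝ) ≤ e by linarith)
  have A2 := hn2 (e - 1) (show (0 : ℝ) ≤ e - 1 by linarith)
  have A3 := hn2 s hs
  simp only [sub_add_cancel] at A1 A2 A3
  rw [← hΓ] at A1
  have d1 := hn3 _ mS1
  have d2 := hn4 _ mT3
  simp only [Prod.mk_add_mk, sub_add_cancel] at d1 d2
  have hLL : L (Γ (e - 1), θ (e - 1, e)) = L (Γ s, η (s, e - 1)) := by
    have x1 := hη _ (subT _ mT3)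
    have x2 := hη _ mT1
    simp only at x1 x2
    have x3 : Γ (e - 1) = Γ s + exp (η (s, e - 1)) := by rw [x1]; ring
    have x4 : θ (e - 1, e) = η (s, e - 1) + Real.pi * I + (c - n1 : ℤ) * (2 * Real.pi * I) := by
      push_cast
      linear_combination c2 - b1
    rw [x4, hLn, x3, hL2]
  rw [hLL] at d1
  have fin : (2 * (c : ℂ) + 1) * (2 * Real.pi * I) = 0 := by
    linear_combination (-1) * c1 - c2 - A1 + A3 - d1 + d2 + b1 - b2 - h34
  have hpi : (2 * Real.pi * I : ℂ) ≠ 0 := by simp [Real.pi_ne_zero]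
  have := (mul_eq_zero.1 fin).resolve_right hpi
  have h5 : (2 * c + 1 : ℤ) = 0 := by exact_mod_cast this
  omega

lemma shrink (G : ℂ → ℂ) (hG : Continuous G) (x u : ℂ) (r : ℝ) (hr : 0 < r)
    (hu : ‖u - x‖ ≤ r) (hGu : ‖G u - x‖ < r) : ∃ u', ‖u' - x‖ < r ∧ ‖G u' - x‖ < r := by
  have hc : Continuous (fun t : ℝ => ‖G (x + (t : ℂ) * (u - x)) - x‖) := by fun_prop
  have h1 : ∀ᶠ t : ℝ in 𝓝[<] 1, ‖G (x + (t : ℂ) * (u - x)) - x‖ < r := by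
    apply nhdsWithin_le_nhds
    apply hc.continuousAt.eventually_lt continuousAt_const
    simpa using hGu
  have h2 : ∀ᶠ t : ℝ in 𝓝[<] 1, 0 < t := nhdsWithin_le_nhds (lt_mem_nhds one_pos)
  obtain ⟨t, ⟨ht1, ht2⟩, ht3⟩ := ((h1.and h2).and self_mem_nhdsWithin).exists
  refine ⟨x + (t : ℂ) * (u - x), ?_, ht1⟩
  rw [add_sub_cancel_left, norm_mul, Complex.norm_real, Real.norm_of_nonneg ht2.le]
  have : t < 1 := ht3
  nlinarith [norm_nonneg (u - x)]

lemma exists_min (F : ℂ ≃ₜ ℂ) (hfix : ∀ w, F w ≠ w) (x : ℂ) :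
    ∃ (r : ℝ) (z : ℂ), 0 < r ∧ ‖z - x‖ = r ∧ ‖F z - x‖ = r ∧
      ∀ y, ‖y - x‖ < r → r < ‖F y - x‖ := by
  have hFc : Continuous F := F.continuous
  let M : ℂ → ℝ := fun y => max ‖y - x‖ ‖F y - x‖
  have hM : Continuous M := by fun_prop
  obtain ⟨z, hz, hmin⟩ := (isCompact_closedBall x ‖F x - x‖).exists_isMinOn
    ⟨x, by simp⟩ hM.continuousOn
  have hMx : M x = ‖F x - x‖ := by simp [M]
  have hmin' : ∀ y, M z ≤ M y := by
    intro y
    by_cases hy : y ∈ Metric.closedBall x ‖F x - x‖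
    · exact isMinOn_iff.1 hmin y hy
    · have h1 := isMinOn_iff.1 hmin x (by simp)
      rw [Metric.mem_closedBall, not_le, dist_eq_norm] at hy
      have : ‖y - x‖ ≤ M y := le_max_left _ _
      linarith
  have hr : 0 < M z := by
    rw [lt_max_iff]
    by_contra h
    push Not at h
    have h1 := sub_eq_zero.1 (norm_le_zero_iff.1 h.1)
    have h2 := sub_eq_zero.1 (norm_le_zero_iff.1 h.2)
    exact hfix z (h2.trans h1.symm)
  have hno : ∀ y, ‖y - x‖ < M z → ‖F y - x‖ < M z → False := by
    intro y h1 h2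
    exact absurd (hmin' y) (not_le.2 (max_lt h1 h2))
  have hy : ∀ y, ‖y - x‖ < M z → M z < ‖F y - x‖ := by
    intro y h1
    by_contra h
    obtain ⟨u, hu1, hu2⟩ := shrink F.symm F.symm.continuous x (F y) (M z) hr (not_lt.1 h)
      (by simpa using h1)
    exact hno (F.symm u) hu2 (by simpa using hu1)
  refine ⟨M z, z, hr, ?_, ?_, hy⟩
  · refine le_antisymm (le_max_left _ _) ?_
    by_contra h
    have h1 := hy z (not_le.1 h)
    exact absurd (le_max_right ‖z - x‖ ‖F z - x‖) (not_le.2 h1)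
  · refine le_antisymm (le_max_right _ _) ?_
    by_contra h
    obtain ⟨u, hu1, hu2⟩ := shrink F hFc x z (M z) hr (le_max_left _ _) (not_le.1 h)
    exact hno u hu1 hu2

lemma exists_curve (F : ℂ ≃ₜ ℂ) (hfix : ∀ w, F w ≠ w) (x : ℂ) :
    ∃ Γ : ℝ → ℂ, ContinuousOn Γ (Ici 0) ∧ (∀ t, 0 ≤ t → Γ (t + 1) = F (Γ t)) ∧
      (∀ t t', 0 ≤ t → t < t' → t' ≤ t + 1 → Γ t ≠ Γ t') ∧ Γ (1 / 2) = x := by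
  have hFc : Continuous F := F.continuous
  obtain ⟨r, z, hr, hz, hFz, hmin⟩ := exists_min F hfix x
  let α : ℝ → ℂ := fun t =>
    x + ((max (1 - 2 * t) 0 : ℝ) : ℂ) * (z - x) + ((max (2 * t - 1) 0 : ℝ) : ℂ) * (F z - x)
  have hαc : Continuous α := by fun_prop
  have hα1 : ∀ t, t ≤ 1 / 2 → α t = x + ((1 - 2 * t : ℝ) : ℂ) * (z - x) := by
    intro t ht
    simp only [α]
    rw [max_eq_left (by linarith), max_eq_right (by linarith)]
    simp
  have hα2 : ∀ t, 1 / 2 ≤ t → α t = x + ((2 * t - 1 : ℝ) : ℂ) * (F z - x) := by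
    intro t ht
    simp only [α]
    rw [max_eq_right (by linarith), max_eq_left (by linarith)]
    simp
  have hn1 : ∀ t, t ≤ 1 / 2 → ‖α t - x‖ = (1 - 2 * t) * r := by
    intro t ht
    rw [hα1 t ht, add_sub_cancel_left, norm_mul, Complex.norm_real,
      Real.norm_of_nonneg (by linarith), hz]
  have hn2 : ∀ t, 1 / 2 ≤ t → ‖α t - x‖ = (2 * t - 1) * r := by
    intro t ht
    rw [hα2 t ht, add_sub_cancel_left, norm_mul, Complex.norm_real,
      Real.norm_of_nonneg (by linarith), hFz]
  have hle : ∀ t, 0 ≤ t → t ≤ 1 → ‖α t - x‖ ≤ r := by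
    intro t h0 h1
    rcases le_total t (1 / 2) with h | h
    · rw [hn1 t h]; nlinarith
    · rw [hn2 t h]; nlinarith
  have hlt : ∀ t, 0 < t → t < 1 → ‖α t - x‖ < r := by
    intro t h0 h1
    rcases le_total t (1 / 2) with h | h
    · rw [hn1 t h]; nlinarith
    · rw [hn2 t h]; nlinarith
  have hα0 : α 0 = z := by rw [hα1 0 (by norm_num)]; simp
  have hαone : α 1 = F z := by rw [hα2 1 (by norm_num)]; norm_num
  have hαinj : ∀ t t', t < t' → α t ≠ α t' := by
    intro t t' htt h
    have hr' := hr.ne'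
    rcases le_total t' (1 / 2) with h1 | h1
    · have a := hn1 t (by linarith)
      have b := hn1 t' h1
      rw [h, b] at a
      have := mul_right_cancel₀ hr' a
      linarith
    · rcases le_total t (1 / 2) with h2 | h2
      · have a := hn1 t h2
        have b := hn2 t' h1
        rw [h, b] at a
        have e := mul_right_cancel₀ hr' a
        rw [hα1 t h2, hα2 t' h1, e] at h
        have h3 : (1 - 2 * t) ≠ 0 := by intro h3; linarith
        have h4 := mul_left_cancel₀ (Complex.ofReal_ne_zero.2 h3) (add_left_cancel h)
        exact hfix z (sub_left_injective h4).symm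
      · have a := hn2 t h2
        have b := hn2 t' h1
        rw [h, b] at a
        have := mul_right_cancel₀ hr' a
        linarith
  let Γ : ℝ → ℂ := fun t => F^[⌊t⌋₊] (α (t - ⌊t⌋₊))
  have hΓ1 : ∀ t, 0 ≤ t → t ≤ 1 → Γ t = α t := by
    intro t h0 h1
    rcases h1.lt_or_eq with h | rfl
    · have : ⌊t⌋₊ = 0 := Nat.floor_eq_zero.2 h
      simp [Γ, this]
    · simp [Γ, hα0, hαone]
  have hstep : ∀ t, 0 ≤ t → Γ (t + 1) = F (Γ t) := by
    intro t ht
    simp only [Γ]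
    rw [Nat.floor_add_one ht, Function.iterate_succ_apply']
    push_cast
    rw [add_sub_add_right_eq_sub]
  have hcN : ∀ n : ℕ, ContinuousOn Γ (Icc 0 (n + 1)) := by
    intro n
    induction n with
    | zero =>
      refine hαc.continuousOn.congr ?_
      intro t ht
      simp only [Nat.cast_zero, zero_add] at ht
      exact hΓ1 t ht.1 ht.2
    | succ n ih =>
      have h1 : ContinuousOn Γ (Icc 0 1) :=
        ih.mono (Icc_subset_Icc le_rfl (by linarith [n.cast_nonneg (α := ℝ)]))
      have h2 : ContinuousOn Γ (Icc 1 ((n : ℝ) + 1 + 1)) := by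
        have : ContinuousOn (fun t => F (Γ (t - 1))) (Icc 1 ((n : ℝ) + 1 + 1)) := by
          refine hFc.comp_continuousOn (ih.comp (by fun_prop) ?_)
          intro t ht
          exact ⟨by linarith [ht.1], by linarith [ht.2]⟩
        refine this.congr ?_
        intro t ht
        have := hstep (t - 1) (by linarith [ht.1])
        simpa using this
      have h3 := h1.union_of_isClosed h2 isClosed_Icc isClosed_Icc
      rw [Icc_union_Icc_eq_Icc zero_le_one (by linarith [n.cast_nonneg (α := ℝ)])] at h3
      push_cast
      exact h3
  have hinjN : ∀ n : ℕ, ∀ t t' : ℝ, 0 ≤ t → t < n + 1 → t < t' → t' ≤ t + 1 → Γ t ≠ Γ t' := by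
    intro n
    induction n with
    | zero =>
      intro t t' h0 h1 h2 h3 h
      simp only [Nat.cast_zero, zero_add] at h1
      rcases le_or_gt t' 1 with h4 | h4
      · rw [hΓ1 t h0 h1.le, hΓ1 t' (by linarith) h4] at h
        exact hαinj t t' h2 h
      · have e := hstep (t' - 1) (by linarith)
        rw [sub_add_cancel] at e
        rw [e, hΓ1 t h0 h1.le, hΓ1 (t' - 1) (by linarith) (by linarith)] at h
        have a := hmin _ (hlt (t' - 1) (by linarith) (by linarith))
        rw [← h] at a
        linarith [hle t h0 h1.le]
    | succ n ih =>
      intro t t' h0 h1 h2 h3 h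
      rcases lt_or_ge t 1 with h4 | h4
      · exact ih t t' h0 (by linarith [n.cast_nonneg (α := ℝ)]) h2 h3 h
      · have e := hstep (t - 1) (by linarith)
        have e' := hstep (t' - 1) (by linarith)
        rw [sub_add_cancel] at e e'
        rw [e, e'] at h
        push_cast at h1
        exact ih (t - 1) (t' - 1) (by linarith) (by linarith) (by linarith) (by linarith)
          (F.injective h)
  refine ⟨Γ, ?_, hstep, ?_, ?_⟩
  · intro t ht
    obtain ⟨n, hn⟩ := exists_nat_gt t
    have h1 := hcN n t ⟨ht, by linarith⟩
    refine h1.mono_of_mem_nhdsWithin ?_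
    have : Ici (0 : ℝ) ∩ Iio ((n : ℝ) + 1) ∈ 𝓝[Ici 0] t :=
      inter_mem self_mem_nhdsWithin (nhdsWithin_le_nhds (Iio_mem_nhds (by linarith)))
    exact mem_of_superset this (fun y hy => ⟨hy.1, hy.2.le⟩)
  · intro t t' h0
    obtain ⟨n, hn⟩ := exists_nat_gt t
    exact hinjN n t t' h0 (by linarith)
  · rw [hΓ1 _ (by norm_num) (by norm_num), hα1 _ le_rfl]
    norm_num

lemma brouwer_bounded (F : ℂ ≃ₜ ℂ) (B : ℝ) (hB : ∀ w, ‖F w - w‖ ≤ B) (hfix : ∀ w, F w ≠ w)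
    (q : ℕ) (hq : 1 ≤ q) (x : ℂ) : F^[q] x ≠ x := by
  intro hx
  obtain ⟨Γ, hc, hstep, hinj, hΓx⟩ := exists_curve F hfix x
  have hit : ∀ n : ℕ, Γ (1 / 2 + n) = F^[n] x := by
    intro n
    induction n with
    | zero => simpa using hΓx
    | succ n ih =>
      rw [Function.iterate_succ_apply', ← ih, ← hstep _ (by positivity)]
      push_cast
      ring_nf
  have hq' : (1 : ℝ) ≤ q := by exact_mod_cast hq
  exact core_false F B hB hfix Γ hc hstep hinj (1 / 2) (1 / 2 + q) (by norm_num) (by linarith)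
    (by rw [hit, hx, hΓx])

lemma lift_no_periodic (F : (ℝ × ℝ) ≃ₜ (ℝ × ℝ))
    (hF : ∀ (x : ℝ × ℝ) (v : ℤ × ℤ),
      F (x + ((v.1 : ℝ), (v.2 : ℝ))) = F x + ((v.1 : ℝ), (v.2 : ℝ)))
    (hfix : ∀ x, F x ≠ x) (q : ℕ) (hq : 1 ≤ q) (x : ℝ × ℝ) : F^[q] x ≠ x := by
  intro hx
  let e : ℂ ≃ₜ ℝ × ℝ := Complex.equivRealProdCLM.toHomeomorph
  let G : ℂ ≃ₜ ℂ := (e.trans F).trans e.symm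
  have hG : ∀ w, G w = e.symm (F (e w)) := fun w => rfl
  have hGc : Continuous G := G.continuous
  obtain ⟨B, hB⟩ := ((isCompact_Icc (a := (0 : ℝ)) (b := 1)).prod
    (isCompact_Icc (a := (0 : ℝ)) (b := 1))).exists_bound_of_continuousOn
    (f := fun p : ℝ × ℝ => G (e.symm p) - e.symm p) (by fun_prop)
  have hes : ∀ a b : ℝ × ℝ, e.symm (a + b) = e.symm a + e.symm b :=
    fun a b => map_add Complex.equivRealProdCLM.symm a b
  have hB' : ∀ w, ‖G w - w‖ ≤ B := by
    intro w
    obtain ⟨p, rfl⟩ := e.symm.surjective w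
    have h1 := hB (Int.fract p.1, Int.fract p.2)
      ⟨⟨Int.fract_nonneg _, (Int.fract_lt_one _).le⟩, ⟨Int.fract_nonneg _, (Int.fract_lt_one _).le⟩⟩
    have hp : p = (Int.fract p.1, Int.fract p.2) + ((⌊p.1⌋ : ℝ), (⌊p.2⌋ : ℝ)) := by
      ext <;> simp
    have h2 : G (e.symm p) - e.symm p = G (e.symm (Int.fract p.1, Int.fract p.2))
        - e.symm (Int.fract p.1, Int.fract p.2) := by
      rw [hG, hG, e.apply_symm_apply, e.apply_symm_apply]
      conv_lhs => rw [hp, hF _ (⌊p.1⌋, ⌊p.2⌋), hes, hes]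
      ring
    rw [h2]
    exact h1
  have hsemi : Function.Semiconj e.symm F G := by
    intro p
    rw [hG, e.apply_symm_apply]
  refine brouwer_bounded G B hB' ?_ q hq (e.symm x) ?_
  · intro w hw
    rw [hG] at hw
    apply hfix (e w)
    exact e.symm.injective (hw.trans (e.symm_apply_apply w).symm)
  · rw [← (hsemi.iterate_right q) x, hx]

/-- **Franks' Lemma.**  If a lift `F` of a torus homeomorphism homotopic to the identity
has no fixed point, then no iterate `F^q` (`q ≥ 1`) has a fixed point; equivalently,
`(0,0)` is realized by a periodic orbit of `f` iff `F` has a fixed point. -/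
theorem franks_lemma_no_fixed_point_iterates
    (f : T2 ≃ₜ T2) (F : (ℝ × ℝ) ≃ₜ (ℝ × ℝ)) (hF : IsLift ⇑f ⇑F) :
    ((∀ x : ℝ × ℝ, F x ≠ x) → ∀ q : ℕ, 1 ≤ q → ∀ x : ℝ × ℝ, (⇑F)^[q] x ≠ x) ∧
    ((∃ q : ℕ, 1 ≤ q ∧ ∃ x : ℝ × ℝ, (⇑F)^[q] x = x) ↔ ∃ x : ℝ × ℝ, F x = x) := by
  have h := lift_no_periodic F hF.2
  refine ⟨h, ?_, ?_⟩
  · rintro ⟨q, hq, x, hx⟩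
    by_contra hne
    push Not at hne
    exact h hne q hq x hx
  · rintro ⟨x, hx⟩
    exact ⟨1, le_rfl, x, hx⟩
end
end

section
/- Let f : 𝕋² → 𝕋² be a homeomorphism homotopic to the identity with lift f̃ : ℝ² → ℝ². If a rational vector (p₁/q, p₂/q) (with p₁, p₂ ∈ ℤ, q ≥ 1) lies in the interior of the rotation set ρ(f̃), then it is realized by a periodic orbit: there exists x ∈ ℝ² with f̃^q(x) = x + (p₁, p₂). -/
open Filter Topology Set Function

noncomputable section

/-- The Misiurewicz–Ziemian rotation set of a lift `F`. -/
def rotSet (F : ℝ × ℝ → ℝ × ℝ) : Set (ℝ × ℝ) :=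
  ⋂ m ∈ Set.Ici (1 : ℕ),
    closure (⋃ n ∈ Set.Ici m, {y : ℝ × ℝ | ∃ x : ℝ × ℝ, y = ((n : ℝ))⁻¹ • (F^[n] x - x)})

namespace Fr

/-- The real plane identified with the complex numbers. -/
def toC (z : ℝ × ℝ) : ℂ := ⟨z.1, z.2⟩

lemma toC_cont : Continuous toC := Complex.equivRealProdCLM.symm.continuous

lemma toC_ne {z : ℝ × ℝ} (h : z ≠ 0) : toC z ≠ 0 := by
  intro h'
  apply h
  have h1 := congrArg Complex.re h'
  have h2 := congrArg Complex.im h'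
  exact Prod.ext h1 h2

lemma toC_neg (z : ℝ × ℝ) : toC (-z) = - toC z := by
  apply Complex.ext <;> simp [toC]

lemma exists_log (u : ℝ × ℝ → ℝ × ℝ) (hu : Continuous u) (h0 : ∀ z, u z ≠ 0) :
    ∃ l : ℝ × ℝ → ℂ, Continuous l ∧ ∀ z, Complex.exp (l z) = toC (u z) := by
  have h1 : ∀ z, toC (u z) ≠ 0 := fun z => toC_ne (h0 z)
  rcases Complex.isCoveringMapOn_exp.existsUnique_continuousMap_lifts
    (⟨fun z => toC (u z), toC_cont.comp hu⟩ : C(ℝ × ℝ, ℂ)) (a₀ := 0)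
    (Complex.exp_log (h1 0)) (fun z => h1 z) with ⟨f, ⟨-, hf⟩, -⟩
  exact ⟨f, f.continuous, fun z => congrFun hf z⟩

lemma const_of_exp_one (d : ℝ → ℂ) (hd : Continuous d) (h : ∀ t, Complex.exp (d t) = 1) (s t : ℝ) :
    d s = d t := by
  have hc : ∀ t, ∃ n : ℤ, d t = n * (2 * Real.pi * Complex.I) := fun t =>
    Complex.exp_eq_one_iff.mp (h t)
  have hdisc : DiscreteTopology (range (Int.cast : ℤ → ℝ)) := by
    have := Int.isClosedEmbedding_coe_real.isEmbedding.toHomeomorph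
    exact this.symm.isEmbedding.discreteTopology
  have hpi : Real.pi ≠ 0 := Real.pi_ne_zero
  have key : ∀ t, ((d t).im / (2 * Real.pi)) ∈ range (Int.cast : ℤ → ℝ) := by
    intro t
    obtain ⟨n, hn⟩ := hc t
    refine ⟨n, ?_⟩
    rw [hn]
    simp
  have e := isPreconnected_univ.constant_of_mapsTo
    (f := fun t => (d t).im / (2 * Real.pi)) (T := range (Int.cast : ℤ → ℝ))
    ⟨hdisc⟩ (by fun_prop) (fun t _ => key t) (mem_univ s) (mem_univ t)
  have e2 : (d s).im = (d t).im := by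
    field_simp at e
    exact e
  apply Complex.ext _ e2
  obtain ⟨n, hn⟩ := hc s
  obtain ⟨m, hm⟩ := hc t
  rw [hn, hm]; simp

/-- Differences of logarithms are constant as soon as their exponentials are. -/
lemma const_of_exp (d : ℝ → ℂ) (hd : Continuous d) (w : ℂ) (h : ∀ t, Complex.exp (d t) = w)
    (s t : ℝ) : d s = d t := by
  have := const_of_exp_one (fun t => d t - d 0) (by fun_prop) (by
    intro t
    rw [Complex.exp_sub, h, h, div_self]
    rw [← h 0]; exact Complex.exp_ne_zero _) s t
  simpa using this

/-- No fixed points and bounded displacement. -/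
def HH (h : ℝ × ℝ → ℝ × ℝ) : Prop := (∃ M : ℝ, ∀ x, ‖h x - x‖ ≤ M) ∧ ∀ x, h x ≠ x

/-- rescaled map -/
def resc (k : ℝ × ℝ → ℝ × ℝ) (q : ℝ × (ℝ × ℝ)) : ℝ × ℝ := q.1 • k (q.1⁻¹ • q.2)

/-- `t * k(z/t)` tends continuously to `0` when `k` is bounded. -/
lemma resc_cont (k : ℝ × ℝ → ℝ × ℝ) (hk : Continuous k) (M : ℝ) (hM : ∀ z, ‖k z‖ ≤ M) :
    Continuous (resc k) := by
  rw [continuous_iff_continuousAt]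
  rintro ⟨t, z⟩
  by_cases ht : t = 0
  · subst ht
    unfold ContinuousAt
    have : resc k (0, z) = 0 := by simp [resc]
    rw [this]
    apply squeeze_zero_norm (a := fun q : ℝ × (ℝ × ℝ) => |q.1| * M)
    · intro q
      simp only [resc, norm_smul]
      exact mul_le_mul_of_nonneg_left (hM _) (abs_nonneg _)
    · have : Continuous (fun q : ℝ × (ℝ × ℝ) => |q.1| * M) := by fun_prop
      simpa using this.tendsto (0, z)
  · unfold resc
    have : ContinuousAt (fun q : ℝ × (ℝ × ℝ) => q.1⁻¹) (t, z) :=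
      ContinuousAt.inv₀ continuous_fst.continuousAt ht
    have h2 : ContinuousAt (fun q : ℝ × (ℝ × ℝ) => q.1⁻¹ • q.2) (t, z) :=
      this.smul continuous_snd.continuousAt
    exact continuous_fst.continuousAt.smul (hk.continuousAt.comp h2)

/-- no period two points -/
lemma no_period_two (h : (ℝ × ℝ) ≃ₜ (ℝ × ℝ)) (H : HH h) (x : ℝ × ℝ) (hx : h (h x) = x) : False := by
  obtain ⟨⟨M, hM⟩, hfix⟩ := H
  set k : ℝ × ℝ → ℝ × ℝ := fun z => h z - z with hk
  have hkc : Continuous k := by fun_prop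
  have hrc := resc_cont k hkc M hM
  set α : ℝ → ℝ × ℝ := fun s => x + s • (h x - x) with hα
  have hαc : Continuous α := by fun_prop
  -- the two-parameter family
  set u : ℝ × ℝ → ℝ × ℝ := fun q => (h (α q.2) + resc k (q.1, h (α q.2))) -
    (α q.2 + resc k (q.1, α q.2)) with hu
  have huc : Continuous u := by
    have a1 : Continuous (fun q : ℝ × ℝ => resc k (q.1, h (α q.2))) := hrc.comp (by fun_prop)
    have a2 : Continuous (fun q : ℝ × ℝ => resc k (q.1, α q.2)) := hrc.comp (by fun_prop)
    fun_prop
  have form : ∀ t : ℝ, t ≠ 0 → ∀ z, z + resc k (t, z) = t • h (t⁻¹ • z) := by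
    intro t ht z
    simp only [resc, hk, smul_sub]
    rw [smul_inv_smul₀ ht]; abel
  have hu0 : ∀ q, u q ≠ 0 := by
    rintro ⟨t, s⟩ h0
    have h1 := sub_eq_zero.mp h0
    simp only at h1
    by_cases ht : t = 0
    · subst ht
      simp [resc] at h1
      exact hfix _ h1
    · rw [form t ht, form t ht] at h1
      have h2 := h.injective (smul_right_injective _ ht h1)
      exact hfix _ (smul_right_injective _ (inv_ne_zero ht) h2)
  obtain ⟨l, hlc, hl⟩ := exists_log u huc hu0
  obtain ⟨L, hLc, hL⟩ := exists_log k hkc (fun z => sub_ne_zero.mpr (hfix z))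
  have α0 : α 0 = x := by simp [hα]
  have α1 : α 1 = h x := by simp [hα]
  -- the variation in s is constant
  have hneg : ∀ t, u (t, 1) = - u (t, 0) := by
    intro t
    simp only [hu, α0, α1, hx]; abel
  have hc : ∀ t, Complex.exp (l (t, 1) - l (t, 0)) = -1 := by
    intro t
    rw [Complex.exp_sub, hl, hl, hneg, toC_neg, neg_div, div_self (toC_ne (hu0 _))]
  have c1 := const_of_exp (fun t => l (t, 1) - l (t, 0)) (by fun_prop) _ hc 0 1
  have d0 := const_of_exp_one (fun s => l (0, s) - L (α s)) (by fun_prop) (by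
    intro s
    have : u (0, s) = k (α s) := by simp [hu, hk, resc]
    rw [Complex.exp_sub, hl, hL, this, div_self]
    exact toC_ne (sub_ne_zero.mpr (hfix _))) 0 1
  have d1 := const_of_exp_one (fun s => l (1, s) - L (h (α s))) (by fun_prop) (by
    intro s
    have : u (1, s) = k (h (α s)) := by simp [hu, hk, resc]
    rw [Complex.exp_sub, hl, hL, this, div_self]
    exact toC_ne (sub_ne_zero.mpr (hfix _))) 0 1
  simp only [α0, α1, hx] at d0 d1
  have e0 : l (0, 1) - l (0, 0) = 0 := by
    linear_combination (1/2 : ℂ) * c1 - (1/2 : ℂ) * d0 - (1/2 : ℂ) * d1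
  have := hc 0
  rw [e0, Complex.exp_zero] at this
  norm_num at this

/-- A continuous map of the plane at bounded distance of an injective linear map has a zero. -/
lemma exists_zero (u : ℝ × ℝ → ℝ × ℝ) (huc : Continuous u) (ψ : (ℝ × ℝ) →L[ℝ] (ℝ × ℝ))
    (hψ : Injective ψ) (M : ℝ) (hM : ∀ z, ‖u z - ψ z‖ ≤ M) : ∃ z, u z = 0 := by
  by_contra hne
  push Not at hne
  set k : ℝ × ℝ → ℝ × ℝ := fun z => u z - ψ z with hk
  have hkc : Continuous k := by fun_prop
  have hrc := resc_cont k hkc M hM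
  set e : ℝ → ℝ × ℝ := fun φ => (Real.cos φ, Real.sin φ) with he
  have hec : Continuous e := by fun_prop
  have he0 : ∀ φ, e φ ≠ 0 := by
    intro φ h
    have h1 := congrArg Prod.fst h
    have h2 := congrArg Prod.snd h
    simp [he] at h1 h2
    have := Real.sin_sq_add_cos_sq φ
    rw [h1, h2] at this; norm_num at this
  have heπ : ∀ φ, e (φ + Real.pi) = - e φ := by intro φ; simp [he]
  set U : ℝ × ℝ → ℝ × ℝ := fun q => ψ (e q.2) + resc k (q.1, e q.2) with hU
  have hUc : Continuous U := by
    have a1 : Continuous (fun q : ℝ × ℝ => resc k (q.1, e q.2)) := hrc.comp (by fun_prop)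
    fun_prop
  have form : ∀ t : ℝ, t ≠ 0 → ∀ z, ψ z + resc k (t, z) = t • u (t⁻¹ • z) := by
    intro t ht z
    simp only [resc, hk, smul_sub, map_smul]
    rw [smul_inv_smul₀ ht]; abel
  have hψ0 : ∀ z, z ≠ 0 → ψ z ≠ 0 := fun z hz h => hz (hψ (by simpa using h))
  have hU0 : ∀ q, U q ≠ 0 := by
    rintro ⟨t, φ⟩
    by_cases ht : t = 0
    · subst ht
      simpa [hU, resc] using hψ0 _ (he0 φ)
    · simp only [hU]
      rw [form t ht]
      exact smul_ne_zero ht (hne _)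
  obtain ⟨l, hlc, hl⟩ := exists_log U hUc hU0
  obtain ⟨L, hLc, hL⟩ := exists_log u huc hne
  have e2 : ∀ φ, e (φ + 2 * Real.pi) = e φ := by intro φ; simp [he]
  have c1 := const_of_exp (fun t => l (t, 2 * Real.pi) - l (t, 0)) (by fun_prop) 1 (by
    intro t
    have : U (t, 2 * Real.pi) = U (t, 0) := by
      have := e2 0
      rw [zero_add] at this
      simp only [hU, this]
    rw [Complex.exp_sub, hl, hl, this, div_self (toC_ne (hU0 _))]) 0 1
  have d1 := const_of_exp_one (fun s => l (1, s) - L (e s)) (by fun_prop) (by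
    intro s
    have : U (1, s) = u (e s) := by simp [hU, hk, resc]
    rw [Complex.exp_sub, hl, hL, this, div_self]
    exact toC_ne (hne _)) 0 (2 * Real.pi)
  have hexp : ∀ φ, Complex.exp (l (0, φ + Real.pi) - l (0, φ)) = -1 := by
    intro φ
    have : U (0, φ + Real.pi) = - U (0, φ) := by
      simp [hU, resc, heπ]
    rw [Complex.exp_sub, hl, hl, this, toC_neg, neg_div, div_self (toC_ne (hU0 _))]
  have d0 := const_of_exp (fun φ => l (0, φ + Real.pi) - l (0, φ)) (by fun_prop) _ hexp 0 Real.pi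
  have e3 := e2 0
  rw [zero_add] at e3
  simp only [e3] at d1 d0 c1
  have hx := hexp 0
  rw [zero_add] at d0 hx
  rw [← two_mul] at d0
  have : l (0, Real.pi) - l (0, 0) = 0 := by
    linear_combination (1/2 : ℂ) * d0 + (1/2 : ℂ) * c1 - (1/2 : ℂ) * d1
  rw [this, Complex.exp_zero] at hx
  norm_num at hx

/-- Two curves following independent directions intersect. -/
lemma curves_cross (γ₁ γ₂ : ℝ → ℝ × ℝ) (h1 : Continuous γ₁) (h2 : Continuous γ₂)
    (w₁ w₂ : ℝ × ℝ) (hw : w₁.1 * w₂.2 - w₁.2 * w₂.1 ≠ 0) (M : ℝ)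
    (hM1 : ∀ t, ‖γ₁ t - t • w₁‖ ≤ M) (hM2 : ∀ t, ‖γ₂ t - t • w₂‖ ≤ M) :
    ∃ s t, γ₁ s = γ₂ t := by
  let ψ : (ℝ × ℝ) →L[ℝ] (ℝ × ℝ) :=
    (ContinuousLinearMap.fst ℝ ℝ ℝ).smulRight w₁ - (ContinuousLinearMap.snd ℝ ℝ ℝ).smulRight w₂
  have hψv : ∀ z, ψ z = z.1 • w₁ - z.2 • w₂ := fun z => rfl
  have hψ : Injective ψ := by
    rw [injective_iff_map_eq_zero]
    intro z hz
    rw [hψv] at hz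
    have a1 := congrArg Prod.fst hz
    have a2 := congrArg Prod.snd hz
    simp at a1 a2
    have b1 : z.1 * (w₁.1 * w₂.2 - w₁.2 * w₂.1) = 0 := by linear_combination w₂.2 * a1 - w₂.1 * a2
    have b2 : z.2 * (w₁.1 * w₂.2 - w₁.2 * w₂.1) = 0 := by linear_combination w₁.2 * a1 - w₁.1 * a2
    exact Prod.ext ((mul_eq_zero.mp b1).resolve_right hw) ((mul_eq_zero.mp b2).resolve_right hw)
  obtain ⟨z, hz⟩ := exists_zero (fun z => γ₁ z.1 - γ₂ z.2) (by fun_prop) ψ hψ (M + M) (by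
    intro z
    rw [hψv]
    have : γ₁ z.1 - γ₂ z.2 - (z.1 • w₁ - z.2 • w₂) = (γ₁ z.1 - z.1 • w₁) - (γ₂ z.2 - z.2 • w₂) := by
      abel
    rw [this]
    exact (norm_sub_le _ _).trans (add_le_add (hM1 _) (hM2 _)))
  exact ⟨z.1, z.2, sub_eq_zero.mp hz⟩

end Fr

namespace Fr

/-- bounded displacement -/
def BD (φ : ℝ × ℝ → ℝ × ℝ) : Prop := ∃ M : ℝ, ∀ x, ‖φ x - x‖ ≤ M

lemma BD.comp {φ ψ : ℝ × ℝ → ℝ × ℝ} (h1 : BD φ) (h2 : BD ψ) : BD (ψ ∘ φ) := by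
  obtain ⟨M1, h1⟩ := h1
  obtain ⟨M2, h2⟩ := h2
  refine ⟨M2 + M1, fun x => ?_⟩
  have : (ψ ∘ φ) x - x = (ψ (φ x) - φ x) + (φ x - x) := by simp
  rw [this]
  exact (norm_add_le _ _).trans (add_le_add (h2 _) (h1 _))

lemma move_local (a b : ℝ × ℝ) (ρ : ℝ) (hρ : ‖b - a‖ < ρ) :
    ∃ φ : (ℝ × ℝ) ≃ₜ (ℝ × ℝ), φ a = b ∧ ∀ z, z ∉ Metric.ball a ρ → φ z = z := by
  have hρ0 : 0 < ρ := (norm_nonneg _).trans_lt hρ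
  set f : ℝ × ℝ → ℝ × ℝ := fun z => z + (max 0 (1 - ‖z - a‖ / ρ)) • (b - a) with hf
  obtain ⟨c, hc⟩ : ∃ c : NNReal, (c : ℝ) = ‖b - a‖ / ρ := ⟨⟨‖b - a‖ / ρ, by positivity⟩, rfl⟩
  have hlip : ∀ x y : ℝ × ℝ, |max 0 (1 - ‖x - a‖ / ρ) - max 0 (1 - ‖y - a‖ / ρ)| ≤ ‖x - y‖ / ρ := by
    intro x y
    have h1 := abs_max_sub_max_le_abs (1 - ‖x - a‖ / ρ) (1 - ‖y - a‖ / ρ) 0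
    rw [max_comm, max_comm (1 - ‖y - a‖ / ρ)] at h1
    refine h1.trans ?_
    have h2 : (1 - ‖x - a‖ / ρ) - (1 - ‖y - a‖ / ρ) = (‖y - a‖ - ‖x - a‖) / ρ := by ring
    rw [h2, abs_div, abs_of_pos hρ0]
    gcongr
    have h3 := abs_norm_sub_norm_le (y - a) (x - a)
    simpa [norm_sub_rev] using h3
  have hA : ApproximatesLinearOn f
      ((ContinuousLinearEquiv.refl ℝ (ℝ × ℝ) : (ℝ × ℝ) ≃L[ℝ] (ℝ × ℝ)) : (ℝ × ℝ) →L[ℝ] (ℝ × ℝ))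
      univ c := by
    intro x _ y _
    have : f x - f y - (x - y) =
      (max 0 (1 - ‖x - a‖ / ρ) - max 0 (1 - ‖y - a‖ / ρ)) • (b - a) := by
      simp only [hf, sub_smul]; abel
    change ‖f x - f y - (x - y)‖ ≤ _
    rw [this, norm_smul, Real.norm_eq_abs]
    calc _ ≤ ‖x - y‖ / ρ * ‖b - a‖ := by gcongr; exact hlip x y
      _ = _ := by rw [hc]; ring
  have hcN : c < ‖(((ContinuousLinearEquiv.refl ℝ (ℝ × ℝ)).symm : (ℝ × ℝ) ≃L[ℝ] (ℝ × ℝ)) :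
      (ℝ × ℝ) →L[ℝ] (ℝ × ℝ))‖₊⁻¹ := by
    have : ‖(((ContinuousLinearEquiv.refl ℝ (ℝ × ℝ)).symm : (ℝ × ℝ) ≃L[ℝ] (ℝ × ℝ)) :
      (ℝ × ℝ) →L[ℝ] (ℝ × ℝ))‖₊ = 1 := by
      have := ContinuousLinearMap.nnnorm_id (𝕜 := ℝ) (E := ℝ × ℝ)
      exact this
    rw [this, inv_one, ← NNReal.coe_lt_coe]
    rw [hc, NNReal.coe_one, div_lt_one hρ0]; exact hρ
  refine ⟨hA.toHomeomorph f (Or.inr hcN), ?_, ?_⟩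
  · change f a = b
    simp [hf]
  · intro z hz
    change f z = z
    rw [Metric.mem_ball, dist_eq_norm, not_lt] at hz
    have : 1 - ‖z - a‖ / ρ ≤ 0 := by
      rw [sub_nonpos, one_le_div hρ0]; exact hz
    simp only [hf, max_eq_left this, zero_smul, add_zero]

lemma move (U : Set (ℝ × ℝ)) (hU : IsOpen U) (hc : IsPreconnected U) {a b : ℝ × ℝ}
    (ha : a ∈ U) (hb : b ∈ U) :
    ∃ φ : (ℝ × ℝ) ≃ₜ (ℝ × ℝ), φ a = b ∧ ∀ z, z ∉ U → φ z = z := by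
  refine hc.induction₂ (fun a b => ∃ φ : (ℝ × ℝ) ≃ₜ (ℝ × ℝ), φ a = b ∧ ∀ z, z ∉ U → φ z = z)
    ?_ ?_ ?_ ha hb
  · intro x hx
    obtain ⟨ρ, hρ, hsub⟩ := Metric.isOpen_iff.mp hU x hx
    have : Metric.ball x ρ ∈ 𝓝[U] x := mem_nhdsWithin_of_mem_nhds (Metric.ball_mem_nhds x hρ)
    filter_upwards [this] with y hy
    rw [Metric.mem_ball, dist_eq_norm] at hy
    obtain ⟨φ, h1, h2⟩ := move_local x y ρ hy
    exact ⟨φ, h1, fun z hz => h2 z (fun h => hz (hsub h))⟩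
  · rintro x y z - - - ⟨φ, h1, h2⟩ ⟨ψ, h3, h4⟩
    refine ⟨φ.trans ψ, by simp [h1, h3], fun w hw => by simp [h2 w hw, h4 w hw]⟩
  · rintro x y - - ⟨φ, h1, h2⟩
    refine ⟨φ.symm, by rw [← h1]; simp, fun w hw => ?_⟩
    rw [Homeomorph.symm_apply_eq]; exact (h2 w hw).symm

lemma supp_mem {U : Set (ℝ × ℝ)} {φ : (ℝ × ℝ) ≃ₜ (ℝ × ℝ)} (h : ∀ z, z ∉ U → φ z = z)
    {z : ℝ × ℝ} (hz : z ∈ U) : φ z ∈ U := by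
  by_contra hn
  have := φ.injective (h _ hn)
  rw [this] at hn; exact hn hz

lemma supp_BD {U : Set (ℝ × ℝ)} (hb : Bornology.IsBounded U) {φ : (ℝ × ℝ) ≃ₜ (ℝ × ℝ)}
    (h : ∀ z, z ∉ U → φ z = z) : BD φ := by
  obtain ⟨C, hC⟩ := Metric.isBounded_iff.mp hb
  refine ⟨max C 0, fun x => ?_⟩
  by_cases hx : x ∈ U
  · rw [← dist_eq_norm]
    exact (hC (supp_mem h hx) hx).trans (le_max_left _ _)
  · rw [h x hx]; simp

/-- `V` is disjoint of its image -/
def Free (h : ℝ × ℝ → ℝ × ℝ) (V : Set (ℝ × ℝ)) : Prop := ∀ z ∈ V, h z ∉ V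

lemma perturb (h φ : (ℝ × ℝ) ≃ₜ (ℝ × ℝ)) (Hh : HH h) (hb : BD φ)
    (hφ : ∀ z, φ z = z ∨ ∃ V, Free h V ∧ z ∈ V ∧ φ z ∈ V) : HH (h.trans φ) := by
  refine ⟨BD.comp (φ := h) (ψ := φ) Hh.1 hb, fun x hx => ?_⟩
  simp only [Homeomorph.trans_apply] at hx
  rcases hφ (h x) with h1 | ⟨V, hV, h1, h2⟩
  · rw [hx] at h1
    exact Hh.2 x h1.symm
  · rw [hx] at h2
    exact hV x h2 h1

lemma closing (n : ℕ)
    (IH : ∀ k, k < n → 1 ≤ k → ∀ h : (ℝ × ℝ) ≃ₜ (ℝ × ℝ), HH h → ∀ x, h^[k] x ≠ x)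
    (h : (ℝ × ℝ) ≃ₜ (ℝ × ℝ)) (Hh : HH h) (U : Set (ℝ × ℝ)) (hU : IsOpen U)
    (hc : IsPreconnected U) (hb : Bornology.IsBounded U) (hf : Free h U) (z : ℝ × ℝ) (hz : z ∈ U)
    (k : ℕ) (hk1 : 1 ≤ k) (hkn : k < n) : h^[k] z ∉ U := by
  induction k using Nat.strong_induction_on with
  | _ k ih =>
    intro hk
    obtain ⟨φ, h1, h2⟩ := move U hU hc hk hz
    have H2 : HH (h.trans φ) := by
      apply perturb h φ Hh (supp_BD hb h2)
      intro z
      by_cases hz : z ∈ U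
      · exact Or.inr ⟨U, hf, hz, supp_mem h2 hz⟩
      · exact Or.inl (h2 z hz)
    have it : ∀ j, j < k → (h.trans φ)^[j] z = h^[j] z := by
      intro j
      induction j with
      | zero => intro _; rfl
      | succ j ihj =>
        intro hj
        rw [iterate_succ_apply', ihj (by lia), Homeomorph.trans_apply, iterate_succ_apply']
        apply h2
        rw [← iterate_succ_apply' h]
        exact ih _ hj (by lia) (by lia)
    apply IH k hkn hk1 _ H2 z
    obtain ⟨j, rfl⟩ : ∃ j, k = j + 1 := ⟨k - 1, by lia⟩
    rw [iterate_succ_apply', it j (by lia), Homeomorph.trans_apply, ← iterate_succ_apply' h, h1]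

lemma sep_thick (K L : Set (ℝ × ℝ)) (hK : IsCompact K) (hL : IsCompact L)
    (g : ℝ × ℝ → ℝ × ℝ) (hg : Continuous g) (h : ∀ z ∈ K, g z ∉ L) :
    ∃ η > 0, ∀ z ∈ Metric.thickening η K, g z ∉ Metric.thickening η L := by
  have hd : Disjoint (g '' K) L := by
    rw [Set.disjoint_left]
    rintro _ ⟨z, hz, rfl⟩
    exact h z hz
  obtain ⟨δ, hδ, hdis⟩ := hd.exists_thickenings (hK.image hg) hL.isClosed
  obtain ⟨η, hη, hsub⟩ := hK.exists_thickening_subset_open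
    (Metric.isOpen_thickening.preimage hg : IsOpen (g ⁻¹' Metric.thickening δ (g '' K)))
    (fun z hz => Metric.self_subset_thickening hδ _ (mem_image_of_mem g hz))
  refine ⟨min η δ, lt_min hη hδ, fun z hz hz2 => ?_⟩
  exact Set.disjoint_left.mp hdis (hsub (Metric.thickening_mono (min_le_left _ _) _ hz))
    (Metric.thickening_mono (min_le_right _ _) _ hz2)

lemma seg_cases {x w z : ℝ × ℝ} {r : ℝ} (hr : 0 < r) (hw : ‖w - x‖ ≤ r) (hz : z ∈ segment ℝ x w) :
    z ∈ Metric.ball x r ∨ z = w := by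
  rw [segment_eq_image'] at hz
  obtain ⟨t, ⟨h0, h1⟩, rfl⟩ := hz
  rcases h1.eq_or_lt with rfl | h1
  · right; simp
  · left
    simp only [Metric.mem_ball, dist_eq_norm, add_sub_cancel_left, norm_smul, Real.norm_eq_abs,
      abs_of_nonneg h0]
    nlinarith [norm_nonneg (w - x)]

lemma seg_compact (x w : ℝ × ℝ) : IsCompact (segment ℝ x w) := by
  rw [segment_eq_image']
  exact isCompact_Icc.image (by fun_prop)

/-- Brouwer: fixed point free plane homeomorphisms (at bounded distance from the identity)
have no periodic points. -/
lemma brouwer (n : ℕ) : 1 ≤ n → ∀ h : (ℝ × ℝ) ≃ₜ (ℝ × ℝ), HH h → ∀ x, h^[n] x ≠ x := by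
  induction n using Nat.strong_induction_on with
  | _ n IH =>
    intro hn h Hh x hx
    rcases hn.eq_or_lt with rfl | hn
    · exact Hh.2 x hx
    rcases (show 2 ≤ n from hn).eq_or_lt with rfl | hn
    · exact no_period_two h Hh x hx
    have C := closing n IH h Hh
    have hcont : Continuous (fun z : ℝ × ℝ => max ‖z - x‖ ‖h z - x‖) := by fun_prop
    obtain ⟨y, hy⟩ := hcont.exists_forall_le (by
      apply tendsto_atTop_mono (fun z => le_max_left (‖z - x‖) (‖h z - x‖))
      simp_rw [← dist_eq_norm]
      exact tendsto_dist_right_cocompact_atTop x)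
    set r := max ‖y - x‖ ‖h y - x‖ with hr
    have hr0 : 0 < r := by
      by_contra hneg
      have h1 : ‖y - x‖ ≤ 0 := (le_max_left _ _).trans (not_lt.mp hneg)
      have h2 : ‖h y - x‖ ≤ 0 := (le_max_right _ _).trans (not_lt.mp hneg)
      rw [norm_le_zero_iff, sub_eq_zero] at h1 h2
      rw [h1] at h2
      exact Hh.2 x h2
    set B := Metric.ball x r with hB
    have hBf : Free h B := by
      intro z hz hz2
      rw [hB, Metric.mem_ball, dist_eq_norm] at hz hz2
      exact absurd (hy z) (not_le.mpr (max_lt hz hz2))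
    have hcl : closure B = Metric.closedBall x r := closure_ball x hr0.ne'
    have F1 : ∀ z ∈ Metric.closedBall x r, h z ∉ B := by
      intro z hz hz2
      rw [← hcl, mem_closure_iff] at hz
      obtain ⟨w, hw1, hw2⟩ := hz (h ⁻¹' B) (Metric.isOpen_ball.preimage h.continuous) hz2
      exact hBf w hw2 hw1
    have F2 : ∀ z ∈ B, h z ∉ Metric.closedBall x r := by
      intro z hz hz2
      rw [← hcl, mem_closure_iff] at hz2
      obtain ⟨w, ⟨v, hv, rfl⟩, hw2⟩ := hz2 (h '' B) (h.isOpenMap _ Metric.isOpen_ball)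
        (mem_image_of_mem _ hz)
      exact hBf v hv hw2
    have hyr : ‖y - x‖ ≤ r := le_max_left _ _
    have hhyr : ‖h y - x‖ ≤ r := le_max_right _ _
    have hyc : y ∈ Metric.closedBall x r := by rw [Metric.mem_closedBall, dist_eq_norm]; exact hyr
    have hhyc : h y ∈ Metric.closedBall x r := by
      rw [Metric.mem_closedBall, dist_eq_norm]; exact hhyr
    have hyB : y ∉ B := fun h1 => F2 y h1 hhyc
    have hhyB : h y ∉ B := F1 y hyc
    have hS1 : Free h (segment ℝ x (h y)) := by
      intro z hz hz2
      rcases seg_cases hr0 hhyr hz with h1 | rfl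
      · apply F2 z h1
        rcases seg_cases hr0 hhyr hz2 with h2 | h2
        · exact Metric.ball_subset_closedBall h2
        · rw [h2]; exact hhyc
      · rcases seg_cases hr0 hhyr hz2 with h2 | h2
        · exact F1 _ hhyc h2
        · exact Hh.2 _ h2
    have hS0 : Free h (segment ℝ x y) := by
      intro z hz hz2
      rcases seg_cases hr0 hyr hz with h1 | rfl
      · apply F2 z h1
        rcases seg_cases hr0 hyr hz2 with h2 | h2
        · exact Metric.ball_subset_closedBall h2
        · rw [h2]; exact hyc
      · rcases seg_cases hr0 hyr hz2 with h2 | h2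
        · exact F1 _ hyc h2
        · exact Hh.2 _ h2
    have hS01 : ∀ z ∈ segment ℝ x y, (h ∘ h) z ∉ segment ℝ x (h y) := by
      intro z hz hz2
      rcases seg_cases hr0 hyr hz with h1 | rfl
      · rcases seg_cases hr0 hhyr hz2 with h2 | h2
        · exact C B Metric.isOpen_ball (convex_ball x r).isPreconnected Metric.isBounded_ball hBf z h1
            2 (by norm_num) hn h2
        · have := h.injective h2
          rw [← this] at hyc
          exact F2 z h1 hyc
      · exact hS1 _ (right_mem_segment ℝ x _) hz2
    obtain ⟨η1, hη1, T1⟩ := sep_thick _ _ (seg_compact x (h y)) (seg_compact x (h y)) h h.continuous hS1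
    obtain ⟨η2, hη2, T2⟩ := sep_thick _ _ (seg_compact x y) (seg_compact x y) h h.continuous hS0
    obtain ⟨η3, hη3, T3⟩ := sep_thick _ _ (seg_compact x y) (seg_compact x (h y)) (h ∘ h)
      (h.continuous.comp h.continuous) hS01
    set η := min η1 (min η2 η3) with hη
    have hη0 : 0 < η := lt_min hη1 (lt_min hη2 hη3)
    have m1 : η ≤ η1 := min_le_left _ _
    have m2 : η ≤ η2 := (min_le_right _ _).trans (min_le_left _ _)
    have m3 : η ≤ η3 := (min_le_right _ _).trans (min_le_right _ _)
    set U1 := Metric.thickening η (segment ℝ x (h y)) with hU1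
    set U0 := Metric.thickening η (segment ℝ x y) with hU0
    have U1f : Free h U1 := fun z hz hz2 =>
      T1 z (Metric.thickening_mono m1 _ hz) (Metric.thickening_mono m1 _ hz2)
    have U0f : Free h U0 := fun z hz hz2 =>
      T2 z (Metric.thickening_mono m2 _ hz) (Metric.thickening_mono m2 _ hz2)
    have U01 : ∀ z ∈ U0, h (h z) ∉ U1 := fun z hz hz2 =>
      T3 z (Metric.thickening_mono m3 _ hz) (Metric.thickening_mono m3 _ hz2)
    have U1o : IsOpen U1 := Metric.isOpen_thickening
    have U0o : IsOpen U0 := Metric.isOpen_thickening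
    have U1c : IsPreconnected U1 := ((convex_segment x (h y)).thickening η).isPreconnected
    have U0c : IsPreconnected U0 := ((convex_segment x y).thickening η).isPreconnected
    have U1b : Bornology.IsBounded U1 := (seg_compact x (h y)).isBounded.thickening
    have U0b : Bornology.IsBounded U0 := (seg_compact x y).isBounded.thickening
    have xU1 : x ∈ U1 := Metric.self_subset_thickening hη0 _ (left_mem_segment ℝ _ _)
    have hyU1 : h y ∈ U1 := Metric.self_subset_thickening hη0 _ (right_mem_segment ℝ _ _)
    have xU0 : x ∈ U0 := Metric.self_subset_thickening hη0 _ (left_mem_segment ℝ _ _)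
    have yU0 : y ∈ U0 := Metric.self_subset_thickening hη0 _ (right_mem_segment ℝ _ _)
    set U2 := h '' U0 with hU2
    have U2o : IsOpen U2 := h.isOpenMap _ U0o
    have U2c : IsPreconnected U2 := U0c.image _ h.continuous.continuousOn
    have U2b : Bornology.IsBounded U2 := by
      obtain ⟨M, hM⟩ := Hh.1
      obtain ⟨R, hR⟩ := U0b.exists_norm_le
      rw [isBounded_iff_forall_norm_le]
      refine ⟨M + R, ?_⟩
      rintro _ ⟨z, hz, rfl⟩
      have : h z = (h z - z) + z := by simp
      rw [this]
      exact (norm_add_le _ _).trans (add_le_add (hM z) (hR z hz))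
    have U2f : Free h U2 := by
      rintro _ ⟨z, hz, rfl⟩ ⟨w, hw, h3⟩
      rw [h.injective h3] at hw
      exact U0f z hz hw
    obtain ⟨φ1, p1, q1⟩ := move U1 U1o U1c xU1 hyU1
    obtain ⟨φ2, p2, q2⟩ := move U2 U2o U2c (mem_image_of_mem h yU0) (mem_image_of_mem h xU0)
    have H1 : HH (h.trans φ1) := by
      apply perturb h φ1 Hh (supp_BD U1b q1)
      intro z
      by_cases hz : z ∈ U1
      · exact Or.inr ⟨U1, U1f, hz, supp_mem q1 hz⟩
      · exact Or.inl (q1 z hz)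
    have H2 : HH ((h.trans φ1).trans φ2) := by
      apply perturb _ φ2 H1 (supp_BD U2b q2)
      intro z
      by_cases hz : z ∈ U2
      · refine Or.inr ⟨U2, ?_, hz, supp_mem q2 hz⟩
        rintro _ ⟨w, hw, rfl⟩ hw2
        rw [Homeomorph.trans_apply, q1 _ (U01 w hw)] at hw2
        exact U2f _ (mem_image_of_mem h hw) hw2
      · exact Or.inl (q2 z hz)
    set h2 := (h.trans φ1).trans φ2 with hh2
    have h2v : ∀ z, h2 z = φ2 (φ1 (h z)) := fun z => rfl
    have it : ∀ j, j + 1 < n → h2^[j] (h x) = h^[j] (h x) := by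
      intro j
      induction j with
      | zero => intro _; rfl
      | succ j ihj =>
        intro hj
        rw [iterate_succ_apply', ihj (by lia), iterate_succ_apply', h2v]
        have a1 : h (h^[j] (h x)) ∉ U1 := by
          rw [← iterate_succ_apply' h, ← iterate_succ_apply]
          exact C U1 U1o U1c U1b U1f x xU1 (j + 2) (by lia) hj
        have a2 : h (h^[j] (h x)) ∉ U2 := by
          rw [← iterate_succ_apply' h]
          exact C U2 U2o U2c U2b U2f (h x) (mem_image_of_mem h xU0) (j + 1) (by lia) (by lia)
        rw [q1 _ a1, q2 _ a2]
    apply IH (n - 1) (by lia) (by lia) h2 H2 (h x)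
    obtain ⟨j, rfl⟩ : ∃ j, n = j + 2 := ⟨n - 2, by lia⟩
    change h2^[j + 1] (h x) = h x
    rw [iterate_succ_apply', it j (by lia), h2v, ← iterate_succ_apply, ← iterate_succ_apply' h, hx,
      p1, p2]

/-- Simultaneous moves in disjoint open sets. -/
lemma multi_move {ι : Type*} [DecidableEq ι] (V : ι → Set (ℝ × ℝ)) (hV : ∀ i, IsOpen (V i))
    (hc : ∀ i, IsPreconnected (V i)) (hb : ∀ i, Bornology.IsBounded (V i))
    (hd : ∀ i j, i ≠ j → Disjoint (V i) (V j)) (p q : ι → ℝ × ℝ) (hp : ∀ i, p i ∈ V i)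
    (hq : ∀ i, q i ∈ V i) (s : Finset ι) :
    ∃ φ : (ℝ × ℝ) ≃ₜ (ℝ × ℝ), BD φ ∧ (∀ z, φ z = z ∨ ∃ i ∈ s, z ∈ V i ∧ φ z ∈ V i) ∧
      ∀ i ∈ s, φ (p i) = q i := by
  induction s using Finset.induction_on with
  | empty => exact ⟨Homeomorph.refl _, ⟨0, by simp⟩, fun z => Or.inl rfl, by simp⟩
  | insert i s his ih =>
    obtain ⟨φ, b, h1, h2⟩ := ih
    obtain ⟨ψ, h3, h4⟩ := move (V i) (hV i) (hc i) (hp i) (hq i)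
    have hdis : ∀ j, j ∈ s → ∀ z, z ∈ V j → z ∉ V i := fun j hj z hz hz2 =>
      Set.disjoint_left.mp (hd j i (fun h => his (h ▸ hj))) hz hz2
    refine ⟨φ.trans ψ, BD.comp (φ := φ) (ψ := ψ) b (supp_BD (hb i) h4), ?_, ?_⟩
    · intro z
      simp only [Homeomorph.trans_apply]
      rcases h1 z with h | ⟨j, hj, hz, hz2⟩
      · rw [h]
        by_cases hz : z ∈ V i
        · exact Or.inr ⟨i, Finset.mem_insert_self _ _, hz, supp_mem h4 hz⟩
        · exact Or.inl (h4 z hz)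
      · rw [h4 _ (hdis j hj _ hz2)]
        exact Or.inr ⟨j, Finset.mem_insert_of_mem hj, hz, hz2⟩
    · intro j hj
      simp only [Homeomorph.trans_apply]
      rcases Finset.mem_insert.mp hj with rfl | hj
      · rcases h1 (p j) with h | ⟨k, hk, hz, hz2⟩
        · rw [h, h3]
        · exact absurd (hp j) (hdis k hk _ hz)
      · rw [h2 j hj, h4 _ (hdis j hj _ (hq j))]

/-- Franks' lemma on cyclic chains of free disks. -/
lemma franks (k : ℕ) [NeZero k] (g : (ℝ × ℝ) ≃ₜ (ℝ × ℝ)) (Hg : HH g) (V : ZMod k → Set (ℝ × ℝ))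
    (hV : ∀ i, IsOpen (V i))
    (hc : ∀ i, IsPreconnected (V i)) (hb : ∀ i, Bornology.IsBounded (V i))
    (hd : ∀ i j, i ≠ j → Disjoint (V i) (V j)) (hf : ∀ i, Free g (V i)) (x : ZMod k → ℝ × ℝ)
    (hx : ∀ i, x i ∈ V i) (hgx : ∀ i, g (x i) ∈ V (i + 1)) : False := by
  obtain ⟨φ, b, h1, h2⟩ := multi_move V hV hc hb hd (fun i => g (x (i - 1))) x
    (fun i => by simpa using hgx (i - 1)) hx Finset.univ
  have H : HH (g.trans φ) := by
    apply perturb g φ Hg b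
    intro z
    rcases h1 z with h | ⟨i, -, h3, h4⟩
    · exact Or.inl h
    · exact Or.inr ⟨V i, hf i, h3, h4⟩
  have it : ∀ j : ℕ, (g.trans φ)^[j] (x 0) = x (j : ZMod k) := by
    intro j
    induction j with
    | zero => simp
    | succ j ih =>
      rw [iterate_succ_apply', ih, Homeomorph.trans_apply]
      have := h2 ((j : ZMod k) + 1) (Finset.mem_univ _)
      simp only [add_sub_cancel_right] at this
      rw [this]; simp
  apply brouwer k (NeZero.one_le) _ H (x 0)
  rw [it]; simp

end Fr

namespace Fr

/-- open unit square -/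
def Qo (a : ℤ × ℤ) : Set (ℝ × ℝ) := Ioo (a.1 : ℝ) (a.1 + 1) ×ˢ Ioo (a.2 : ℝ) (a.2 + 1)

/-- integer part -/
def fl (z : ℝ × ℝ) : ℤ × ℤ := (⌊z.1⌋, ⌊z.2⌋)

/-- generic points: not on the grid -/
def GenS : Set (ℝ × ℝ) := ⋃ a, Qo a

/-- neighbouring squares (reflexive) -/
def Nb (c d : ℤ × ℤ) : Prop :=
  (c.1 = d.1 ∧ c.2 ≤ d.2 + 1 ∧ d.2 ≤ c.2 + 1) ∨ (c.2 = d.2 ∧ c.1 ≤ d.1 + 1 ∧ d.1 ≤ c.1 + 1)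

/-- open rectangle spanned by two squares -/
def Wd (c d : ℤ × ℤ) : Set (ℝ × ℝ) :=
  Ioo ((min c.1 d.1 : ℤ) : ℝ) ((max c.1 d.1 : ℤ) + 1) ×ˢ
    Ioo ((min c.2 d.2 : ℤ) : ℝ) ((max c.2 d.2 : ℤ) + 1)

/-- open region of a set of squares -/
def Og (S : Set (ℤ × ℤ)) : Set (ℝ × ℝ) := {z | ∃ c ∈ S, ∃ d ∈ S, Nb c d ∧ z ∈ Wd c d}

/-- chain connection in a set of squares -/
def Ch (S : Set (ℤ × ℤ)) : ℤ × ℤ → ℤ × ℤ → Prop :=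
  Relation.ReflTransGen (fun c d => Nb c d ∧ c ∈ S ∧ d ∈ S)

/-- center of a square -/
def ctr (a : ℤ × ℤ) : ℝ × ℝ := ((a.1 : ℝ) + 1 / 2, (a.2 : ℝ) + 1 / 2)

/-- transition relation -/
def Er (g : ℝ × ℝ → ℝ × ℝ) (a c : ℤ × ℤ) : Prop := ∃ z ∈ Qo a, g z ∈ Qo c

lemma Nb.refl (a : ℤ × ℤ) : Nb a a := Or.inl ⟨rfl, by lia, by lia⟩

lemma Nb.symm {a b : ℤ × ℤ} (h : Nb a b) : Nb b a := by
  unfold Nb at *; lia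

lemma Nb.shift {a b : ℤ × ℤ} (h : Nb a b) (v : ℤ × ℤ) : Nb (a + v) (b + v) := by
  unfold Nb at *; simp only [Prod.fst_add, Prod.snd_add]; lia

lemma Ch.symm {S : Set (ℤ × ℤ)} {a b : ℤ × ℤ} (h : Ch S a b) : Ch S b a := by
  induction h with
  | refl => exact Relation.ReflTransGen.refl
  | tail _ h ih => exact Relation.ReflTransGen.head ⟨h.1.symm, h.2.2, h.2.1⟩ ih

lemma Ch.mono {S T : Set (ℤ × ℤ)} (hST : S ⊆ T) {a b : ℤ × ℤ} (h : Ch S a b) : Ch T a b := by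
  induction h with
  | refl => exact Relation.ReflTransGen.refl
  | tail _ h ih => exact Relation.ReflTransGen.tail ih ⟨h.1, hST h.2.1, hST h.2.2⟩

lemma Ch.trans {S : Set (ℤ × ℤ)} {a b c : ℤ × ℤ} (h : Ch S a b) (h' : Ch S b c) : Ch S a c :=
  Relation.ReflTransGen.trans h h'

lemma Ch.single {S : Set (ℤ × ℤ)} {a b : ℤ × ℤ} (ha : a ∈ S) (hb : b ∈ S) (h : Nb a b) : Ch S a b :=
  Relation.ReflTransGen.single ⟨h, ha, hb⟩

lemma Ch.refl {S : Set (ℤ × ℤ)} (a : ℤ × ℤ) : Ch S a a := Relation.ReflTransGen.refl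

lemma Qo_open (a : ℤ × ℤ) : IsOpen (Qo a) := isOpen_Ioo.prod isOpen_Ioo

lemma GenS_open : IsOpen GenS := isOpen_iUnion Qo_open

lemma Wd_open (c d : ℤ × ℤ) : IsOpen (Wd c d) := isOpen_Ioo.prod isOpen_Ioo

lemma Wd_convex (c d : ℤ × ℤ) : Convex ℝ (Wd c d) := (convex_Ioo _ _).prod (convex_Ioo _ _)

lemma fl_of_mem {z : ℝ × ℝ} {a : ℤ × ℤ} (h : z ∈ Qo a) : fl z = a := by
  obtain ⟨⟨h1, h2⟩, h3, h4⟩ := h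
  apply Prod.ext
  · exact Int.floor_eq_iff.mpr ⟨h1.le, h2⟩
  · exact Int.floor_eq_iff.mpr ⟨h3.le, h4⟩

lemma mem_Qo_fl {z : ℝ × ℝ} (h : z ∈ GenS) : z ∈ Qo (fl z) := by
  obtain ⟨a, ha⟩ := mem_iUnion.mp h
  rwa [fl_of_mem ha]

lemma GenS_dense : Dense GenS := by
  have h := dense_irrational.prod dense_irrational
  apply h.mono
  rintro ⟨x, y⟩ ⟨hx, hy⟩
  simp only [mem_ofPred_eq] at hx hy
  refine mem_iUnion.mpr ⟨(⌊x⌋, ⌊y⌋), ⟨?_, ?_⟩, ?_, ?_⟩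
  · exact lt_of_le_of_ne (Int.floor_le x) (hx.ne_int _).symm
  · exact Int.lt_floor_add_one x
  · exact lt_of_le_of_ne (Int.floor_le y) (hy.ne_int _).symm
  · exact Int.lt_floor_add_one y

lemma fl_of_Wd {z : ℝ × ℝ} {c d : ℤ × ℤ} (hn : Nb c d) (h : z ∈ Wd c d) : fl z = c ∨ fl z = d := by
  obtain ⟨⟨h1, h2⟩, h3, h4⟩ := h
  have a1 : min c.1 d.1 ≤ ⌊z.1⌋ := Int.le_floor.mpr h1.le
  have a2 : ⌊z.1⌋ < max c.1 d.1 + 1 := Int.floor_lt.mpr (by push_cast at h2 ⊢; exact h2)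
  have a3 : min c.2 d.2 ≤ ⌊z.2⌋ := Int.le_floor.mpr h3.le
  have a4 : ⌊z.2⌋ < max c.2 d.2 + 1 := Int.floor_lt.mpr (by push_cast at h4 ⊢; exact h4)
  unfold Nb at hn
  simp only [fl, Prod.ext_iff]
  lia

lemma fl_of_Og {z : ℝ × ℝ} {S : Set (ℤ × ℤ)} (h : z ∈ Og S) : fl z ∈ S := by
  obtain ⟨c, hc, d, hd, hn, hz⟩ := h
  rcases fl_of_Wd hn hz with h | h <;> rwa [h]

lemma Og_open (S : Set (ℤ × ℤ)) : IsOpen (Og S) := by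
  have : Og S = ⋃ c, ⋃ (_ : c ∈ S), ⋃ d, ⋃ (_ : d ∈ S), ⋃ (_ : Nb c d), Wd c d := by
    ext z; simp only [Og, mem_ofPred_eq, mem_iUnion]
    constructor
    · rintro ⟨c, h1, d, h2, h3, h4⟩; exact ⟨c, h1, d, h2, h3, h4⟩
    · rintro ⟨c, h1, d, h2, h3, h4⟩; exact ⟨c, h1, d, h2, h3, h4⟩
  rw [this]
  exact isOpen_iUnion fun c => isOpen_iUnion fun _ => isOpen_iUnion fun d => isOpen_iUnion fun _ =>
    isOpen_iUnion fun _ => Wd_open c d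

lemma Qo_sub_Wd_left (c d : ℤ × ℤ) : Qo c ⊆ Wd c d := by
  rintro z ⟨⟨h1, h2⟩, h3, h4⟩
  have a1 : ((min c.1 d.1 : ℤ) : ℝ) ≤ c.1 := by exact_mod_cast min_le_left _ _
  have a2 : (c.1 : ℝ) ≤ (max c.1 d.1 : ℤ) := by exact_mod_cast le_max_left _ _
  have a3 : ((min c.2 d.2 : ℤ) : ℝ) ≤ c.2 := by exact_mod_cast min_le_left _ _
  have a4 : (c.2 : ℝ) ≤ (max c.2 d.2 : ℤ) := by exact_mod_cast le_max_left _ _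
  exact ⟨⟨by linarith, by linarith⟩, by linarith, by linarith⟩

lemma Wd_comm (c d : ℤ × ℤ) : Wd c d = Wd d c := by
  unfold Wd; rw [min_comm, max_comm, min_comm c.2, max_comm c.2]

lemma Qo_sub_Wd_right (c d : ℤ × ℤ) : Qo d ⊆ Wd c d := by
  rw [Wd_comm]; exact Qo_sub_Wd_left d c

lemma Qo_sub_Og {S : Set (ℤ × ℤ)} {a : ℤ × ℤ} (ha : a ∈ S) : Qo a ⊆ Og S :=
  fun _ hz => ⟨a, ha, a, ha, Nb.refl a, Qo_sub_Wd_left a a hz⟩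

lemma ctr_mem (a : ℤ × ℤ) : ctr a ∈ Qo a := by
  refine ⟨⟨?_, ?_⟩, ?_, ?_⟩ <;> simp only [ctr] <;> linarith

lemma joined_Wd {c d : ℤ × ℤ} {x y : ℝ × ℝ} (hx : x ∈ Wd c d) (hy : y ∈ Wd c d) :
    JoinedIn (Wd c d) x y :=
  JoinedIn.of_segment_subset ((Wd_convex c d).segment_subset hx hy)

lemma Wd_sub_Og {S : Set (ℤ × ℤ)} {c d : ℤ × ℤ} (hc : c ∈ S) (hd : d ∈ S) (h : Nb c d) :
    Wd c d ⊆ Og S := fun _ hz => ⟨c, hc, d, hd, h, hz⟩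

lemma joined_ctr {S : Set (ℤ × ℤ)} {a b : ℤ × ℤ} (ha : a ∈ S) (h : Ch S a b) :
    JoinedIn (Og S) (ctr a) (ctr b) := by
  induction h with
  | refl => exact JoinedIn.refl (Qo_sub_Og ha (ctr_mem a))
  | tail _ h ih =>
    refine ih.trans ((joined_Wd ?_ ?_).mono (Wd_sub_Og h.2.1 h.2.2 h.1))
    · exact Qo_sub_Wd_left _ _ (ctr_mem _)
    · exact Qo_sub_Wd_right _ _ (ctr_mem _)

lemma Og_preconnected {S : Set (ℤ × ℤ)} (h : ∀ a ∈ S, ∀ b ∈ S, Ch S a b) :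
    IsPreconnected (Og S) := by
  rcases S.eq_empty_or_nonempty with rfl | ⟨a, ha⟩
  · have : Og ∅ = ∅ := by ext; simp [Og]
    rw [this]; exact isPreconnected_empty
  · have : IsPathConnected (Og S) := by
      refine ⟨ctr a, Qo_sub_Og ha (ctr_mem a), ?_⟩
      rintro z ⟨c, hc, d, hd, hn, hz⟩
      refine (joined_ctr ha (h a ha c hc)).trans ((joined_Wd ?_ hz).mono (Wd_sub_Og hc hd hn))
      exact Qo_sub_Wd_left _ _ (ctr_mem _)
    exact this.isConnected.isPreconnected

lemma Og_bounded {S : Set (ℤ × ℤ)} (h : S.Finite) : Bornology.IsBounded (Og S) := by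
  have : Og S ⊆ ⋃ a ∈ S, Icc (a.1 : ℝ) (a.1 + 1) ×ˢ Icc (a.2 : ℝ) (a.2 + 1) := by
    intro z hz
    have := fl_of_Og hz
    refine mem_biUnion this ⟨⟨Int.floor_le _, (Int.lt_floor_add_one _).le⟩,
      Int.floor_le _, (Int.lt_floor_add_one _).le⟩
  refine Bornology.IsBounded.subset ?_ this
  rw [Bornology.isBounded_biUnion h]
  intro a _
  exact (Metric.isBounded_Icc _ _).prod (Metric.isBounded_Icc _ _)

/-- squares meeting a set -/
def sq (W : Set (ℝ × ℝ)) : Set (ℤ × ℤ) := {a | (Qo a ∩ W).Nonempty}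

lemma sq_of_closed {W : Set (ℝ × ℝ)} (hW : IsOpen W) {p : ℝ × ℝ} (hp : p ∈ W) (a : ℤ × ℤ)
    (h1 : (a.1 : ℝ) ≤ p.1) (h2 : p.1 ≤ a.1 + 1) (h3 : (a.2 : ℝ) ≤ p.2) (h4 : p.2 ≤ a.2 + 1) :
    a ∈ sq W := by
  have hc : p ∈ closure (Qo a) := by
    unfold Qo
    rw [closure_prod_eq, closure_Ioo (by linarith), closure_Ioo (by linarith)]
    exact ⟨⟨h1, h2⟩, h3, h4⟩
  rw [mem_closure_iff] at hc
  obtain ⟨z, hz1, hz2⟩ := hc W hW hp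
  exact ⟨z, hz2, hz1⟩

lemma floor_near (t₀ : ℝ) : ∀ᶠ t : ℝ in 𝓝 t₀, (⌊t⌋ : ℤ) ≤ ⌊t₀⌋ ∧ t₀ ≤ (⌊t⌋ : ℝ) + 1 := by
  have h1 : ∀ᶠ t : ℝ in 𝓝 t₀, t < ⌊t₀⌋ + 1 := gt_mem_nhds (Int.lt_floor_add_one t₀)
  have h2 : ∀ᶠ t : ℝ in 𝓝 t₀, (⌈t₀⌉ : ℝ) - 1 < t :=
    lt_mem_nhds (by linarith [Int.ceil_lt_add_one t₀])
  filter_upwards [h1, h2] with t h1 h2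
  constructor
  · have : ⌊t⌋ < ⌊t₀⌋ + 1 := Int.floor_lt.mpr (by push_cast; exact h1)
    lia
  · have : ⌈t₀⌉ - 1 ≤ ⌊t⌋ := Int.le_floor.mpr (by push_cast; exact h2.le)
    have h4 : (⌈t₀⌉ : ℝ) - 1 ≤ ⌊t⌋ := by exact_mod_cast this
    linarith [Int.le_ceil t₀]

lemma sq_connected {W : Set (ℝ × ℝ)} (hW : IsOpen W) (hc : IsPreconnected W) {a b : ℤ × ℤ}
    (ha : a ∈ sq W) (hb : b ∈ sq W) : Ch (sq W) a b := by
  have key : ∀ p ∈ W, ∀ q ∈ W, Ch (sq W) (fl p) (fl q) := by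
    intro p hp q hq
    refine hc.induction₂ (fun p q => Ch (sq W) (fl p) (fl q)) ?_ ?_ ?_ hp hq
    · intro p hp
      have e1 := (continuous_fst.tendsto p).eventually (floor_near p.1)
      have e2 := (continuous_snd.tendsto p).eventually (floor_near p.2)
      filter_upwards [mem_nhdsWithin_of_mem_nhds e1, mem_nhdsWithin_of_mem_nhds e2,
        self_mem_nhdsWithin] with q h1 h2 hq
      obtain ⟨a1, a2⟩ := h1
      obtain ⟨b1, b2⟩ := h2
      have a3 : ⌊p.1⌋ ≤ ⌊q.1⌋ + 1 := by
        have : (⌊p.1⌋ : ℝ) ≤ (⌊q.1⌋ : ℝ) + 1 := (Int.floor_le _).trans a2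
        exact_mod_cast this
      have b3 : ⌊p.2⌋ ≤ ⌊q.2⌋ + 1 := by
        have : (⌊p.2⌋ : ℝ) ≤ (⌊q.2⌋ : ℝ) + 1 := (Int.floor_le _).trans b2
        exact_mod_cast this
      have a4 : (⌊q.1⌋ : ℝ) ≤ p.1 := (by exact_mod_cast a1 : (⌊q.1⌋ : ℝ) ≤ ⌊p.1⌋).trans (Int.floor_le _)
      have m1 : fl p ∈ sq W := sq_of_closed hW hp _ (Int.floor_le _) (Int.lt_floor_add_one _).le
        (Int.floor_le _) (Int.lt_floor_add_one _).le
      have m2 : fl q ∈ sq W := sq_of_closed hW hq _ (Int.floor_le _) (Int.lt_floor_add_one _).le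
        (Int.floor_le _) (Int.lt_floor_add_one _).le
      have m3 : (⌊q.1⌋, ⌊p.2⌋) ∈ sq W := sq_of_closed hW hp _ a4 a2
        (Int.floor_le _) (Int.lt_floor_add_one _).le
      refine (Ch.single m1 m3 ?_).trans (Ch.single m3 m2 ?_)
      · right; simp only [fl]; lia
      · left; simp only [fl]; lia
    · intro x y z _ _ _ h1 h2; exact h1.trans h2
    · intro x y _ _ h; exact h.symm
  obtain ⟨x, hx, hx'⟩ := ha
  obtain ⟨y, hy, hy'⟩ := hb
  have := key x hx' y hy'
  rwa [fl_of_mem hx, fl_of_mem hy] at this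

/-- (A2) images of two neighbouring squares are chain connected -/
lemma Er_connected (g : (ℝ × ℝ) ≃ₜ (ℝ × ℝ)) {a b c d : ℤ × ℤ} (hn : Nb a b)
    (hc : Er g a c ∨ Er g b c) (hd : Er g a d ∨ Er g b d) :
    Ch {e | Er g a e ∨ Er g b e} c d := by
  have hW : IsOpen (g '' Wd a b) := g.isOpenMap _ (Wd_open a b)
  have hWc : IsPreconnected (g '' Wd a b) :=
    (Wd_convex a b).isPreconnected.image _ g.continuous.continuousOn
  have eq : sq (g '' Wd a b) = {e | Er g a e ∨ Er g b e} := by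
    ext e
    constructor
    · rintro ⟨_, hz1, w, hw, rfl⟩
      obtain ⟨w', ⟨h1, h2⟩, h3⟩ := GenS_dense.inter_open_nonempty
        (Wd a b ∩ g ⁻¹' Qo e) ((Wd_open a b).inter ((Qo_open e).preimage g.continuous)) ⟨w, hw, hz1⟩
      have h4 := mem_Qo_fl h3
      rcases fl_of_Wd hn h1 with h | h
      · rw [h] at h4; exact Or.inl ⟨w', h4, h2⟩
      · rw [h] at h4; exact Or.inr ⟨w', h4, h2⟩
    · rintro (⟨z, h1, h2⟩ | ⟨z, h1, h2⟩)
      · exact ⟨g z, h2, z, Qo_sub_Wd_left _ _ h1, rfl⟩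
      · exact ⟨g z, h2, z, Qo_sub_Wd_right _ _ h1, rfl⟩
  rw [← eq]
  apply sq_connected hW hWc
  · rw [eq]; exact hc
  · rw [eq]; exact hd

lemma Er_exists (g : (ℝ × ℝ) ≃ₜ (ℝ × ℝ)) (U : Set (ℝ × ℝ)) (hU : IsOpen U) (hne : U.Nonempty) :
    ∃ z ∈ U, z ∈ GenS ∧ g z ∈ GenS := by
  have h1 := GenS_dense.inter_open_nonempty U hU hne
  have h2 := GenS_dense.preimage g.isOpenMap
  obtain ⟨z, ⟨h3, h4⟩, h5⟩ := h2.inter_open_nonempty (U ∩ GenS) (hU.inter GenS_open) h1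
  exact ⟨z, h3, h4, h5⟩

/-- (A3) -/
lemma Er_succ (g : (ℝ × ℝ) ≃ₜ (ℝ × ℝ)) (a : ℤ × ℤ) : ∃ c, Er g a c := by
  obtain ⟨z, h1, h2, h3⟩ := Er_exists g (Qo a) (Qo_open a) ⟨_, ctr_mem a⟩
  exact ⟨fl (g z), z, h1, mem_Qo_fl h3⟩

lemma Er_symm (g : (ℝ × ℝ) ≃ₜ (ℝ × ℝ)) (a c : ℤ × ℤ) : Er g.symm a c ↔ Er g c a := by
  constructor
  · rintro ⟨z, h1, h2⟩; exact ⟨g.symm z, h2, by simpa using h1⟩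
  · rintro ⟨z, h1, h2⟩; exact ⟨g z, h2, by simpa using h1⟩

lemma Og_free (g : (ℝ × ℝ) ≃ₜ (ℝ × ℝ)) (S : Set (ℤ × ℤ)) (h : ∀ a ∈ S, ∀ b ∈ S, ¬ Er g a b) :
    Free g (Og S) := by
  intro z hz hz2
  obtain ⟨w, ⟨h1, h2⟩, h3, h4⟩ := Er_exists g (Og S ∩ g ⁻¹' Og S)
    ((Og_open S).inter ((Og_open S).preimage g.continuous)) ⟨z, hz, hz2⟩
  exact h _ (fl_of_Og h1) _ (fl_of_Og h2) ⟨w, mem_Qo_fl h3, mem_Qo_fl h4⟩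

/-- (A4) no cyclic chain of free sets of squares -/
lemma Er_franks (g : (ℝ × ℝ) ≃ₜ (ℝ × ℝ)) (Hg : HH g) (k : ℕ) [NeZero k] (S : ZMod k → Set (ℤ × ℤ))
    (hfin : ∀ i, (S i).Finite) (hc : ∀ i, ∀ a ∈ S i, ∀ b ∈ S i, Ch (S i) a b)
    (hf : ∀ i, ∀ a ∈ S i, ∀ b ∈ S i, ¬ Er g a b) (hd : ∀ i j, i ≠ j → Disjoint (S i) (S j))
    (he : ∀ i, ∃ a ∈ S i, ∃ b ∈ S (i + 1), Er g a b) : False := by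
  choose a ha b hb z hz hz2 using he
  refine franks k g Hg (fun i => Og (S i)) (fun i => Og_open _) (fun i => Og_preconnected (hc i))
    (fun i => Og_bounded (hfin i)) ?_ (fun i => Og_free g _ (hf i)) z
    (fun i => Qo_sub_Og (ha i) (hz i)) (fun i => Qo_sub_Og (hb i) (hz2 i))
  intro i j hij
  rw [Set.disjoint_left]
  intro x h1 h2
  exact Set.disjoint_left.mp (hd i j hij) (fl_of_Og h1) (fl_of_Og h2)

end Fr

namespace Fr

/-- integer vector as a real vector -/
def rv (v : ℤ × ℤ) : ℝ × ℝ := ((v.1 : ℝ), (v.2 : ℝ))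

lemma rv_add (v w : ℤ × ℤ) : rv (v + w) = rv v + rv w := by simp [rv]

lemma rv_zsmul (k : ℤ) (v : ℤ × ℤ) : rv (k • v) = (k : ℝ) • rv v := by simp [rv]

/-- linear functional -/
def lin (l x : ℝ × ℝ) : ℝ := l.1 * x.1 + l.2 * x.2

lemma lin_add (l x y : ℝ × ℝ) : lin l (x + y) = lin l x + lin l y := by simp [lin]; ring
lemma lin_sub (l x y : ℝ × ℝ) : lin l (x - y) = lin l x - lin l y := by simp [lin]; ring
lemma lin_smul (l : ℝ × ℝ) (t : ℝ) (x : ℝ × ℝ) : lin l (t • x) = t * lin l x := by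
  simp [lin]; ring
lemma lin_neg_left (l x : ℝ × ℝ) : lin (-l) x = - lin l x := by simp [lin]; ring
lemma lin_smul_left (l : ℝ × ℝ) (t : ℝ) (x : ℝ × ℝ) : lin (t • l) x = t * lin l x := by
  simp [lin]; ring

lemma lin_bound (l x : ℝ × ℝ) : |lin l x| ≤ (|l.1| + |l.2|) * ‖x‖ := by
  unfold lin
  have h1 : |x.1| ≤ ‖x‖ := norm_fst_le x
  have h2 : |x.2| ≤ ‖x‖ := norm_snd_le x
  calc |l.1 * x.1 + l.2 * x.2| ≤ |l.1 * x.1| + |l.2 * x.2| := abs_add_le _ _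
    _ = |l.1| * |x.1| + |l.2| * |x.2| := by rw [abs_mul, abs_mul]
    _ ≤ |l.1| * ‖x‖ + |l.2| * ‖x‖ := by gcongr
    _ = _ := by ring

lemma lin_cont (l : ℝ × ℝ) : Continuous (lin l) := by unfold lin; fun_prop

lemma Qo_shift {z : ℝ × ℝ} {a : ℤ × ℤ} (v : ℤ × ℤ) (h : z ∈ Qo a) : z + rv v ∈ Qo (a + v) := by
  obtain ⟨⟨h1, h2⟩, h3, h4⟩ := h
  refine ⟨⟨?_, ?_⟩, ?_, ?_⟩ <;> simp only [rv, Prod.fst_add, Prod.snd_add] <;> push_cast <;> linarith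


lemma Wd_shift {z : ℝ × ℝ} {c d : ℤ × ℤ} (v : ℤ × ℤ) (h : z ∈ Wd c d) :
    z + rv v ∈ Wd (c + v) (d + v) := by
  obtain ⟨⟨h1, h2⟩, h3, h4⟩ := h
  refine ⟨⟨?_, ?_⟩, ?_, ?_⟩ <;> simp only [rv, Prod.fst_add, Prod.snd_add]
  · rw [min_add_add_right]; push_cast at *; linarith
  · rw [max_add_add_right]; push_cast at *; linarith
  · rw [min_add_add_right]; push_cast at *; linarith
  · rw [max_add_add_right]; push_cast at *; linarith

lemma Og_shift {S : Set (ℤ × ℤ)} {v : ℤ × ℤ} (hS : ∀ c ∈ S, c + v ∈ S) {z : ℝ × ℝ} (h : z ∈ Og S) :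
    z + rv v ∈ Og S := by
  obtain ⟨c, hc, d, hd, hn, hz⟩ := h
  exact ⟨c + v, hS c hc, d + v, hS d hd, hn.shift v, Wd_shift v hz⟩

lemma ctr_add (a v : ℤ × ℤ) : ctr (a + v) = ctr a + rv v := by
  apply Prod.ext <;> simp [ctr, rv] <;> ring

/-- periodic curves in chain connected invariant sets of squares -/
lemma periodic_curve (S : Set (ℤ × ℤ)) (v : ℤ × ℤ) (hS : ∀ k : ℤ, ∀ c ∈ S, c + k • v ∈ S)
    (a : ℤ × ℤ) (ha : a ∈ S) (hch : Ch S a (a + v)) :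
    ∃ γ : ℝ → ℝ × ℝ, Continuous γ ∧ (∀ t, γ t ∈ Og S) ∧ ∃ M, ∀ t, ‖γ t - t • rv v‖ ≤ M := by
  obtain ⟨p, hp⟩ := joined_ctr ha hch
  set q : ℝ → ℝ × ℝ := fun t => p.extend t - t • rv v with hq
  have hqc : Continuous q := by
    have := p.continuous_extend
    fun_prop
  have hq01 : q 0 = q 1 := by
    simp [hq, ctr_add]
  have hqf : Continuous (q ∘ Int.fract) := hqc.continuousOn.comp_fract'' hq01
  obtain ⟨M, hM⟩ := (isCompact_Icc (a := (0 : ℝ)) (b := 1)).exists_bound_of_continuousOn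
    hqc.continuousOn
  refine ⟨fun t => q (Int.fract t) + t • rv v, ?_, ?_, M, ?_⟩
  · exact hqf.add (continuous_id.smul continuous_const)
  · intro t
    have e : q (Int.fract t) + t • rv v = p.extend (Int.fract t) + rv (⌊t⌋ • v) := by
      simp only [hq, rv_zsmul]
      have : t • rv v = (⌊t⌋ : ℝ) • rv v + Int.fract t • rv v := by
        rw [← add_smul, Int.floor_add_fract]
      rw [this]; abel
    change q (Int.fract t) + t • rv v ∈ Og S
    rw [e]
    apply Og_shift (hS _)
    have hm : Int.fract t ∈ Icc (0 : ℝ) 1 := ⟨Int.fract_nonneg t, (Int.fract_lt_one t).le⟩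
    rw [p.extend_apply hm]
    exact hp _
  · intro t
    simp only [add_sub_cancel_right]
    exact hM _ ⟨Int.fract_nonneg t, (Int.fract_lt_one t).le⟩

/-- (A6) crossing -/
lemma cross_sets (S S' : Set (ℤ × ℤ)) (v v' : ℤ × ℤ) (hS : ∀ k : ℤ, ∀ c ∈ S, c + k • v ∈ S)
    (hS' : ∀ k : ℤ, ∀ c ∈ S', c + k • v' ∈ S') (a a' : ℤ × ℤ) (ha : a ∈ S) (ha' : a' ∈ S')
    (hch : Ch S a (a + v)) (hch' : Ch S' a' (a' + v')) (hdet : v.1 * v'.2 - v.2 * v'.1 ≠ 0) :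
    ∃ c, c ∈ S ∧ c ∈ S' := by
  obtain ⟨γ, h1, h2, M, h3⟩ := periodic_curve S v hS a ha hch
  obtain ⟨γ', h1', h2', M', h3'⟩ := periodic_curve S' v' hS' a' ha' hch'
  obtain ⟨s, t, hst⟩ := curves_cross γ γ' h1 h1' (rv v) (rv v') (by
    simp only [rv]; exact_mod_cast hdet) (max M M') (fun t => (h3 t).trans (le_max_left _ _))
    (fun t => (h3' t).trans (le_max_right _ _))
  refine ⟨fl (γ s), fl_of_Og (h2 s), ?_⟩
  rw [hst]; exact fl_of_Og (h2' t)

/-- one side of the argument on invariant curves -/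
lemma side (g : (ℝ × ℝ) ≃ₜ (ℝ × ℝ)) (M : ℝ) (hM : ∀ x, ‖g x - x‖ ≤ M) (Γ : Set (ℝ × ℝ))
    (l : ℝ × ℝ) (C : ℝ) (hC : ∀ x, C < lin l x → x ∉ Γ)
    (sep : ∀ x y, C < lin l x → lin l y < -C → ¬ JoinedIn Γᶜ x y)
    (star : ∀ K : ℝ, ∃ x, ∃ n : ℕ, K ≤ lin l (g^[n] x - x))
    (e : ℝ × ℝ) (he : ∀ x, ∀ k : ℤ, g (x + (k : ℝ) • e) = g x + (k : ℝ) • e) (hpos : 0 < lin l e) :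
    ∃ z ∈ Γ, ∃ y, C < lin l y ∧ JoinedIn Γᶜ y (g z) := by
  by_contra hcon
  push Not at hcon
  -- points above are joined
  have hj : ∀ x y, C < lin l x → C < lin l y → JoinedIn Γᶜ x y := by
    intro x y hx hy
    apply JoinedIn.of_segment_subset
    intro z hz
    apply hC
    rw [segment_eq_image'] at hz
    obtain ⟨t, ⟨h0, h1⟩, rfl⟩ := hz
    rw [lin_add, lin_smul, lin_sub]
    have b1 : 0 ≤ (1 - t) * (lin l x - C) := mul_nonneg (by linarith) (by linarith)
    rcases h0.eq_or_lt with rfl | h0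
    · linarith
    · have b2 : 0 < t * (lin l y - C) := mul_pos h0 (by linarith)
      nlinarith
  set D := (|l.1| + |l.2|) * M with hD
  have hdisp : ∀ x, |lin l (g x) - lin l x| ≤ D := by
    intro x
    rw [← lin_sub]
    exact (lin_bound _ _).trans (mul_le_mul_of_nonneg_left (hM x) (by positivity))
  have back : ∀ x, (∃ y, C < lin l y ∧ JoinedIn Γᶜ y (g x)) → ∃ y, C < lin l y ∧ JoinedIn Γᶜ y x := by
    rintro x ⟨y, hy, hyx⟩
    obtain ⟨k, hk⟩ := exists_nat_gt ((C + D - lin l y) / lin l e)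
    rw [div_lt_iff₀ hpos] at hk
    set u := y + (k : ℝ) • e with hu
    have hlu : lin l u = lin l y + k * lin l e := by rw [hu, lin_add, lin_smul]
    have hD0 : 0 ≤ D := (abs_nonneg _).trans (hdisp x)
    have huC : C < lin l u := by rw [hlu]; linarith
    obtain ⟨p, hp⟩ := (hj u y huC hy).trans hyx
    have hpn : ∀ t, g.symm (p t) ∉ Γ := by
      intro t ht
      apply hcon _ ht u huC
      rw [g.apply_symm_apply]
      have hpc : IsPathConnected (range p) := by
        rw [← p.extend_range]; exact isPathConnected_range p.continuous_extend
      have hr : JoinedIn (range p) (p 0) (p t) :=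
        hpc.joinedIn _ (mem_range_self _) _ (mem_range_self _)
      rw [p.source] at hr
      apply hr.mono
      rintro _ ⟨s, rfl⟩
      exact hp s
    refine ⟨g.symm u, ?_, ?_⟩
    · have := hdisp (g.symm u)
      rw [g.apply_symm_apply] at this
      have := (abs_le.mp this).2
      rw [hlu] at this
      linarith
    · have e2 : x = g.symm (g x) := by simp
      rw [e2]
      exact ⟨p.map g.symm.continuous, hpn⟩
  have backn : ∀ n : ℕ, ∀ x, (∃ y, C < lin l y ∧ JoinedIn Γᶜ y (g^[n] x)) →
      ∃ y, C < lin l y ∧ JoinedIn Γᶜ y x := by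
    intro n
    induction n with
    | zero => intro x h; exact h
    | succ n ih =>
      intro x h
      rw [iterate_succ_apply'] at h
      exact ih x (back _ h)
  obtain ⟨x, n, hxn⟩ := star (2 * |C| + 2 + lin l e)
  set k : ℤ := ⌊(-|C| - 1 - lin l x) / lin l e⌋ with hk
  have k1 : (k : ℝ) * lin l e ≤ -|C| - 1 - lin l x := by
    have := Int.floor_le ((-|C| - 1 - lin l x) / lin l e)
    rwa [le_div_iff₀ hpos] at this
  have k2 : -|C| - 1 - lin l x < (k + 1) * lin l e := by
    have := Int.lt_floor_add_one ((-|C| - 1 - lin l x) / lin l e)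
    rwa [div_lt_iff₀ hpos] at this
  have hit : ∀ n : ℕ, g^[n] (x + (k : ℝ) • e) = g^[n] x + (k : ℝ) • e := by
    intro n
    induction n with
    | zero => rfl
    | succ n ih => rw [iterate_succ_apply', ih, he, iterate_succ_apply']
  have hCa := le_abs_self C
  have hCb := neg_abs_le C
  have htop : C < lin l (g^[n] (x + (k : ℝ) • e)) := by
    rw [hit, lin_add, lin_smul]
    rw [lin_sub] at hxn
    linarith
  obtain ⟨y, hy1, hy2⟩ := backn n (x + (k : ℝ) • e) ⟨_, htop, JoinedIn.refl (hC _ htop)⟩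
  refine sep y _ hy1 ?_ hy2
  rw [lin_add, lin_smul]
  linarith

/-- (A5) there is no free periodic curve -/
lemma no_free_curve (g : (ℝ × ℝ) ≃ₜ (ℝ × ℝ)) (M : ℝ) (hM : ∀ x, ‖g x - x‖ ≤ M)
    (γ : ℝ → ℝ × ℝ) (hγ : Continuous γ) (w : ℝ × ℝ) (hw : w ≠ 0) (B : ℝ)
    (hB : ∀ t, ‖γ t - t • w‖ ≤ B) (hfree : ∀ s t, g (γ s) ≠ γ t)
    (star : ∀ l : ℝ × ℝ, l ≠ 0 → ∀ K : ℝ, ∃ x, ∃ n : ℕ, K ≤ lin l (g^[n] x - x))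
    (hper : ∀ x, ∀ k : ℤ, g (x + (k : ℝ) • (-w.2, w.1)) = g x + (k : ℝ) • (-w.2, w.1)) : False := by
  set l : ℝ × ℝ := (-w.2, w.1) with hl
  have hl0 : l ≠ 0 := by
    intro h
    apply hw
    have h1 := congrArg Prod.fst h
    have h2 := congrArg Prod.snd h
    simp [hl] at h1 h2
    exact Prod.ext h2 h1
  have hlw : lin l w = 0 := by simp [lin, hl]; ring
  have hll : 0 < lin l l := by
    simp only [lin, hl]
    by_contra hneg
    apply hl0
    have : w.1 = 0 := by nlinarith
    have : w.2 = 0 := by nlinarith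
    simp [*]
  set Γ := range γ with hΓ
  set C := (|l.1| + |l.2|) * B with hC
  have hlγ : ∀ t, |lin l (γ t)| ≤ C := by
    intro t
    have : lin l (γ t) = lin l (γ t - t • w) := by rw [lin_sub, lin_smul, hlw]; ring
    rw [this]
    exact (lin_bound _ _).trans (mul_le_mul_of_nonneg_left (hB t) (by positivity))
  have hup : ∀ x, C < lin l x → x ∉ Γ := by
    rintro _ h ⟨t, rfl⟩
    exact absurd (abs_le.mp (hlγ t)).2 (not_le.mpr h)
  have hdown : ∀ x, lin l x < -C → x ∉ Γ := by
    rintro _ h ⟨t, rfl⟩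
    exact absurd (abs_le.mp (hlγ t)).1 (not_le.mpr h)
  have sep : ∀ x y, C < lin l x → lin l y < -C → ¬ JoinedIn Γᶜ x y := by
    rintro x y hx hy ⟨p, hp⟩
    set δ : ℝ → ℝ × ℝ := fun s => p.extend s + (- min s 0 - max (s - 1) 0) • l with hδ
    have hδc : Continuous δ := by
      have := p.continuous_extend
      fun_prop
    obtain ⟨R, hR⟩ : ∃ R, ∀ s, ‖p.extend s‖ ≤ R := by
      have := isCompact_range p.continuous
      obtain ⟨R, hR⟩ := this.isBounded.exists_norm_le
      refine ⟨R, fun s => hR _ ?_⟩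
      rw [← p.extend_range]
      exact mem_range_self s
    obtain ⟨s, t, hst⟩ := curves_cross δ γ hδc hγ (-l) w (by
        simp only [lin, hl] at hll
        simp only [hl, Prod.fst_neg, Prod.snd_neg]
        intro h; nlinarith) (max (R + ‖l‖) B) (by
        intro s
        refine le_trans ?_ (le_max_left _ _)
        have : δ s - s • (-l) = p.extend s + (s - min s 0 - max (s - 1) 0) • l := by
          simp only [hδ]; module
        rw [this]
        refine (norm_add_le _ _).trans (add_le_add (hR s) ?_)
        rw [norm_smul, Real.norm_eq_abs]
        have : |s - min s 0 - max (s - 1) 0| ≤ 1 := by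
          rw [abs_le]
          rcases le_total s 0 with h | h <;> rcases le_total (s - 1) 0 with h' | h' <;>
            simp only [min_eq_left, min_eq_right, max_eq_left, max_eq_right, h, h'] <;>
            constructor <;> linarith
        nlinarith [norm_nonneg l]) (fun t => (hB t).trans (le_max_right _ _))
    have hmem : δ s ∈ Γ := ⟨t, hst.symm⟩
    rcases lt_or_ge s 0 with h | h
    · apply hup _ _ hmem
      have : p.extend s = x := p.extend_of_le_zero h.le
      simp only [hδ]
      rw [this, lin_add, lin_smul, min_eq_left h.le, max_eq_right (by linarith)]
      nlinarith
    rcases lt_or_ge 1 s with h1 | h1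
    · apply hdown _ _ hmem
      have : p.extend s = y := p.extend_of_one_le h1.le
      simp only [hδ]
      rw [this, lin_add, lin_smul, min_eq_right h, max_eq_left (by linarith)]
      nlinarith
    · have e : δ s = p ⟨s, h, h1⟩ := by
        simp only [hδ]
        rw [p.extend_apply ⟨h, h1⟩, min_eq_right h, max_eq_right (by linarith)]
        simp
      rw [e] at hmem
      exact hp _ hmem
  obtain ⟨_, ⟨t, rfl⟩, y, hy, hyj⟩ := side g M hM Γ l C hup sep (star l hl0) l hper hll
  obtain ⟨_, ⟨t', rfl⟩, y', hy', hyj'⟩ := side g M hM Γ (-l) C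
    (fun x hx => hdown x (by rw [lin_neg_left] at hx; linarith))
    (fun a b ha hb hj => sep b a (by rw [lin_neg_left] at hb; linarith)
      (by rw [lin_neg_left] at ha; linarith) hj.symm)
    (star (-l) (neg_ne_zero.mpr hl0)) (-l) (by
      intro x k
      have := hper x (-k)
      simpa using this) (by simpa [lin] using hll)
  rw [lin_neg_left] at hy'
  apply sep y y' hy (by linarith)
  refine hyj.trans (JoinedIn.trans ?_ hyj'.symm)
  have hpc : JoinedIn (range (g ∘ γ)) (g (γ t)) (g (γ t')) :=
    (isPathConnected_range (g.continuous.comp hγ)).joinedIn _ ⟨t, rfl⟩ _ ⟨t', rfl⟩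
  apply hpc.mono
  rintro _ ⟨s, rfl⟩ ⟨s', h⟩
  exact hfree s s' h.symm

/-- standing hypotheses of the main argument -/
structure Std (g : (ℝ × ℝ) ≃ₜ (ℝ × ℝ)) (N : ℕ) : Prop where
  pos : 1 ≤ N
  per : ∀ x v, g (x + rv (N • v)) = g x + rv (N • v)
  bd : ∃ M : ℝ, ∀ x, ‖g x - x‖ ≤ M
  far : ∀ x, 1 ≤ ‖g x - x‖
  star : ∀ l : ℝ × ℝ, l ≠ 0 → ∀ K : ℝ, ∃ x, ∃ n : ℕ, K ≤ lin l (g^[n] x - x)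

lemma Std.HH {g : (ℝ × ℝ) ≃ₜ (ℝ × ℝ)} {N : ℕ} (h : Std g N) : HH g := by
  refine ⟨h.bd, fun x hx => ?_⟩
  have := h.far x
  rw [hx] at this
  norm_num at this

/-- (A1) -/
lemma Std.shift {g : (ℝ × ℝ) ≃ₜ (ℝ × ℝ)} {N : ℕ} (h : Std g N) {a c : ℤ × ℤ} (v : ℤ × ℤ)
    (he : Er g a c) : Er g (a + N • v) (c + N • v) := by
  obtain ⟨z, h1, h2⟩ := he
  refine ⟨z + rv (N • v), Qo_shift _ h1, ?_⟩
  rw [h.per]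
  exact Qo_shift _ h2

lemma Std.not_self {g : (ℝ × ℝ) ≃ₜ (ℝ × ℝ)} {N : ℕ} (h : Std g N) (a : ℤ × ℤ) : ¬ Er g a a := by
  rintro ⟨z, ⟨⟨h1, h2⟩, h3, h4⟩, ⟨⟨h5, h6⟩, h7, h8⟩⟩
  have := h.far z
  have h9 : ‖g z - z‖ < 1 := by
    rw [Prod.norm_def, max_lt_iff, Real.norm_eq_abs, Real.norm_eq_abs, abs_lt, abs_lt]
    simp only [Prod.fst_sub, Prod.snd_sub]
    refine ⟨⟨?_, ?_⟩, ?_, ?_⟩ <;> linarith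
  linarith

/-- (A5) -/
lemma Std.strip {g : (ℝ × ℝ) ≃ₜ (ℝ × ℝ)} {N : ℕ} (h : Std g N) (S : Set (ℤ × ℤ)) (v : ℤ × ℤ)
    (hv : v ≠ 0) (hS : ∀ k : ℤ, ∀ c ∈ S, c + k • (N • v) ∈ S) (a : ℤ × ℤ) (ha : a ∈ S)
    (hch : Ch S a (a + N • v)) : ∃ x ∈ S, ∃ y ∈ S, Er g x y := by
  by_contra hcon
  push Not at hcon
  obtain ⟨γ, h1, h2, B, h3⟩ := periodic_curve S (N • v) hS a ha hch
  obtain ⟨M, hM⟩ := h.bd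
  refine no_free_curve g M hM γ h1 (rv (N • v)) ?_ B h3 ?_ h.star ?_
  · intro h0
    apply hv
    have hN := h.pos
    have e1 := congrArg Prod.fst h0
    have e2 := congrArg Prod.snd h0
    simp [rv] at e1 e2
    refine Prod.ext (e1.resolve_left (by lia)) (e2.resolve_left (by lia))
  · intro s t hst
    apply Og_free g S hcon (γ s) (h2 s)
    rw [hst]; exact h2 t
  · intro x k
    have e : (k : ℝ) • ((-(rv (N • v)).2, (rv (N • v)).1) : ℝ × ℝ) =
        rv (N • (k • ((-v.2, v.1) : ℤ × ℤ))) := by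
      apply Prod.ext <;> simp [rv] <;> ring
    rw [e]
    exact h.per x _

end Fr

namespace Fr

lemma climb {ρ : Type*} [DecidableEq ρ] (n : ℕ) (val : ℕ → ℝ) (res : ℕ → ρ) (D : ℝ) (hD : 0 ≤ D)
    (hstep : ∀ i, val (i + 1) ≤ val i + D)
    (hno : ∀ i j, i < j → res i = res j → val j ≤ val i) (m : ℕ) :
    ∀ i, i ≤ n → ((Finset.Icc i n).image res).card ≤ m → val n ≤ val i + m * D := by
  induction m with
  | zero =>
    intro i hi hcard
    exfalso
    have : res i ∈ (Finset.Icc i n).image res :=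
      Finset.mem_image_of_mem _ (Finset.mem_Icc.mpr ⟨le_rfl, hi⟩)
    have := Finset.card_pos.mpr ⟨_, this⟩
    lia
  | succ m ih =>
    intro i hi hcard
    set F := (Finset.Icc i n).filter (fun j => res j = res i) with hF
    have hFne : F.Nonempty := ⟨i, by simp [hF, hi]⟩
    set j := F.max' hFne with hj
    have hjF : j ∈ F := F.max'_mem hFne
    obtain ⟨h1, h2⟩ := Finset.mem_filter.mp hjF
    obtain ⟨h3, h4⟩ := Finset.mem_Icc.mp h1
    have hji : val j ≤ val i := by
      rcases h3.eq_or_lt with h | h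
      · rw [← h]
      · exact hno i j h h2.symm
    have hm0 : 0 ≤ (m : ℝ) * D := by positivity
    push_cast
    rcases h4.eq_or_lt with h | h
    · rw [← h]; linarith
    · have hsub : (Finset.Icc (j + 1) n).image res ⊆ ((Finset.Icc i n).image res).erase (res i) := by
        intro r hr
        obtain ⟨k, hk, rfl⟩ := Finset.mem_image.mp hr
        obtain ⟨k1, k2⟩ := Finset.mem_Icc.mp hk
        rw [Finset.mem_erase]
        refine ⟨fun hh => ?_, Finset.mem_image_of_mem _ (Finset.mem_Icc.mpr ⟨by lia, k2⟩)⟩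
        have : k ≤ j := F.le_max' k (Finset.mem_filter.mpr ⟨Finset.mem_Icc.mpr ⟨by lia, k2⟩, hh⟩)
        lia
      have hc := Finset.card_le_card hsub
      rw [Finset.card_erase_of_mem
        (Finset.mem_image_of_mem _ (Finset.mem_Icc.mpr ⟨le_rfl, hi⟩))] at hc
      have := ih (j + 1) h (by lia)
      have := hstep j
      linarith

/-- (A7) loops in every direction -/
lemma Std.loop {g : (ℝ × ℝ) ≃ₜ (ℝ × ℝ)} {N : ℕ} (h : Std g N) (l : ℝ × ℝ) (hl : l ≠ 0) :
    ∃ a w, Relation.TransGen (Er g) a (a + N • w) ∧ 0 < lin l (rv w) := by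
  by_contra hcon
  push Not at hcon
  have hN := h.pos
  have : NeZero N := ⟨by lia⟩
  obtain ⟨M, hM⟩ := h.bd
  set L := |l.1| + |l.2| with hL
  have hL0 : 0 ≤ L := by positivity
  have hM0 : 0 ≤ M := (norm_nonneg _).trans (hM 0)
  set D := L * (M + 2) with hD
  have hD0 : 0 ≤ D := by positivity
  obtain ⟨x, n, hx⟩ := h.star l hl ((N * N : ℕ) * D + 2 * L + 1)
  -- generic point
  have hcont : Continuous (fun x => lin l (g^[n] x - x)) := by
    have := g.continuous.iterate n
    exact (lin_cont l).comp (by fun_prop)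
  have hopen : IsOpen {x | (N * N : ℕ) * D + 2 * L < lin l (g^[n] x - x)} :=
    isOpen_lt continuous_const hcont
  have hio : ∀ i, IsOpenMap (g^[i]) := fun i => by
    induction i with
    | zero => exact IsOpenMap.id
    | succ i ih => rw [iterate_succ]; exact ih.comp g.isOpenMap
  have hdense : Dense (⋂ i : ℕ, (g^[i]) ⁻¹' GenS) := by
    apply dense_iInter_of_isOpen_nat
    · intro i; exact GenS_open.preimage (g.continuous.iterate i)
    · intro i; exact GenS_dense.preimage (hio i)
  obtain ⟨z, hz1, hz2⟩ := hdense.inter_open_nonempty _ hopen ⟨x, by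
    change _ < lin l (g^[n] x - x)
    linarith⟩
  change _ < lin l (g^[n] z - z) at hz1
  have hgen : ∀ i, g^[i] z ∈ GenS := fun i => mem_iInter.mp hz2 i
  set a : ℕ → ℤ × ℤ := fun i => fl (g^[i] z) with ha
  have hE : ∀ i, Er g (a i) (a (i + 1)) := by
    intro i
    refine ⟨g^[i] z, mem_Qo_fl (hgen i), ?_⟩
    rw [← iterate_succ_apply' g]
    exact mem_Qo_fl (hgen (i + 1))
  have hT : ∀ i j, i < j → Relation.TransGen (Er g) (a i) (a j) := by
    intro i j hij
    induction j, hij using Nat.le_induction with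
    | base => exact Relation.TransGen.single (hE i)
    | succ j _ ih => exact ih.tail (hE j)
  have hclose : ∀ y : ℝ × ℝ, |lin l (rv (fl y)) - lin l y| ≤ L := by
    intro y
    rw [← lin_sub]
    refine (lin_bound _ _).trans ?_
    have : ‖rv (fl y) - y‖ ≤ 1 := by
      rw [Prod.norm_def, max_le_iff, Real.norm_eq_abs, Real.norm_eq_abs, abs_le, abs_le]
      simp only [Prod.fst_sub, Prod.snd_sub, rv, fl]
      have := Int.floor_le y.1
      have := Int.floor_le y.2
      have := Int.lt_floor_add_one y.1
      have := Int.lt_floor_add_one y.2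
      refine ⟨⟨?_, ?_⟩, ?_, ?_⟩ <;> linarith
    exact mul_le_of_le_one_right hL0 this
  have hstep : ∀ i, lin l (rv (a (i + 1))) ≤ lin l (rv (a i)) + D := by
    intro i
    have h1 := abs_le.mp (hclose (g^[i] z))
    have h2 := abs_le.mp (hclose (g^[i + 1] z))
    have h3 := abs_le.mp ((lin_bound l (g (g^[i] z) - g^[i] z)).trans
      (mul_le_mul_of_nonneg_left (hM _) (by positivity)))
    rw [lin_sub, ← iterate_succ_apply' g] at h3
    simp only [ha]
    rw [hD]
    nlinarith
  have hno : ∀ i j, i < j → (fun i => (((a i).1 : ZMod N), ((a i).2 : ZMod N))) i =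
      (fun i => (((a i).1 : ZMod N), ((a i).2 : ZMod N))) j →
      lin l (rv (a j)) ≤ lin l (rv (a i)) := by
    intro i j hij hr
    simp only [Prod.mk.injEq] at hr
    obtain ⟨r1, r2⟩ := hr
    rw [ZMod.intCast_eq_intCast_iff_dvd_sub] at r1 r2
    obtain ⟨w1, hw1⟩ := r1
    obtain ⟨w2, hw2⟩ := r2
    have e : a j = a i + N • ((w1, w2) : ℤ × ℤ) := by
      apply Prod.ext
      · simp; linarith
      · simp; linarith
    have ht := hT i j hij
    rw [e] at ht
    have := hcon _ _ ht
    have e2 : rv (N • ((w1, w2) : ℤ × ℤ)) = (N : ℝ) • rv (w1, w2) := by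
      simp [rv]
    rw [e, rv_add, lin_add, e2, lin_smul]
    nlinarith [(Nat.cast_nonneg N : (0 : ℝ) ≤ N)]
  have := climb n (fun i => lin l (rv (a i))) _ D hD0 hstep hno (N * N) 0 (Nat.zero_le _) (by
    refine (Finset.card_le_univ _).trans ?_
    rw [Fintype.card_prod, ZMod.card])
  have c0 := abs_le.mp (hclose z)
  have c1 := abs_le.mp (hclose (g^[n] z))
  simp only [ha, iterate_zero, id] at this
  rw [lin_sub] at hz1
  linarith

end Fr

namespace Fr
open Relation

/-- dynamical properties -/
structure Ax (E : ℤ × ℤ → ℤ × ℤ → Prop) (N : ℕ) : Prop where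
  pos : 1 ≤ N
  shift : ∀ a c v, E a c → E (a + N • v) (c + N • v)
  conn : ∀ a b c d, Nb a b → (E a c ∨ E b c) → (E a d ∨ E b d) → Ch {e | E a e ∨ E b e} c d
  succ : ∀ a, ∃ c, E a c
  strip : ∀ (S : Set (ℤ × ℤ)) (v : ℤ × ℤ), v ≠ 0 → (∀ k : ℤ, ∀ c ∈ S, c + k • (N • v) ∈ S) →
    ∀ a ∈ S, Ch S a (a + N • v) → ∃ x ∈ S, ∃ y ∈ S, E x y

/-- valid equivalence relations -/
structure Val (E : ℤ × ℤ → ℤ × ℤ → Prop) (N : ℕ) (r : ℤ × ℤ → ℤ × ℤ → Prop) : Prop where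
  refl : ∀ a, r a a
  symm : ∀ a b, r a b → r b a
  trans : ∀ a b c, r a b → r b c → r a c
  v1 : ∀ a b v, r a b → r (a + N • v) (b + N • v)
  v2 : ∀ a b, r a b → Ch {x | r a x} a b
  v3 : ∀ a b, r a b → ¬ E a b
  v4 : ∀ a v, r a (a + N • v) → v = 0

/-- transition between classes -/
def RR (E r : ℤ × ℤ → ℤ × ℤ → Prop) (a b : ℤ × ℤ) : Prop := ∃ c d, r a c ∧ r b d ∧ E c d

/-- maximal decomposition -/
structure Sys (E : ℤ × ℤ → ℤ × ℤ → Prop) (N : ℕ) (r : ℤ × ℤ → ℤ × ℤ → Prop) : Prop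
    extends Ax E N, Val E N r where
  comp : ∀ a b, Nb a b → ¬ r a b → (∀ v : ℤ × ℤ, ¬ r b (a + N • v)) → RR E r a b ∨ RR E r b a
  acyc : ∀ a, ¬ TransGen (RR E r) a a

section
variable {E r : ℤ × ℤ → ℤ × ℤ → Prop} {N : ℕ}

lemma Ch.shift {S : Set (ℤ × ℤ)} {a b : ℤ × ℤ} (w : ℤ × ℤ) (hS : ∀ c ∈ S, c + w ∈ S)
    (h : Ch S a b) : Ch S (a + w) (b + w) := by
  induction h with
  | refl => exact Ch.refl _
  | tail _ h ih => exact ih.trans (Ch.single (hS _ h.2.1) (hS _ h.2.2) (h.1.shift w))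

lemma Ch.exit {S T : Set (ℤ × ℤ)} {a b : ℤ × ℤ} (h : Ch T a b) (ha : a ∈ S) (hb : b ∉ S) :
    ∃ c d, c ∈ S ∧ d ∉ S ∧ Nb c d ∧ d ∈ T := by
  induction h with
  | refl => exact absurd ha hb
  | @tail b c _ h ih =>
    by_cases hbS : b ∈ S
    · exact ⟨b, c, hbS, hb, h.1, h.2.2⟩
    · exact ih hbS

lemma Ax.image (h : Ax E N) {S : Set (ℤ × ℤ)} {a b : ℤ × ℤ} (hch : Ch S a b) (ha : a ∈ S) {c d : ℤ × ℤ}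
    (hc : E a c) (hd : E b d) : Ch {e | ∃ x ∈ S, E x e} c d := by
  induction hch generalizing d with
  | refl =>
    exact (h.conn a a c d (Nb.refl a) (Or.inl hc) (Or.inl hd)).mono
      (by rintro e (he | he) <;> exact ⟨a, ha, he⟩)
  | @tail b b' _ hb ih =>
    obtain ⟨e, he⟩ := h.succ b
    refine (ih he).trans ((h.conn b b' e d hb.1 (Or.inl he) (Or.inr hd)).mono ?_)
    rintro x (hx | hx)
    · exact ⟨b, hb.2.1, hx⟩
    · exact ⟨b', hb.2.2, hx⟩

lemma Val.finite (h : Val E N r) (hN : 1 ≤ N) (a : ℤ × ℤ) : {x | r a x}.Finite := by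
  have : NeZero N := ⟨by lia⟩
  apply Set.Finite.of_finite_image (f := fun x : ℤ × ℤ => ((x.1 : ZMod N), (x.2 : ZMod N)))
    (Set.toFinite _)
  intro x hx y hy hxy
  simp only [Prod.mk.injEq] at hxy
  have h1 := (ZMod.intCast_eq_intCast_iff_dvd_sub _ _ _).mp hxy.1
  have h2 := (ZMod.intCast_eq_intCast_iff_dvd_sub _ _ _).mp hxy.2
  obtain ⟨k1, h1⟩ := h1
  obtain ⟨k2, h2⟩ := h2
  have hyx : y = x + N • (k1, k2) := by
    apply Prod.ext <;> simp <;> lia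
  have : r x y := h.trans _ _ _ (h.symm _ _ hx) hy
  rw [hyx] at this
  have := h.v4 _ _ this
  rw [hyx, this]; simp

lemma Val.flip (h : Val E N r) : Val (flip E) N r :=
  { h with v3 := fun a b hab => h.v3 b a (h.symm _ _ hab) }

lemma RR_flip {a b : ℤ × ℤ} : RR (flip E) r a b ↔ RR E r b a := by
  constructor
  · rintro ⟨c, d, h1, h2, h3⟩; exact ⟨d, c, h2, h1, h3⟩
  · rintro ⟨c, d, h1, h2, h3⟩; exact ⟨d, c, h2, h1, h3⟩

lemma TG_flip {a b : ℤ × ℤ} : TransGen (RR (flip E) r) a b ↔ TransGen (RR E r) b a := by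
  constructor
  · intro h
    induction h with
    | single h => exact TransGen.single (RR_flip.mp h)
    | tail _ h ih => exact TransGen.head (RR_flip.mp h) ih
  · intro h
    induction h with
    | single h => exact TransGen.single (RR_flip.mpr h)
    | tail _ h ih => exact TransGen.head (RR_flip.mpr h) ih

lemma Sys.flip (h : Sys E N r) (h' : Ax (flip E) N) : Sys (flip E) N r :=
  { h', h.toVal.flip with
    comp := fun a b hn hr hv => by
      rw [RR_flip, RR_flip]; exact (h.comp a b hn hr hv).symm
    acyc := fun a ha => h.acyc a (TG_flip.mp ha) }

lemma Val.RR_left (h : Val E N r) {a a' b : ℤ × ℤ} (hr : r a a') (hR : RR E r a b) : RR E r a' b := by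
  obtain ⟨c, d, h1, h2, h3⟩ := hR
  exact ⟨c, d, h.trans _ _ _ (h.symm _ _ hr) h1, h2, h3⟩

lemma Val.RR_right (h : Val E N r) {a b b' : ℤ × ℤ} (hr : r b b') (hR : RR E r a b) : RR E r a b' := by
  obtain ⟨c, d, h1, h2, h3⟩ := hR
  exact ⟨c, d, h1, h.trans _ _ _ (h.symm _ _ hr) h2, h3⟩

lemma RR_shift (h : Ax E N) (h' : Val E N r) {a b : ℤ × ℤ} (v : ℤ × ℤ) (hR : RR E r a b) :
    RR E r (a + N • v) (b + N • v) := by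
  obtain ⟨c, d, h1, h2, h3⟩ := hR
  exact ⟨_, _, h'.v1 _ _ v h1, h'.v1 _ _ v h2, h.shift _ _ v h3⟩

lemma TG_shift (h : Ax E N) (h' : Val E N r) {a b : ℤ × ℤ} (v : ℤ × ℤ) (hR : TransGen (RR E r) a b) :
    TransGen (RR E r) (a + N • v) (b + N • v) := by
  induction hR with
  | single hh => exact TransGen.single (RR_shift h h' v hh)
  | tail _ hh ih => exact ih.tail (RR_shift h h' v hh)

lemma Val.TG_left (h : Val E N r) {a a' b : ℤ × ℤ} (hr : r a a') (hR : TransGen (RR E r) a b) :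
    TransGen (RR E r) a' b := by
  rcases TransGen.head'_iff.mp hR with ⟨c, h1, h2⟩
  exact TransGen.head'_iff.mpr ⟨c, h.RR_left hr h1, h2⟩

lemma Val.TG_right (h : Val E N r) {a b b' : ℤ × ℤ} (hr : r b b') (hR : TransGen (RR E r) a b) :
    TransGen (RR E r) a b' := by
  rcases TransGen.tail'_iff.mp hR with ⟨c, h1, h2⟩
  exact TransGen.tail'_iff.mpr ⟨c, h1, h.RR_right hr h2⟩

/-- weak order -/
def LE' (E r : ℤ × ℤ → ℤ × ℤ → Prop) (a b : ℤ × ℤ) : Prop := r a b ∨ TransGen (RR E r) a b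

lemma Val.le_trans (h : Val E N r) {a b c : ℤ × ℤ} (h1 : LE' E r a b) (h2 : LE' E r b c) :
    LE' E r a c := by
  rcases h1 with h1 | h1 <;> rcases h2 with h2 | h2
  · exact Or.inl (h.trans _ _ _ h1 h2)
  · exact Or.inr (h.TG_left (h.symm _ _ h1) h2)
  · exact Or.inr (h.TG_right h2 h1)
  · exact Or.inr (h1.trans h2)

lemma Val.lt_le (h : Val E N r) {a b c : ℤ × ℤ} (h1 : TransGen (RR E r) a b) (h2 : LE' E r b c) :
    TransGen (RR E r) a c := by
  rcases h2 with h2 | h2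
  · exact h.TG_right h2 h1
  · exact h1.trans h2

lemma Val.le_lt (h : Val E N r) {a b c : ℤ × ℤ} (h1 : LE' E r a b) (h2 : TransGen (RR E r) b c) :
    TransGen (RR E r) a c := by
  rcases h1 with h1 | h1
  · exact h.TG_left (h.symm _ _ h1) h2
  · exact h1.trans h2

lemma LE_shift (h : Ax E N) (h' : Val E N r) {a b : ℤ × ℤ} (v : ℤ × ℤ) (hR : LE' E r a b) :
    LE' E r (a + N • v) (b + N • v) := by
  rcases hR with h1 | h1
  · exact Or.inl (h'.v1 _ _ v h1)
  · exact Or.inr (TG_shift h h' v h1)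

/-- attractor -/
def At (E r : ℤ × ℤ → ℤ × ℤ → Prop) (N : ℕ) (a : ℤ × ℤ) : Set (ℤ × ℤ) :=
  {c | ∃ u : ℤ × ℤ, LE' E r (a + N • u) c}

lemma At_of_le {a c : ℤ × ℤ} (h : LE' E r a c) : c ∈ At E r N a := ⟨0, by simpa using h⟩

lemma At_shift (h : Ax E N) (h' : Val E N r) {a : ℤ × ℤ} (v : ℤ × ℤ) {c : ℤ × ℤ} (hc : c ∈ At E r N a) :
    c + N • v ∈ At E r N a := by
  obtain ⟨u, hu⟩ := hc
  refine ⟨u + v, ?_⟩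
  rw [smul_add, ← add_assoc]
  exact LE_shift h h' v hu

lemma At_mono (h : Ax E N) (h' : Val E N r) {a b : ℤ × ℤ} (hb : b ∈ At E r N a) :
    At E r N b ⊆ At E r N a := by
  rintro c ⟨u, hu⟩
  obtain ⟨v, hv⟩ := At_shift h h' u hb
  exact ⟨v, h'.le_trans hv hu⟩

lemma class_sub_At (h : Val E N r) {a b : ℤ × ℤ} (hb : LE' E r a b) : {x | r b x} ⊆ At E r N a :=
  fun _ hx => At_of_le (h.le_trans hb (Or.inl hx))

lemma Sys.next (h : Sys E N r) (a : ℤ × ℤ) : ∃ b, RR E r a b ∧ Ch (At E r N a) a b := by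
  have haa : LE' E r a a := Or.inl (h.refl a)
  by_contra hcon
  push Not at hcon
  -- case 1
  have c1 : ∀ c d, r a c → ¬ r a d → Nb c d → ¬ RR E r a d := by
    intro c d hc hd hn hR
    refine hcon d hR (((h.v2 a c hc).mono (class_sub_At h.toVal haa)).trans ?_)
    exact Ch.single (At_of_le (Or.inl hc)) (At_of_le (Or.inr (TransGen.single hR))) hn
  -- case 2
  have c2 : ∀ c d v, r a c → ¬ r a d → Nb c d → ¬ r d (a + N • v) := by
    intro c d v hc hd hn hr
    have hv : v ≠ 0 := by
      rintro rfl
      apply hd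
      apply h.symm
      simpa using hr
    set S : Set (ℤ × ℤ) := {x | ∃ k : ℤ, r (a + k • (N • v)) x} with hS
    have hSs : ∀ k : ℤ, ∀ x ∈ S, x + k • (N • v) ∈ S := by
      rintro k x ⟨j, hj⟩
      refine ⟨j + k, ?_⟩
      have := h.v1 _ _ (k • v) hj
      rw [smul_comm N k v] at this
      rwa [add_smul, ← add_assoc]
    have haS : a ∈ S := ⟨0, by simpa using h.refl a⟩
    have hcS : ∀ x, r a x → x ∈ S := fun x hx => ⟨0, by simpa using hx⟩
    have hdS : ∀ x, r d x → x ∈ S := fun x hx =>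
      ⟨1, by rw [one_smul]; exact h.trans _ _ _ (h.symm _ _ hr) hx⟩
    have hch : Ch S a (a + N • v) :=
      ((h.v2 a c hc).mono hcS).trans ((Ch.single (hcS c hc) (hdS d (h.refl d)) hn).trans
        ((h.v2 d _ hr).mono hdS))
    have hchk : ∀ k : ℤ, Ch S a (a + k • (N • v)) := by
      intro k
      induction k with
      | zero => simpa using Ch.refl a
      | succ k ih =>
        refine ih.trans ?_
        have := hch.shift ((k : ℤ) • (N • v)) (hSs _)
        convert this using 1
        rw [add_smul, one_smul]; abel
      | pred k ih =>
        refine ih.trans ?_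
        have := hch.symm.shift ((-(k : ℤ) - 1) • (N • v)) (hSs _)
        convert this using 1
        rw [sub_smul, one_smul]; abel
    have hSA : S ⊆ At E r N a := by
      rintro x ⟨k, hk⟩
      refine ⟨k • v, Or.inl ?_⟩
      rwa [smul_comm N k v]
    obtain ⟨x, ⟨k, hk⟩, y, ⟨j, hj⟩, hE⟩ := h.strip S v hv hSs a haS hch
    have hR : RR E r (a + k • (N • v)) (a + j • (N • v)) := ⟨x, y, hk, hj, hE⟩
    have hR' := RR_shift h.toAx h.toVal (-(k • v)) hR
    rw [smul_neg, smul_comm N k v, add_neg_cancel_right,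
      show a + j • (N • v) + -(k • (N • v)) = a + (j - k) • (N • v) by rw [sub_smul]; abel] at hR'
    exact hcon _ hR' ((hchk _).mono hSA)
  -- case 3
  have c3 : ∀ c d, r a c → ¬ r a d → Nb c d → RR E r d a := by
    intro c d hc hd hn
    rcases h.comp c d hn (fun hh => hd (h.trans _ _ _ hc hh)) (fun v hv =>
      c2 c d v hc hd hn (h.trans _ _ _ hv (h.v1 _ _ v (h.symm _ _ hc)))) with hR | hR
    · exact absurd (h.toVal.RR_left (h.symm _ _ hc) hR) (c1 c d hc hd hn)
    · exact h.toVal.RR_right (h.symm _ _ hc) hR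
  have hfin := h.toVal.finite h.pos a
  set B : Set (ℤ × ℤ) := {d | ¬ r a d ∧ ∃ c, r a c ∧ Nb c d} with hB
  have hBfin : B.Finite := by
    refine (hfin.biUnion (fun c _ => Set.finite_Icc (c - (1, 1)) (c + (1, 1)))).subset ?_
    rintro d ⟨_, c, hc, hn⟩
    refine mem_biUnion hc ?_
    unfold Nb at hn
    rw [mem_Icc, Prod.le_def, Prod.le_def]
    simp only [Prod.fst_sub, Prod.snd_sub, Prod.fst_add, Prod.snd_add]
    lia
  have hBne : B.Nonempty := by
    obtain ⟨c, hc, hmax⟩ := Set.exists_max_image {x | r a x} (fun x => x.1) hfin ⟨a, h.refl a⟩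
    refine ⟨c + (1, 0), fun hh => ?_, c, hc, ?_⟩
    · have := hmax _ hh
      simp at this
    · unfold Nb; simp; lia
  have hirr : IsStrictOrder (ℤ × ℤ) (fun x y => TransGen (RR E r) y x) :=
    { irrefl := h.acyc, trans := fun x y z h1 h2 => h2.trans h1 }
  have hwf := hBfin.wellFoundedOn (r := fun x y => TransGen (RR E r) y x)
  obtain ⟨⟨b, hbB⟩, -, hbmax⟩ := WellFounded.has_min hwf Set.univ ⟨⟨hBne.some, hBne.some_mem⟩, trivial⟩
  obtain ⟨hb1, c, hc, hn⟩ := hbB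
  have hba := c3 c b hc hb1 hn
  obtain ⟨t, s, ht, hs, hts⟩ := hba
  obtain ⟨y, hy⟩ := h.succ a
  set U : Set (ℤ × ℤ) := {x | r a x ∨ r b x} with hU
  have hchU : Ch U t a := by
    have h1 : Ch U b t := (h.v2 b t ht).mono (fun x hx => Or.inr hx)
    have h2 : Ch U a c := (h.v2 a c hc).mono (fun x hx => Or.inl hx)
    have h3 : Ch U c b := Ch.single (Or.inl hc) (Or.inr (h.refl b)) hn
    exact ((h2.trans h3).trans h1).symm
  have him := h.toAx.image hchU (Or.inr ht) hts hy
  obtain ⟨c', d', hc', hd', hn', x, hx, hxE⟩ := him.exit (S := {x | r a x}) hs (fun hh => h.v3 _ _ hh hy)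
  rcases hx with hx | hx
  · exact c1 c' d' hc' hd' hn' ⟨x, d', hx, h.refl _, hxE⟩
  · exact hbmax ⟨d', hd', c', hc', hn'⟩ trivial (TransGen.single ⟨x, d', hx, h.refl _, hxE⟩)

lemma Sys.ch1 (h : Sys E N r) {a b : ℤ × ℤ} (hR : RR E r a b) : Ch (At E r N a) a b := by
  obtain ⟨b0, hR0, hch⟩ := h.next a
  have hle : LE' E r a b := Or.inr (TransGen.single hR)
  have hle0 : LE' E r a b0 := Or.inr (TransGen.single hR0)
  obtain ⟨c, d, h1, h2, h3⟩ := hR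
  obtain ⟨c0, d0, k1, k2, k3⟩ := hR0
  have hcc : Ch {x | r a x} c0 c := (h.v2 a c0 k1).symm.trans (h.v2 a c h1)
  have := h.toAx.image hcc k1 k3 h3
  have hsub : {e | ∃ x ∈ {x | r a x}, E x e} ⊆ At E r N a := by
    rintro e ⟨x, hx, hE⟩
    exact At_of_le (Or.inr (TransGen.single ⟨x, e, hx, h.refl e, hE⟩))
  exact hch.trans (((h.v2 _ _ k2).mono (class_sub_At h.toVal hle0)).trans
    ((this.mono hsub).trans ((h.v2 _ _ h2).mono (class_sub_At h.toVal hle)).symm))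

lemma Sys.chT (h : Sys E N r) {a b : ℤ × ℤ} (hR : TransGen (RR E r) a b) : Ch (At E r N a) a b := by
  induction hR with
  | single hh => exact h.ch1 hh
  | tail h1 h2 ih =>
    exact ih.trans ((h.ch1 h2).mono (At_mono h.toAx h.toVal (At_of_le (Or.inr h1))))

end

end Fr

namespace Fr
open Relation

section
variable {E r : ℤ × ℤ → ℤ × ℤ → Prop} {N : ℕ}

lemma Val.eq (hE : ∀ a, ¬ E a a) (hN : 1 ≤ N) : Val E N (fun a b => a = b) where
  refl _ := rfl
  symm _ _ h := h.symm
  trans _ _ _ h h' := h.trans h'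
  v1 _ _ _ h := by rw [h]
  v2 a b h := by rw [h]; exact Ch.refl _
  v3 a b h := by rw [← h]; exact hE a
  v4 a v h := by
    have h0 : N • v = 0 := by simpa using h.symm
    exact (smul_eq_zero.mp h0).resolve_left (by lia)

lemma Val.max (hE : ∀ a, ¬ E a a) (hN : 1 ≤ N) :
    ∃ r, Val E N r ∧ ∀ r', Val E N r' → (∀ a b, r a b → r' a b) → ∀ a b, r' a b → r a b := by
  obtain ⟨m, -, hm, hmax⟩ := zorn_le_nonempty₀ {r | Val E N r} (by
    intro c hc hch y hy
    refine ⟨fun a b => ∃ ρ ∈ c, ρ a b, ?_, fun z hz a b hab => ⟨z, hz, hab⟩⟩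
    have dir : ∀ ρ ∈ c, ∀ σ ∈ c, ∃ τ ∈ c, (∀ a b, ρ a b → τ a b) ∧ (∀ a b, σ a b → τ a b) := by
      intro ρ hρ σ hσ
      rcases hch.total hρ hσ with h | h
      · exact ⟨σ, hσ, fun a b => h a b, fun _ _ h => h⟩
      · exact ⟨ρ, hρ, fun _ _ h => h, fun a b => h a b⟩
    constructor
    · exact fun a => ⟨y, hy, (hc hy).refl a⟩
    · rintro a b ⟨ρ, hρ, h⟩; exact ⟨ρ, hρ, (hc hρ).symm _ _ h⟩
    · rintro a b d ⟨ρ, hρ, h⟩ ⟨σ, hσ, h'⟩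
      obtain ⟨τ, hτ, h1, h2⟩ := dir ρ hρ σ hσ
      exact ⟨τ, hτ, (hc hτ).trans _ _ _ (h1 _ _ h) (h2 _ _ h')⟩
    · rintro a b v ⟨ρ, hρ, h⟩; exact ⟨ρ, hρ, (hc hρ).v1 _ _ v h⟩
    · rintro a b ⟨ρ, hρ, h⟩
      exact ((hc hρ).v2 a b h).mono (fun x hx => show ∃ ρ ∈ c, ρ a x from ⟨ρ, hρ, hx⟩)
    · rintro a b ⟨ρ, hρ, h⟩; exact (hc hρ).v3 a b h
    · rintro a v ⟨ρ, hρ, h⟩; exact (hc hρ).v4 a v h) _ (Val.eq hE hN)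
  exact ⟨m, hm, fun r' h' hle => hmax h' hle⟩

/-- merging two neighbouring classes -/
def mg (r : ℤ × ℤ → ℤ × ℤ → Prop) (N : ℕ) (a b x y : ℤ × ℤ) : Prop :=
  r x y ∨ (∃ v : ℤ × ℤ, r x (a + N • v) ∧ r y (b + N • v)) ∨
    ∃ v : ℤ × ℤ, r x (b + N • v) ∧ r y (a + N • v)

lemma Val.unshift (h : Val E N r) {a b u v : ℤ × ℤ} (hr : r (a + N • u) (b + N • v)) :
    r a (b + N • (v - u)) := by
  have := h.v1 _ _ (-u) hr
  rw [smul_neg, add_neg_cancel_right] at this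
  convert this using 1
  rw [smul_sub]; abel

lemma RR_unshift (h : Ax E N) (h' : Val E N r) {a b v : ℤ × ℤ}
    (hr : RR E r (a + N • v) (b + N • v)) : RR E r a b := by
  have := RR_shift h h' (-v) hr
  rwa [smul_neg, add_neg_cancel_right, add_neg_cancel_right] at this

lemma Val.comp (h' : Ax E N) (h : Val E N r)
    (hmax : ∀ r', Val E N r' → (∀ a b, r a b → r' a b) → ∀ a b, r' a b → r a b) (a b : ℤ × ℤ)
    (hn : Nb a b) (hab : ¬ r a b) (hv : ∀ v : ℤ × ℤ, ¬ r b (a + N • v)) :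
    RR E r a b ∨ RR E r b a := by
  by_contra hcon
  push Not at hcon
  obtain ⟨hc1, hc2⟩ := hcon
  have key : ∀ u v, ¬ r (a + N • u) (b + N • v) := by
    intro u v hr
    exact hv _ (h.unshift (h.symm _ _ hr))
  have same : ∀ c u v x y, r x (c + N • u) → r x (c + N • v) → r y (c + N • u) →
      r y (c + N • v) := by
    intro c u v x y h1 h2 h3
    exact h.trans _ _ _ h3 (h.trans _ _ _ (h.symm _ _ h1) h2)
  have uniq : ∀ c u v x, r x (c + N • u) → r x (c + N • v) → u = v := by
    intro c u v x h1 h2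
    have := h.v4 _ _ (h.unshift (h.trans _ _ _ (h.symm _ _ h1) h2))
    exact (sub_eq_zero.mp this).symm
  apply hab
  refine hmax (mg r N a b) ?_ (fun x y hxy => Or.inl hxy) a b
    (Or.inr (Or.inl ⟨0, by simpa using h.refl a, by simpa using h.refl b⟩))
  constructor
  · exact fun x => Or.inl (h.refl x)
  · rintro x y (hr | ⟨v, h1, h2⟩ | ⟨v, h1, h2⟩)
    · exact Or.inl (h.symm _ _ hr)
    · exact Or.inr (Or.inr ⟨v, h2, h1⟩)
    · exact Or.inr (Or.inl ⟨v, h2, h1⟩)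
  · rintro x y z (hr | ⟨v, h1, h2⟩ | ⟨v, h1, h2⟩) (hr' | ⟨v', h1', h2'⟩ | ⟨v', h1', h2'⟩)
    · exact Or.inl (h.trans _ _ _ hr hr')
    · exact Or.inr (Or.inl ⟨v', h.trans _ _ _ hr h1', h2'⟩)
    · exact Or.inr (Or.inr ⟨v', h.trans _ _ _ hr h1', h2'⟩)
    · exact Or.inr (Or.inl ⟨v, h1, h.trans _ _ _ (h.symm _ _ hr') h2⟩)
    · exact absurd (h.trans _ _ _ (h.symm _ _ h1') h2) (key _ _)
    · have := uniq _ _ _ _ h2 h1'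
      subst this
      exact Or.inl (h.trans _ _ _ h1 (h.symm _ _ h2'))
    · exact Or.inr (Or.inr ⟨v, h1, h.trans _ _ _ (h.symm _ _ hr') h2⟩)
    · have := uniq _ _ _ _ h2 h1'
      subst this
      exact Or.inl (h.trans _ _ _ h1 (h.symm _ _ h2'))
    · exact absurd (h.trans _ _ _ (h.symm _ _ h2) h1') (key _ _)
  · rintro x y w (hr | ⟨v, h1, h2⟩ | ⟨v, h1, h2⟩)
    · exact Or.inl (h.v1 _ _ w hr)
    · refine Or.inr (Or.inl ⟨v + w, ?_, ?_⟩) <;> rw [smul_add, ← add_assoc]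
      exacts [h.v1 _ _ w h1, h.v1 _ _ w h2]
    · refine Or.inr (Or.inr ⟨v + w, ?_, ?_⟩) <;> rw [smul_add, ← add_assoc]
      exacts [h.v1 _ _ w h1, h.v1 _ _ w h2]
  · rintro x y (hr | ⟨v, h1, h2⟩ | ⟨v, h1, h2⟩)
    · exact (h.v2 x y hr).mono (fun z hz => Or.inl hz)
    · have hx : ∀ z, r x z → mg r N a b x z := fun z hz => Or.inl hz
      have hy : ∀ z, r y z → mg r N a b x z := fun z hz =>
        Or.inr (Or.inl ⟨v, h1, h.trans _ _ _ (h.symm _ _ hz) h2⟩)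
      exact ((h.v2 _ _ h1).mono hx).trans ((Ch.single (hx _ h1) (hy _ h2) (hn.shift _)).trans
        ((h.v2 _ _ h2).mono hy).symm)
    · have hx : ∀ z, r x z → mg r N a b x z := fun z hz => Or.inl hz
      have hy : ∀ z, r y z → mg r N a b x z := fun z hz =>
        Or.inr (Or.inr ⟨v, h1, h.trans _ _ _ (h.symm _ _ hz) h2⟩)
      exact ((h.v2 _ _ h1).mono hx).trans ((Ch.single (hx _ h1) (hy _ h2) (hn.symm.shift _)).trans
        ((h.v2 _ _ h2).mono hy).symm)
  · rintro x y (hr | ⟨v, h1, h2⟩ | ⟨v, h1, h2⟩) hE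
    · exact h.v3 x y hr hE
    · exact hc1 (RR_unshift (v := v) h' h ⟨x, y, h.symm _ _ h1, h.symm _ _ h2, hE⟩)
    · exact hc2 (RR_unshift (v := v) h' h ⟨x, y, h.symm _ _ h1, h.symm _ _ h2, hE⟩)
  · rintro x w (hr | ⟨v, h1, h2⟩ | ⟨v, h1, h2⟩)
    · exact h.v4 x w hr
    · have := h.v1 _ _ w h1
      rw [add_assoc, ← smul_add] at this
      exact absurd (h.trans _ _ _ (h.symm _ _ this) h2) (key _ _)
    · have := h.v1 _ _ w h1
      rw [add_assoc, ← smul_add] at this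
      exact absurd (h.trans _ _ _ (h.symm _ _ h2) this) (key _ _)

lemma TG_seq {α : Type*} {R : α → α → Prop} {a b : α} (h : TransGen R a b) :
    ∃ k : ℕ, 1 ≤ k ∧ ∃ s : ℕ → α, s 0 = a ∧ s k = b ∧ ∀ i < k, R (s i) (s (i + 1)) := by
  induction h with
  | @single b h =>
    refine ⟨1, le_rfl, fun i => if i = 0 then a else b, by simp, by simp, ?_⟩
    intro i hi
    obtain rfl : i = 0 := by lia
    simpa using h
  | @tail b c _ h ih =>
    obtain ⟨k, hk, s, h0, h1, h2⟩ := ih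
    refine ⟨k + 1, by lia, fun i => if i ≤ k then s i else c, by simpa using h0, by simp, ?_⟩
    intro i hi
    rcases (Nat.lt_succ_iff.mp hi).eq_or_lt with rfl | hlt
    · simpa [h1] using h
    · simp only [hlt.le, if_true, show i + 1 ≤ k from hlt]
      exact h2 i hlt

lemma Val.acyc (h : Val E N r)
    (hfr : ∀ (k : ℕ) [NeZero k] (S : ZMod k → Set (ℤ × ℤ)), (∀ i, (S i).Finite) →
      (∀ i, ∀ a ∈ S i, ∀ b ∈ S i, Ch (S i) a b) → (∀ i, ∀ a ∈ S i, ∀ b ∈ S i, ¬ E a b) →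
      (∀ i j, i ≠ j → Disjoint (S i) (S j)) → (∀ i, ∃ a ∈ S i, ∃ b ∈ S (i + 1), E a b) → False)
    (hN : 1 ≤ N) (a : ℤ × ℤ) : ¬ TransGen (RR E r) a a := by
  intro hT
  obtain ⟨k, hk, s, h0, h1, h2⟩ := TG_seq hT
  have hex : ∃ k : ℕ, 1 ≤ k ∧ ∃ s : ℕ → ℤ × ℤ, (∀ i < k, RR E r (s i) (s (i + 1))) ∧ r (s 0) (s k) :=
    ⟨k, hk, s, h2, by rw [h0, h1]; exact h.refl a⟩
  classical
  obtain ⟨hk, s, hs, hsk⟩ := Nat.find_spec hex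
  have hmin := fun m => @Nat.find_min _ _ hex m
  generalize Nat.find hex = k at *
  have : NeZero k := ⟨by lia⟩
  have hdist : ∀ i j, i < j → j < k → ¬ r (s i) (s j) := by
    intro i j hij hjk hr
    refine hmin (j - i) (by lia) ⟨by lia, fun t => s (i + t), fun t ht => hs (i + t) (by lia), ?_⟩
    change r (s (i + 0)) (s (i + (j - i)))
    rwa [add_zero, show i + (j - i) = j by lia]
  refine hfr k (fun i => {x | r (s i.val) x}) (fun i => h.finite hN _) ?_ ?_ ?_ ?_
  · intro i a ha b hb
    exact (h.v2 _ _ ha).symm.trans (h.v2 _ _ hb)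
  · intro i a ha b hb
    exact h.v3 _ _ (h.trans _ _ _ (h.symm _ _ ha) hb)
  · intro i j hij
    rw [Set.disjoint_left]
    intro x hx hx'
    have hr : r (s i.val) (s j.val) := h.trans _ _ _ hx (h.symm _ _ hx')
    rcases lt_trichotomy i.val j.val with hlt | heq | hgt
    · exact hdist _ _ hlt (ZMod.val_lt j) hr
    · exact hij (ZMod.val_injective k heq)
    · exact hdist _ _ hgt (ZMod.val_lt i) (h.symm _ _ hr)
  · intro i
    have hi := ZMod.val_lt i
    obtain ⟨c, d, hc, hd, hE⟩ := hs i.val hi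
    refine ⟨c, hc, d, ?_, hE⟩
    change r (s (i + 1).val) d
    have hval : (i + 1).val = (i.val + 1) % k := by
      rw [ZMod.val_add, ZMod.val_one_eq_one_mod, Nat.add_mod_mod]
    rw [hval]
    rcases (show i.val + 1 ≤ k from hi).eq_or_lt with heq | hlt
    · rw [heq, Nat.mod_self]
      rw [heq] at hd
      exact h.trans _ _ _ hsk hd
    · rwa [Nat.mod_eq_of_lt hlt]

end

/-- a subsemigroup of ℤ² positively spanning every direction contains 0 -/
lemma semigroup_zero (S : Set (ℤ × ℤ)) (hadd : ∀ x ∈ S, ∀ y ∈ S, x + y ∈ S)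
    (hS : ∀ l : ℝ × ℝ, l ≠ 0 → ∃ s ∈ S, 0 < lin l (rv s)) : (0 : ℤ × ℤ) ∈ S := by
  by_contra h0
  have hmul : ∀ n : ℕ, 1 ≤ n → ∀ x ∈ S, n • x ∈ S := by
    intro n hn x hx
    induction n, hn using Nat.le_induction with
    | base => simpa using hx
    | succ n _ ih => rw [add_smul, one_smul]; exact hadd _ ih _ hx
  have hmulz : ∀ n : ℤ, 1 ≤ n → ∀ x ∈ S, n • x ∈ S := by
    intro n hn x hx
    lift n to ℕ using by lia
    rw [natCast_zsmul]
    exact hmul n (by lia) x hx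
  obtain ⟨s, hs, -⟩ := hS (1, 0) (by simp)
  obtain ⟨p, q⟩ := s
  set n2 : ℤ := p * p + q * q with hn2
  have hpos : 0 < n2 := by
    have hne : (p, q) ≠ (0 : ℤ × ℤ) := fun hh => h0 (hh ▸ hs)
    by_contra hle
    apply hne
    have hp : p = 0 := by nlinarith [mul_self_nonneg p, mul_self_nonneg q]
    have hq : q = 0 := by nlinarith [mul_self_nonneg p, mul_self_nonneg q]
    rw [hp, hq]; rfl
  -- inner product and determinant
  have hpar : ∀ z ∈ S, p * z.2 - q * z.1 = 0 → 0 < p * z.1 + q * z.2 := by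
    rintro ⟨x, y⟩ hz hd
    by_contra hle
    simp only at hd hle
    push Not at hle
    apply h0
    have e1 : n2 * x = (p * x + q * y) * p := by rw [hn2]; linear_combination (-q) * hd
    have e2 : n2 * y = (p * x + q * y) * q := by rw [hn2]; linear_combination p * hd
    have hz' := hmulz n2 (by lia) _ hz
    rcases hle.eq_or_lt with h | h
    · convert hz' using 1
      rw [h, zero_mul] at e1 e2
      apply Prod.ext
      · exact e1.symm
      · exact e2.symm
    · convert hadd _ hz' _ (hmulz (-(p * x + q * y)) (by lia) _ hs) using 1
      apply Prod.ext <;> simp <;> lia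
  have hcut : ∀ x ∈ S, ∀ y ∈ S, 0 < p * x.2 - q * x.1 → p * y.2 - q * y.1 < 0 →
      0 < -(p * y.2 - q * y.1) * (p * x.1 + q * x.2) + (p * x.2 - q * x.1) * (p * y.1 + q * y.2) := by
    intro x hx y hy hdx hdy
    have hz := hadd _ (hmulz (-(p * y.2 - q * y.1)) (by lia) _ hx) _
      (hmulz (p * x.2 - q * x.1) (by lia) _ hy)
    have := hpar _ hz (by simp; ring)
    convert this using 1
    simp; ring
  have hn2R : (0 : ℝ) < p * p + q * q := by exact_mod_cast hpos
  have hpq : ¬ ((p : ℝ) = 0 ∧ (q : ℝ) = 0) := by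
    rintro ⟨h1, h2⟩; rw [h1, h2] at hn2R; norm_num at hn2R
  obtain ⟨x0, hx0, hx0d⟩ := hS (-(q : ℝ), (p : ℝ)) (by
    intro hh; rw [Prod.ext_iff] at hh; apply hpq; simpa [and_comm] using hh)
  obtain ⟨y0, hy0, hy0d⟩ := hS ((q : ℝ), -(p : ℝ)) (by
    intro hh; rw [Prod.ext_iff] at hh; apply hpq; simpa [and_comm] using hh)
  set ip : ℤ × ℤ → ℝ := fun z => p * z.1 + q * z.2 with hip
  set dt : ℤ × ℤ → ℝ := fun z => p * z.2 - q * z.1 with hdt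
  have hx0' : 0 < dt x0 := by simp only [lin, rv] at hx0d; simp only [hdt]; linarith
  have hy0' : dt y0 < 0 := by simp only [lin, rv] at hy0d; simp only [hdt]; linarith
  have hcutR : ∀ x ∈ S, ∀ y ∈ S, 0 < dt x → dt y < 0 → ip y / dt y ≤ ip x / dt x := by
    intro x hx y hy h1 h2
    have h1' : 0 < p * x.2 - q * x.1 := by simp only [hdt] at h1; exact_mod_cast h1
    have h2' : p * y.2 - q * y.1 < 0 := by simp only [hdt] at h2; exact_mod_cast h2
    have h3 := hcut x hx y hy h1' h2'
    have h3' : 0 < -(dt y) * ip x + dt x * ip y := by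
      simp only [hdt, hip]; exact_mod_cast h3
    rw [← neg_div_neg_eq, div_le_div_iff₀ (by linarith) h1]
    linarith
  set B : Set ℝ := {t | ∃ y ∈ S, dt y < 0 ∧ t = ip y / dt y} with hB
  have hBne : B.Nonempty := ⟨_, y0, hy0, hy0', rfl⟩
  have hBbd : BddAbove B := ⟨ip x0 / dt x0, by
    rintro t ⟨y, hy, hy', rfl⟩; exact hcutR _ hx0 _ hy hx0' hy'⟩
  set m := sSup B with hm
  have hnn : ∀ z ∈ S, 0 ≤ ip z - m * dt z := by
    intro z hz
    rcases lt_trichotomy (dt z) 0 with h | h | h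
    · have : ip z / dt z ≤ m := le_csSup hBbd ⟨z, hz, h, rfl⟩
      rw [div_le_iff_of_neg h] at this
      linarith
    · have hd : p * z.2 - q * z.1 = 0 := by simp only [hdt] at h; exact_mod_cast h
      have := hpar z hz hd
      have h' : 0 < ip z := by simp only [hip]; exact_mod_cast this
      rw [h]; linarith
    · have : m ≤ ip z / dt z := csSup_le hBne (by
        rintro t ⟨y, hy, hy', rfl⟩; exact hcutR _ hz _ hy h hy')
      rw [le_div_iff₀ h] at this
      linarith
  obtain ⟨z, hz, hzl⟩ := hS (-((p : ℝ) + m * q), -((q : ℝ) - m * p)) (by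
    intro hh
    rw [Prod.ext_iff] at hh
    obtain ⟨h1, h2⟩ := hh
    simp only [Prod.fst_zero, Prod.snd_zero] at h1 h2
    have : (p : ℝ) * p + q * q = 0 := by linear_combination (-(p : ℝ)) * h1 - q * h2
    linarith)
  have := hnn z hz
  simp only [lin, rv, hip, hdt] at hzl this
  linarith

end Fr

namespace Fr
open Relation

lemma Std.ax {g : (ℝ × ℝ) ≃ₜ (ℝ × ℝ)} {N : ℕ} (h : Std g N) : Ax (Er g) N where
  pos := h.pos
  shift _ _ v he := h.shift v he
  conn _ _ _ _ hn hc hd := Er_connected g hn hc hd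
  succ a := Er_succ g a
  strip S v hv hS a ha hch := h.strip S v hv hS a ha hch

lemma flip_Er (g : (ℝ × ℝ) ≃ₜ (ℝ × ℝ)) : flip (Er g) = Er g.symm := by
  funext a c
  exact propext (Er_symm g a c).symm

lemma Std.ax' {g : (ℝ × ℝ) ≃ₜ (ℝ × ℝ)} {N : ℕ} (h : Std g N) : Ax (flip (Er g)) N where
  pos := h.pos
  shift _ _ v he := h.shift v he
  conn a b c d hn hc hd := by
    rw [flip_Er] at *
    exact Er_connected g.symm hn hc hd
  succ a := by rw [flip_Er]; exact Er_succ g.symm a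
  strip S v hv hS a ha hch := by
    obtain ⟨x, hx, y, hy, hE⟩ := h.strip S v hv hS a ha hch
    exact ⟨y, hy, x, hx, hE⟩

lemma Std.sys {g : (ℝ × ℝ) ≃ₜ (ℝ × ℝ)} {N : ℕ} (h : Std g N) : ∃ r, Sys (Er g) N r := by
  obtain ⟨r, hr, hmax⟩ := Val.max (E := Er g) h.not_self h.pos
  exact ⟨r, { h.ax, hr with
    comp := fun a b => hr.comp h.ax hmax a b
    acyc := hr.acyc (fun k _ S h1 h2 h3 h4 h5 => Er_franks g h.HH k S h1 h2 h3 h4 h5) h.pos }⟩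

section
variable {E r : ℤ × ℤ → ℤ × ℤ → Prop} {N : ℕ}

lemma Sys.cross (h : Sys E N r) (hf : Ax (_root_.flip E) N) {a w a' w' : ℤ × ℤ}
    (h1 : TransGen (RR E r) a (a + N • w)) (h2 : TransGen (RR E r) a' (a' + N • w'))
    (hdet : w.1 * w'.2 - w.2 * w'.1 ≠ 0) : ∃ p : ℤ × ℤ, LE' E r a (a' + N • p) := by
  have hfs := h.flip hf
  have c1 := h.chT h1
  have c2 := (hfs.chT (TG_flip.mpr h2)).symm
  have hsub : At (_root_.flip E) r N (a' + N • w') ⊆ At (_root_.flip E) r N a' := by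
    apply At_mono hfs.toAx hfs.toVal
    apply At_shift hfs.toAx hfs.toVal
    exact At_of_le (Or.inl (h.refl a'))
  have hN := h.pos
  obtain ⟨c, ⟨u, hu⟩, u', hu'⟩ := cross_sets (At E r N a) (At (_root_.flip E) r N a') (N • w) (N • w')
    (fun k c hc => by
      rw [smul_comm k N w]; exact At_shift h.toAx h.toVal _ hc)
    (fun k c hc => by
      rw [smul_comm k N w']; exact At_shift hfs.toAx hfs.toVal _ hc) a a'
    (At_of_le (Or.inl (h.refl a))) (At_of_le (Or.inl (h.refl a'))) c1 (c2.mono hsub) (by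
      have : (N • w).1 * (N • w').2 - (N • w).2 * (N • w').1 =
        (N * N : ℤ) * (w.1 * w'.2 - w.2 * w'.1) := by simp; ring
      rw [this]
      exact mul_ne_zero (by positivity) hdet)
  have hu'' : LE' E r c (a' + N • u') := by
    rcases hu' with hh | hh
    · exact Or.inl (h.symm _ _ hh)
    · exact Or.inr (TG_flip.mp hh)
  have := LE_shift h.toAx h.toVal (-u) (h.toVal.le_trans hu hu'')
  refine ⟨u' - u, ?_⟩
  rw [smul_neg, add_neg_cancel_right] at this
  convert this using 1
  rw [smul_sub]; abel

lemma Sys.iter (h : Sys E N r) {a w : ℤ × ℤ} (h1 : TransGen (RR E r) a (a + N • w)) (n : ℕ)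
    (hn : 1 ≤ n) : TransGen (RR E r) a (a + N • (n • w)) := by
  induction n, hn using Nat.le_induction with
  | base => simpa using h1
  | succ n _ ih =>
    refine ih.trans ?_
    have := TG_shift h.toAx h.toVal (n • w) h1
    convert this using 1
    rw [add_smul, smul_add, one_smul]; abel

lemma Sys.false (h : Sys E N r) (hf : Ax (_root_.flip E) N)
    (hloop : ∀ l : ℝ × ℝ, l ≠ 0 → ∃ a w, TransGen (RR E r) a (a + N • w) ∧ 0 < lin l (rv w)) :
    False := by
  have hne : ∀ a w, TransGen (RR E r) a (a + N • w) → w ≠ 0 := by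
    rintro a w hT rfl
    exact h.acyc a (by simpa using hT)
  have hmut : ∀ a w a' w', TransGen (RR E r) a (a + N • w) → TransGen (RR E r) a' (a' + N • w') →
      ∃ p : ℤ × ℤ, LE' E r a (a' + N • p) := by
    intro a w a' w' h1 h2
    by_cases hdet : w.1 * w'.2 - w.2 * w'.1 = 0
    swap
    · exact h.cross hf h1 h2 hdet
    obtain ⟨b, u, h3, h4⟩ := hloop (-(w.2 : ℝ), (w.1 : ℝ)) (by
      intro hh
      rw [Prod.ext_iff] at hh
      apply hne a w h1
      apply Prod.ext
      · have := hh.2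
        simpa using this
      · have := hh.1
        simpa using this)
    have h4' : 0 < w.1 * u.2 - w.2 * u.1 := by
      simp only [lin, rv] at h4
      have : (0 : ℝ) < w.1 * u.2 - w.2 * u.1 := by linarith
      exact_mod_cast this
    have h5 : u.1 * w'.2 - u.2 * w'.1 ≠ 0 := by
      intro h5
      apply hne a' w' h2
      have e1 : (w.1 * u.2 - w.2 * u.1) * w'.1 = 0 := by
        linear_combination u.1 * hdet - w.1 * h5
      have e2 : (w.1 * u.2 - w.2 * u.1) * w'.2 = 0 := by
        linear_combination u.2 * hdet - w.2 * h5
      apply Prod.ext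
      · exact (mul_eq_zero.mp e1).resolve_left (by lia)
      · exact (mul_eq_zero.mp e2).resolve_left (by lia)
    obtain ⟨p, hp⟩ := h.cross hf h1 h3 (by lia)
    obtain ⟨p', hp'⟩ := h.cross hf h3 h2 h5
    refine ⟨p' + p, ?_⟩
    rw [smul_add, ← add_assoc]
    exact h.toVal.le_trans hp (LE_shift h.toAx h.toVal p hp')
  obtain ⟨a, w, haw, -⟩ := hloop (1, 0) (by simp)
  have h0 := semigroup_zero {s | TransGen (RR E r) a (a + N • s)} (by
    intro x hx y hy
    change TransGen (RR E r) a (a + N • (x + y))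
    refine TransGen.trans hx ?_
    have := TG_shift h.toAx h.toVal x hy
    convert this using 1
    rw [smul_add]; abel) (by
    intro l hl
    obtain ⟨b, u, hb, hu⟩ := hloop l hl
    obtain ⟨p, hp⟩ := hmut a w b u haw hb
    obtain ⟨p', hp'⟩ := hmut b u a w hb haw
    obtain ⟨n, hn⟩ := exists_nat_gt (-(lin l (rv (p + p'))) / lin l (rv u))
    rw [div_lt_iff₀ hu] at hn
    refine ⟨(p' + (n + 1) • u) + p, ?_, ?_⟩
    · change TransGen (RR E r) a _
      have h1 := h.iter hb (n + 1) (by lia)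
      have h2 := h.toVal.lt_le h1 (LE_shift h.toAx h.toVal ((n + 1) • u) hp')
      have h3 := h.toVal.le_lt hp (TG_shift h.toAx h.toVal p h2)
      convert h3 using 1
      simp only [smul_add, add_assoc]
    · have e : lin l (rv (p' + (n + 1) • u + p)) = lin l (rv (p + p')) + (n + 1) * lin l (rv u) := by
        simp only [rv_add, lin_add]
        rw [show rv ((n + 1) • u) = ((n : ℝ) + 1) • rv u by
          have := rv_zsmul (n + 1) u
          push_cast at this
          rw [← this]; congr 1, lin_smul]
        ring
      rw [e]
      linarith)
  exact h.acyc a (by simpa using h0)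

end

theorem Std.false {g : (ℝ × ℝ) ≃ₜ (ℝ × ℝ)} {N : ℕ} (h : Std g N) : False := by
  obtain ⟨r, hr⟩ := h.sys
  refine hr.false h.ax' fun l hl => ?_
  obtain ⟨a, w, hT, hw⟩ := h.loop l hl
  refine ⟨a, w, ?_, hw⟩
  clear hw
  generalize a + N • w = b at hT ⊢
  induction hT with
  | single he => exact TransGen.single ⟨_, _, hr.refl _, hr.refl _, he⟩
  | tail _ he ih => exact ih.tail ⟨_, _, hr.refl _, hr.refl _, he⟩

end Fr

namespace Fr

lemma disp_reduce (F : ℝ × ℝ → ℝ × ℝ) (hF : ∀ x v, F (x + rv v) = F x + rv v) (x : ℝ × ℝ) :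
    ∃ y ∈ Icc (0 : ℝ × ℝ) (1, 1), F x - x = F y - y := by
  refine ⟨x + rv (-fl x), ?_, ?_⟩
  · rw [mem_Icc, Prod.le_def, Prod.le_def]
    simp only [rv, fl, Prod.fst_add, Prod.snd_add, Prod.fst_neg, Prod.snd_neg, Prod.fst_zero,
      Prod.snd_zero]
    push_cast
    have := Int.floor_le x.1
    have := Int.floor_le x.2
    have := Int.lt_floor_add_one x.1
    have := Int.lt_floor_add_one x.2
    refine ⟨⟨?_, ?_⟩, ?_, ?_⟩ <;> linarith
  · rw [hF]; abel

lemma disp_bounds (F : ℝ × ℝ → ℝ × ℝ) (hc : Continuous F) (hF : ∀ x v, F (x + rv v) = F x + rv v) :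
    (∃ M : ℝ, ∀ x, ‖F x - x‖ ≤ M) ∧ ((∀ x, F x ≠ x) → ∃ δ > 0, ∀ x, δ ≤ ‖F x - x‖) := by
  have hK : IsCompact (Icc (0 : ℝ × ℝ) (1, 1)) := isCompact_Icc
  have hne : (Icc (0 : ℝ × ℝ) (1, 1)).Nonempty := ⟨0, by
    rw [mem_Icc, Prod.le_def, Prod.le_def]; simp⟩
  have hcont : ContinuousOn (fun x => ‖F x - x‖) (Icc (0 : ℝ × ℝ) (1, 1)) := by fun_prop
  constructor
  · obtain ⟨y, -, hy⟩ := hK.exists_isMaxOn hne hcont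
    refine ⟨‖F y - y‖, fun x => ?_⟩
    obtain ⟨z, hz, e⟩ := disp_reduce F hF x
    rw [e]; exact hy hz
  · intro hfix
    obtain ⟨y, -, hy⟩ := hK.exists_isMinOn hne hcont
    refine ⟨‖F y - y‖, norm_pos_iff.mpr (sub_ne_zero.mpr (hfix y)), fun x => ?_⟩
    obtain ⟨z, hz, e⟩ := disp_reduce F hF x
    rw [e]; exact hy hz

lemma iter_comm {F : ℝ × ℝ → ℝ × ℝ} {w : ℝ × ℝ} (hF : ∀ x, F (x + w) = F x + w) (n : ℕ) (x : ℝ × ℝ) :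
    F^[n] (x + w) = F^[n] x + w := by
  induction n generalizing x with
  | zero => rfl
  | succ n ih => rw [iterate_succ_apply, hF, ih, iterate_succ_apply]

lemma iter_disp {F : ℝ × ℝ → ℝ × ℝ} {M : ℝ} (hM : ∀ x, ‖F x - x‖ ≤ M) (n : ℕ) (x : ℝ × ℝ) :
    ‖F^[n] x - x‖ ≤ n * M := by
  induction n with
  | zero => simp
  | succ n ih =>
    rw [iterate_succ_apply']
    have := hM (F^[n] x)
    calc ‖F (F^[n] x) - x‖ = ‖(F (F^[n] x) - F^[n] x) + (F^[n] x - x)‖ := by congr 1; abel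
      _ ≤ _ := norm_add_le _ _
      _ ≤ _ := by push_cast; linarith

lemma homeo_iter (F : (ℝ × ℝ) ≃ₜ (ℝ × ℝ)) (n : ℕ) : ∃ H : (ℝ × ℝ) ≃ₜ (ℝ × ℝ), ∀ x, H x = F^[n] x := by
  induction n with
  | zero => exact ⟨Homeomorph.refl _, fun x => rfl⟩
  | succ n ih =>
    obtain ⟨H, hH⟩ := ih
    exact ⟨F.trans H, fun x => by
      rw [Homeomorph.trans_apply, hH, iterate_succ_apply]⟩

theorem reduction (F : (ℝ × ℝ) ≃ₜ (ℝ × ℝ)) (hF : ∀ x v, F (x + rv v) = F x + rv v)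
    (p : ℤ × ℤ) (q : ℕ) (hq : 1 ≤ q) (v0 : ℝ × ℝ) (hv0 : rv p = (q : ℝ) • v0)
    (hrot : ∀ l : ℝ × ℝ, l ≠ 0 → ∃ c > 0, ∀ m : ℕ, 1 ≤ m → ∃ n, m ≤ n ∧ ∃ x,
      n * (lin l v0 + c) ≤ lin l (F^[n] x - x))
    (hno : ∀ x, F^[q] x ≠ x + rv p) : False := by
  obtain ⟨H, hH⟩ := homeo_iter F q
  set G : (ℝ × ℝ) ≃ₜ (ℝ × ℝ) := H.trans (Homeomorph.addRight (-rv p)) with hG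
  have hGx : ∀ x, G x = F^[q] x - rv p := by
    intro x
    simp [hG, hH, sub_eq_add_neg]
  have hGc : ∀ x v, G (x + rv v) = G x + rv v := by
    intro x v
    rw [hGx, hGx, iter_comm (fun y => hF y v)]; abel
  have hGk : ∀ k : ℕ, ∀ x, F^[q * k] x = G^[k] x + (k : ℝ) • rv p := by
    intro k x
    induction k with
    | zero => simp
    | succ k ih =>
      rw [Nat.mul_succ, Nat.add_comm, iterate_add_apply, ih, iterate_succ_apply', hGx]
      have : (k : ℝ) • rv p = rv ((k : ℤ) • p) := by rw [rv_zsmul]; simp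
      rw [this, iter_comm (fun y => hF y _), ← this]
      push_cast
      rw [add_smul, one_smul]; abel
  obtain ⟨⟨M, hM⟩, -⟩ := disp_bounds F F.continuous hF
  have hM0 : 0 ≤ M := (norm_nonneg _).trans (hM 0)
  obtain ⟨⟨M', hM'⟩, hδ⟩ := disp_bounds G G.continuous hGc
  obtain ⟨δ, hδ0, hδ⟩ := hδ (fun x hx => hno x (by rw [hGx] at hx; exact sub_eq_iff_eq_add.mp hx))
  -- star for G
  have hstar : ∀ l : ℝ × ℝ, l ≠ 0 → ∀ K : ℝ, ∃ x, ∃ n : ℕ, K ≤ lin l (G^[n] x - x) := by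
    intro l hl K
    obtain ⟨c, hc, hr⟩ := hrot l hl
    set L := |l.1| + |l.2| with hL
    have hL0 : 0 ≤ L := by positivity
    obtain ⟨m, hm⟩ := exists_nat_gt ((K + L * (q * M) + q * |lin l v0|) / c)
    rw [div_lt_iff₀ hc] at hm
    obtain ⟨n, hn, x, hx⟩ := hr (m + 1) (by lia)
    refine ⟨x, n / q, ?_⟩
    have hnq : n % q + q * (n / q) = n := Nat.mod_add_div n q
    set k := n / q with hk
    set s := n % q with hs
    have hsq : s < q := Nat.mod_lt _ (by lia)
    rw [← hnq, iterate_add_apply] at hx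
    have e1 := abs_le.mp ((lin_bound l (F^[s] (F^[q * k] x) - F^[q * k] x)).trans
      (mul_le_mul_of_nonneg_left (iter_disp hM s _) (by positivity)))
    have e2 : (s : ℝ) ≤ q := by exact_mod_cast hsq.le
    have e3 : L * (s * M) ≤ L * (q * M) := by gcongr
    have e4 : lin l (F^[q * k] x - x) = lin l (G^[k] x - x) + k * (q * lin l v0) := by
      rw [hGk, hv0, ← lin_smul, ← lin_smul, ← lin_add]
      congr 1
      abel
    have e5 : -(q * |lin l v0|) ≤ s * lin l v0 := by
      have h1 : |s * lin l v0| ≤ q * |lin l v0| := by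
        rw [abs_mul, Nat.abs_cast]; gcongr
      exact (abs_le.mp h1).1
    have e6 : (m : ℝ) * c ≤ n * c := by
      have : (m : ℝ) ≤ n := by exact_mod_cast (by lia : m ≤ n)
      gcongr
    have e7 : (n : ℝ) = s + q * k := by exact_mod_cast hnq.symm
    rw [e7] at e6
    push_cast at hx
    have e8 : lin l (F^[s] (F^[q * k] x) - x) =
        lin l (F^[s] (F^[q * k] x) - F^[q * k] x) + lin l (F^[q * k] x - x) := by
      rw [← lin_add]; congr 1; abel
    rw [e8, e4] at hx
    have e9 := e1.2
    nlinarith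
  obtain ⟨N, hN⟩ := exists_nat_gt (1 / δ)
  rw [div_lt_iff₀ hδ0] at hN
  have hN1 : 1 ≤ N := by
    by_contra hlt
    obtain rfl : N = 0 := by lia
    norm_num at hN
  have hNR : (0 : ℝ) < N := by exact_mod_cast hN1
  set D : (ℝ × ℝ) ≃ₜ (ℝ × ℝ) := Homeomorph.smulOfNeZero (N : ℝ) hNR.ne' with hD
  have hDx : ∀ x, D x = (N : ℝ) • x := fun x => rfl
  set g : (ℝ × ℝ) ≃ₜ (ℝ × ℝ) := (D.symm.trans G).trans D with hg
  have hgx : ∀ x, g (D x) = D (G x) := by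
    intro x; simp [hg]
  have hgn : ∀ n x, g^[n] (D x) = D (G^[n] x) := by
    intro n x
    induction n with
    | zero => rfl
    | succ n ih => rw [iterate_succ_apply', ih, hgx, iterate_succ_apply']
  have hsurj : ∀ x, ∃ y, x = D y := fun x => ⟨D.symm x, by simp⟩
  have hdisp : ∀ y, ‖g (D y) - D y‖ = N * ‖G y - y‖ := by
    intro y
    rw [hgx, hDx, hDx, ← smul_sub, norm_smul, Real.norm_eq_abs, abs_of_pos hNR]
  have hrvN : ∀ v : ℤ × ℤ, rv (N • v) = D (rv v) := by
    intro v
    rw [hDx, ← natCast_zsmul, rv_zsmul]; simp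
  have hDadd : ∀ x y, D (x + y) = D x + D y := fun x y => by rw [hDx, hDx, hDx, smul_add]
  have std : Std g N :=
    { pos := hN1
      per := by
        intro x v
        obtain ⟨y, rfl⟩ := hsurj x
        rw [hrvN, ← hDadd, hgx, hGc, hDadd, hgx]
      bd := ⟨N * M', fun x => by
        obtain ⟨y, rfl⟩ := hsurj x
        rw [hdisp]
        have := hM' y
        gcongr⟩
      far := fun x => by
        obtain ⟨y, rfl⟩ := hsurj x
        rw [hdisp]
        have : (N : ℝ) * δ ≤ N * ‖G y - y‖ := by
          have := hδ y
          gcongr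
        linarith
      star := fun l hl K => by
        obtain ⟨y, n, hy⟩ := hstar l hl (K / N)
        refine ⟨D y, n, ?_⟩
        rw [hgn, hDx, hDx, ← smul_sub, lin_smul]
        rw [div_le_iff₀ hNR] at hy
        linarith }
  exact std.false

end Fr

/-- **Franks.**  Any rational point `(p₁/q, p₂/q)` in the interior of the rotation set
is realized by a periodic orbit: there is `x ∈ ℝ²` with `F^q(x) = x + (p₁, p₂)`. -/
theorem rational_interior_point_realized_by_periodic_orbit
    (f : T2 ≃ₜ T2) (F : (ℝ × ℝ) ≃ₜ (ℝ × ℝ)) (hF : IsLift ⇑f ⇑F)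
    (p₁ p₂ : ℤ) (q : ℕ) (hq : 1 ≤ q)
    (hmem : (((p₁ : ℝ) / (q : ℝ), (p₂ : ℝ) / (q : ℝ)) : ℝ × ℝ) ∈ interior (rotSet ⇑F)) :
    ∃ x : ℝ × ℝ, (⇑F)^[q] x = x + ((p₁ : ℝ), (p₂ : ℝ)) := by
  by_contra hcon
  push Not at hcon
  have hqR : (0 : ℝ) < q := by exact_mod_cast hq
  refine Fr.reduction F (fun x v => hF.2 x v) (p₁, p₂) q hq
    ((p₁ : ℝ) / (q : ℝ), (p₂ : ℝ) / (q : ℝ)) ?_ ?_ (fun x => hcon x)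
  · apply Prod.ext
    · simp only [Fr.rv, Prod.smul_fst, smul_eq_mul]; field_simp
    · simp only [Fr.rv, Prod.smul_snd, smul_eq_mul]; field_simp
  · intro l hl
    set v0 : ℝ × ℝ := ((p₁ : ℝ) / (q : ℝ), (p₂ : ℝ) / (q : ℝ)) with hv0
    have hcont : Tendsto (fun t : ℝ => v0 + t • l) (𝓝[>] 0) (𝓝 v0) := by
      have h1 : Continuous (fun t : ℝ => v0 + t • l) := by fun_prop
      have h2 := h1.tendsto 0
      simp only [zero_smul, add_zero] at h2
      exact h2.mono_left nhdsWithin_le_nhds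
    have hev := hcont.eventually (isOpen_interior.mem_nhds hmem)
    obtain ⟨ε, hε, hε0⟩ := (hev.and self_mem_nhdsWithin).exists
    have hε0 : 0 < ε := hε0
    have hll : 0 < Fr.lin l l := by
      unfold Fr.lin
      by_contra hle
      apply hl
      apply Prod.ext
      · change l.1 = 0
        nlinarith [mul_self_nonneg l.1, mul_self_nonneg l.2]
      · change l.2 = 0
        nlinarith [mul_self_nonneg l.1, mul_self_nonneg l.2]
    have hpos : 0 < ε * Fr.lin l l := mul_pos hε0 hll
    refine ⟨ε * Fr.lin l l / 2, by linarith, fun m hm => ?_⟩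
    have hmemr := interior_subset hε
    have hcl := mem_iInter₂.mp hmemr m hm
    have hopen : IsOpen {y : ℝ × ℝ | Fr.lin l v0 + ε * Fr.lin l l / 2 < Fr.lin l y} :=
      isOpen_lt continuous_const (Fr.lin_cont l)
    obtain ⟨y, hy1, hy2⟩ := mem_closure_iff.mp hcl _ hopen (by
      change Fr.lin l v0 + ε * Fr.lin l l / 2 < Fr.lin l (v0 + ε • l)
      rw [Fr.lin_add, Fr.lin_smul]; linarith)
    change Fr.lin l v0 + ε * Fr.lin l l / 2 < Fr.lin l y at hy1
    obtain ⟨n, hn, x, rfl⟩ := mem_iUnion₂.mp hy2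
    have hn' : m ≤ n := hn
    have hnR : (0 : ℝ) < n := by exact_mod_cast (by lia : 0 < n)
    refine ⟨n, hn', x, ?_⟩
    rw [Fr.lin_smul] at hy1
    have h3 := mul_lt_mul_of_pos_left hy1 hnR
    rw [mul_inv_cancel_left₀ hnR.ne'] at h3
    exact h3.le
end
end
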